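/- arXiv:1811.00190 — 2 statements merged into one kernel-verified Lean document; each statement's English description precedes it below -/
import Mathlib

section
/- Under the local blowup setup with simple blowup, there exists a constant C' > 0 independent of k such that max_{1≤i≤n} ũ_i^k(0) ≥ μ·M_k − C' for all k. Equivalently, setting ε_k = e^{−M_k/2} and ṽ_i^k(y) = ũ_i^k(ε_k y) + 2μ log ε_k, one has max_{1≤i≤n} ṽ_i^k(0) ≥ −C' for all k. -/
open MeasureTheory Metric Filter

noncomputable section

/-- The plane `ℝ²`. -/
abbrev E2 := EuclideanSpace ℝ (Fin 2)

/-- An n×n real matrix `A` satisfies (H1) if it is symmetric, has all entries nonnegative,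
is irreducible, and is invertible. -/
def H1 {n : ℕ} (A : Matrix (Fin n) (Fin n) ℝ) : Prop :=
  A.IsSymm ∧ (∀ i j, 0 ≤ A i j) ∧
  (¬ ∃ S : Finset (Fin n), S.Nonempty ∧ Sᶜ.Nonempty ∧ ∀ i ∈ S, ∀ j ∈ Sᶜ, A i j = 0) ∧
  IsUnit A.det

/-- An n×n real matrix `A` satisfies (H2) if its inverse `A⁻¹ = (aⁱʲ)` satisfies
`aⁱⁱ ≤ 0`, `aⁱʲ ≥ 0` for `i ≠ j`, and all row sums of `A⁻¹` are nonnegative. -/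
def H2 {n : ℕ} (A : Matrix (Fin n) (Fin n) ℝ) : Prop :=
  (∀ i, A⁻¹ i i ≤ 0) ∧ (∀ i j, i ≠ j → 0 ≤ A⁻¹ i j) ∧ (∀ i, 0 ≤ ∑ j, A⁻¹ i j)

/-- The Laplacian of a function on the plane, as the sum of its pure second derivatives
in the coordinate directions. -/
def lap (f : E2 → ℝ) (x : E2) : ℝ :=
  ∑ i : Fin 2, fderiv ℝ (fun y => fderiv ℝ f y (EuclideanSpace.single i 1)) x
    (EuclideanSpace.single i 1)

/-- The local blowup setup of the paper: `ũᵏ = u` is a sequence of solutions of the singular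
Liouville system `Δũᵢᵏ + Σⱼ aᵢⱼ |x|^{2γ} hⱼᵏ e^{ũⱼᵏ} = 0` on the ball `B_δ ⊂ ℝ²`, with
uniformly bounded positive `C¹` coefficient functions `hᵢᵏ`, uniformly bounded energy,
uniformly bounded boundary oscillation, blowup `M_k := (1/μ) maxᵢ max_{B_δ} ũᵢᵏ → ∞`
(`μ = 1 + γ`), and no blowup away from the origin. -/
structure LocalBlowupSetup (n : ℕ) (δ γ : ℝ) (A : Matrix (Fin n) (Fin n) ℝ)
    (h u : ℕ → Fin n → E2 → ℝ) (M : ℕ → ℝ) where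
  /-- uniform lower bound for the coefficient functions -/
  c₁ : ℝ
  /-- uniform upper bound for the coefficient functions -/
  c₂ : ℝ
  /-- uniform `C¹` bound for the coefficient functions -/
  c₃ : ℝ
  /-- uniform energy/oscillation bound -/
  C : ℝ
  hn : 0 < n
  hδ : 0 < δ
  hγ : -1 < γ
  hH1 : H1 A
  hH2 : H2 A
  c₁_pos : 0 < c₁
  h_lb : ∀ k i, ∀ x ∈ closedBall (0:E2) δ, c₁ ≤ h k i x
  h_ub : ∀ k i, ∀ x ∈ closedBall (0:E2) δ, h k i x ≤ c₂
  h_c1 : ∀ k i, ContDiffOn ℝ 1 (h k i) (closedBall (0:E2) δ)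
  h_grad : ∀ k i, ∀ x ∈ closedBall (0:E2) δ,
    ‖fderivWithin ℝ (h k i) (closedBall (0:E2) δ) x‖ ≤ c₃
  u_cont : ∀ k i, ContinuousOn (u k i) (closedBall (0:E2) δ)
  u_c2 : ∀ k i, ContDiffOn ℝ 2 (u k i) (ball (0:E2) δ \ {0})
  pde : ∀ k i, ∀ x ∈ ball (0:E2) δ \ {0},
    lap (u k i) x + ∑ j, A i j * (‖x‖ ^ (2*γ) * (h k j x * Real.exp (u k j x))) = 0
  energy : ∀ k i, ∫ x in closedBall (0:E2) δ, ‖x‖ ^ (2*γ) * (h k i x * Real.exp (u k i x)) ≤ C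
  osc : ∀ k i, ∀ x ∈ sphere (0:E2) δ, ∀ y ∈ sphere (0:E2) δ, |u k i x - u k i y| ≤ C
  M_attained : ∀ k, ∃ i, ∃ x ∈ closedBall (0:E2) δ, u k i x = (1+γ) * M k
  M_max : ∀ k i, ∀ x ∈ closedBall (0:E2) δ, u k i x ≤ (1+γ) * M k
  M_inf : Tendsto M atTop atTop
  no_blowup_away : ∀ ε, 0 < ε → ε < δ → ∃ Cε : ℝ, ∀ k i, ∀ x ∈ closedBall (0:E2) δ,
    ε ≤ ‖x‖ → u k i x + 2*γ*Real.log ‖x‖ ≤ Cε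

/-- The blowup is simple if `ũᵢᵏ(x) + 2μ log|x|` is bounded above uniformly. -/
def SimpleBlowup {n : ℕ} (δ γ : ℝ) (u : ℕ → Fin n → E2 → ℝ) : Prop :=
  ∃ C : ℝ, ∀ k i, ∀ x ∈ closedBall (0:E2) δ, x ≠ 0 →
    u k i x + 2*(1+γ)*Real.log ‖x‖ ≤ C


/-- Differentiation under the integral sign for an integrand with continuous derivative. -/
lemma hasDerivAt_intervalIntegral_of_continuousOn {F F' : ℝ → ℝ → ℝ} {U : Set ℝ}
    (hU : IsOpen U) {a b t₀ : ℝ} (ht₀ : t₀ ∈ U)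
    (hF : ContinuousOn (fun p : ℝ × ℝ => F p.1 p.2) (U ×ˢ Set.univ))
    (hF' : ContinuousOn (fun p : ℝ × ℝ => F' p.1 p.2) (U ×ˢ Set.univ))
    (hd : ∀ t ∈ U, ∀ θ, HasDerivAt (fun t => F t θ) (F' t θ) t) :
    HasDerivAt (fun t => ∫ θ in a..b, F t θ) (∫ θ in a..b, F' t₀ θ) t₀ := by
  obtain ⟨ε, hε, hεU⟩ := nhds_basis_closedBall.mem_iff.1 (hU.mem_nhds ht₀)
  have hslice : ∀ {G : ℝ → ℝ → ℝ},
      ContinuousOn (fun p : ℝ × ℝ => G p.1 p.2) (U ×ˢ Set.univ) → ∀ t ∈ U, Continuous (G t) :=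
    fun hG t ht => continuousOn_univ.1 (hG.comp (f := fun θ => (t, θ)) (by fun_prop)
      fun θ _ => ⟨ht, trivial⟩)
  obtain ⟨K, hK⟩ := ((isCompact_closedBall t₀ ε).prod (isCompact_uIcc (a := a) (b := b))
    ).exists_bound_of_continuousOn (hF'.mono (Set.prod_mono hεU (Set.subset_univ _)))
  refine (intervalIntegral.hasDerivAt_integral_of_dominated_loc_of_deriv_le
    (bound := fun _ => K) (closedBall_mem_nhds t₀ hε) ?_ ?_ ?_ ?_ ?_ ?_).2
  · filter_upwards [hU.mem_nhds ht₀] with t ht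
    exact (hslice hF t ht).aestronglyMeasurable
  · exact (hslice hF t₀ ht₀).intervalIntegrable _ _
  · exact (hslice hF' t₀ ht₀).aestronglyMeasurable
  · exact ae_of_all _ fun θ hθ t ht => hK (t, θ) ⟨ht, Set.uIoc_subset_uIcc hθ⟩
  · exact intervalIntegrable_const
  · exact ae_of_all _ fun θ _ t ht => hd t (hεU ht) θ

/-- The unit vector of the plane at angle `θ`. -/
def unitVec (θ : ℝ) : E2 :=
  Real.cos θ • EuclideanSpace.single 0 1 + Real.sin θ • EuclideanSpace.single 1 1

/-- The derivative of `unitVec`. -/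
def unitVec' (θ : ℝ) : E2 :=
  -Real.sin θ • EuclideanSpace.single 0 1 + Real.cos θ • EuclideanSpace.single 1 1

lemma hasDerivAt_unitVec (θ : ℝ) : HasDerivAt unitVec (unitVec' θ) θ :=
  ((Real.hasDerivAt_cos θ).smul_const _).add ((Real.hasDerivAt_sin θ).smul_const _)

lemma hasDerivAt_unitVec' (θ : ℝ) : HasDerivAt unitVec' (-unitVec θ) θ := by
  have h := ((Real.hasDerivAt_sin θ).neg.smul_const (EuclideanSpace.single (0 : Fin 2) (1 : ℝ))).add
    ((Real.hasDerivAt_cos θ).smul_const (EuclideanSpace.single (1 : Fin 2) (1 : ℝ)))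
  refine h.congr_deriv ?_
  rw [unitVec, neg_add, neg_smul, neg_smul]

@[fun_prop]
lemma continuous_unitVec : Continuous unitVec := by
  unfold unitVec; fun_prop

@[fun_prop]
lemma continuous_unitVec' : Continuous unitVec' := by
  unfold unitVec'; fun_prop

lemma norm_unitVec (θ : ℝ) : ‖unitVec θ‖ = 1 := by
  simp [unitVec, EuclideanSpace.norm_eq]

lemma lap_eq_unitVec {w : E2 → ℝ} {x : E2} (hw : DifferentiableAt ℝ (fderiv ℝ w) x) (θ : ℝ) :
    lap w x = fderiv ℝ (fderiv ℝ w) x (unitVec θ) (unitVec θ) +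
      fderiv ℝ (fderiv ℝ w) x (unitVec' θ) (unitVec' θ) := by
  have h : ∀ v : E2, fderiv ℝ (fun y => fderiv ℝ w y v) x v = fderiv ℝ (fderiv ℝ w) x v v := by
    intro v
    rw [fderiv_clm_apply hw (differentiableAt_const v)]
    simp
  simp only [lap, Fin.sum_univ_two, h, unitVec, unitVec', map_add, map_smul,
    add_apply, smul_apply, smul_eq_mul]
  linear_combination -(fderiv ℝ (fderiv ℝ w) x (EuclideanSpace.single 0 1)
    (EuclideanSpace.single 0 1) + fderiv ℝ (fderiv ℝ w) x (EuclideanSpace.single 1 1)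
    (EuclideanSpace.single 1 1)) * Real.sin_sq_add_cos_sq θ

lemma add_smul_unitVec_mem {c : E2} {R r : ℝ} (hr : 0 < r) (hrR : r < R) (θ : ℝ) :
    c + r • unitVec θ ∈ ball c R \ {c} := by
  have h : ‖r • unitVec θ‖ = r := by rw [norm_smul, norm_unitVec, mul_one, Real.norm_of_nonneg hr.le]
  refine ⟨by simpa [h] using hrR, fun hc => ?_⟩
  rw [Set.mem_singleton_iff, add_eq_left] at hc
  rw [hc, norm_zero] at h
  exact hr.ne h

set_option maxHeartbeats 1000000 in
/-- Circle integrals of a subharmonic function are convex in the logarithm of the radius. -/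
lemma convexOn_circleIntegral {w : E2 → ℝ} {c : E2} {R : ℝ} (hR : 0 < R)
    (hw : ContDiffOn ℝ 2 w (ball c R \ {c})) (hlap : ∀ x ∈ ball c R \ {c}, 0 ≤ lap w x) :
    ConvexOn ℝ (Set.Iio (Real.log R))
      (fun t => ∫ θ in -Real.pi..Real.pi, w (c + Real.exp t • unitVec θ)) := by
  set U : Set E2 := ball c R \ {c} with hUdef
  have hU : IsOpen U := isOpen_ball.sdiff isClosed_singleton
  set I : Set ℝ := Set.Iio (Real.log R)
  have hI : IsOpen I := isOpen_Iio
  set X : ℝ → ℝ → E2 := fun t θ => c + Real.exp t • unitVec θ with hX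
  have hXU : ∀ t ∈ I, ∀ θ, X t θ ∈ U := fun t ht θ =>
    add_smul_unitVec_mem (Real.exp_pos t) ((Real.lt_log_iff_exp_lt hR).1 ht) θ
  have hXc : ContinuousOn (fun p : ℝ × ℝ => X p.1 p.2) (I ×ˢ Set.univ) := by
    simp only [hX]; fun_prop
  have hXm : Set.MapsTo (fun p : ℝ × ℝ => X p.1 p.2) (I ×ˢ Set.univ) U :=
    fun p hp => hXU p.1 hp.1 p.2
  have hDw : ∀ x ∈ U, HasFDerivAt w (fderiv ℝ w x) x := fun x hx =>
    ((hw.contDiffAt (hU.mem_nhds hx)).differentiableAt (by norm_num)).hasFDerivAt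
  have hD1 : ContDiffOn ℝ 1 (fderiv ℝ w) U := hw.fderiv_of_isOpen hU (by norm_num)
  have hD2 : ∀ x ∈ U, HasFDerivAt (fderiv ℝ w) (fderiv ℝ (fderiv ℝ w) x) x := fun x hx =>
    ((hD1.contDiffAt (hU.mem_nhds hx)).differentiableAt (by norm_num)).hasFDerivAt
  have hD2c : ContinuousOn (fderiv ℝ (fderiv ℝ w)) U :=
    hD1.continuousOn_fderiv_of_isOpen hU (by norm_num)
  have hw0 := hw.continuousOn.comp hXc hXm
  have hw1 := hD1.continuousOn.comp hXc hXm
  have hw2 := hD2c.comp hXc hXm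
  have hXt : ∀ t θ, HasDerivAt (fun t => X t θ) (Real.exp t • unitVec θ) t := fun t θ =>
    ((Real.hasDerivAt_exp t).smul_const _).const_add c
  have hXθ : ∀ t θ, HasDerivAt (fun θ => X t θ) (Real.exp t • unitVec' θ) θ := fun t θ =>
    ((hasDerivAt_unitVec θ).fun_const_smul _).const_add c
  set g1 : ℝ → ℝ → ℝ := fun t θ => fderiv ℝ w (X t θ) (Real.exp t • unitVec θ) with hg1
  set g2 : ℝ → ℝ → ℝ := fun t θ =>
    fderiv ℝ (fderiv ℝ w) (X t θ) (Real.exp t • unitVec θ) (Real.exp t • unitVec θ) +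
      fderiv ℝ w (X t θ) (Real.exp t • unitVec θ) with hg2
  set q2 : ℝ → ℝ → ℝ := fun t θ =>
    fderiv ℝ (fderiv ℝ w) (X t θ) (Real.exp t • unitVec' θ) (Real.exp t • unitVec' θ) +
      fderiv ℝ w (X t θ) (Real.exp t • -unitVec θ) with hq2
  have hg1c : ContinuousOn (fun p : ℝ × ℝ => g1 p.1 p.2) (I ×ˢ Set.univ) :=
    hw1.clm_apply (by fun_prop)
  have hg2c : ContinuousOn (fun p : ℝ × ℝ => g2 p.1 p.2) (I ×ˢ Set.univ) :=
    ((hw2.clm_apply (by fun_prop)).clm_apply (by fun_prop)).add hg1c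
  have hq2c : ContinuousOn (fun p : ℝ × ℝ => q2 p.1 p.2) (I ×ˢ Set.univ) :=
    ((hw2.clm_apply (by fun_prop)).clm_apply (by fun_prop)).add (hw1.clm_apply (by fun_prop))
  have hslice : ∀ {G : ℝ → ℝ → ℝ},
      ContinuousOn (fun p : ℝ × ℝ => G p.1 p.2) (I ×ˢ Set.univ) → ∀ t ∈ I, Continuous (G t) :=
    fun hG t ht => continuousOn_univ.1 (hG.comp (f := fun θ => (t, θ)) (by fun_prop)
      fun θ _ => ⟨ht, trivial⟩)
  have hd1 : ∀ t ∈ I, ∀ θ, HasDerivAt (fun t => w (X t θ)) (g1 t θ) t := fun t ht θ =>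
    (hDw _ (hXU t ht θ)).comp_hasDerivAt t (hXt t θ)
  have hd2 : ∀ t ∈ I, ∀ θ, HasDerivAt (fun t => g1 t θ) (g2 t θ) t := fun t ht θ =>
    ((hD2 _ (hXU t ht θ)).comp_hasDerivAt t (hXt t θ)).clm_apply
      ((Real.hasDerivAt_exp t).smul_const _)
  have hdq : ∀ t ∈ I, ∀ θ, HasDerivAt (fun θ => fderiv ℝ w (X t θ) (Real.exp t • unitVec' θ))
      (q2 t θ) θ := fun t ht θ =>
    ((hD2 _ (hXU t ht θ)).comp_hasDerivAt θ (hXθ t θ)).clm_apply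
      ((hasDerivAt_unitVec' θ).fun_const_smul _)
  have hm1 := fun t (ht : t ∈ I) => hasDerivAt_intervalIntegral_of_continuousOn hI (a := -Real.pi)
    (b := Real.pi) (F := fun t θ => w (X t θ)) ht hw0 hg1c hd1
  have hm2 := fun t (ht : t ∈ I) => hasDerivAt_intervalIntegral_of_continuousOn hI (a := -Real.pi)
    (b := Real.pi) ht hg1c hg2c hd2
  refine convexOn_of_hasDerivWithinAt2_nonneg (f' := fun t => ∫ θ in -Real.pi..Real.pi, g1 t θ)
    (f'' := fun t => ∫ θ in -Real.pi..Real.pi, g2 t θ) (convex_Iio _)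
    (fun t ht => (hm1 t ht).continuousAt.continuousWithinAt)
    (fun t ht => (hm1 t (interior_subset ht)).hasDerivWithinAt)
    (fun t ht => (hm2 t (interior_subset ht)).hasDerivWithinAt) fun t ht => ?_
  replace ht : t ∈ I := interior_subset ht
  have hq0 : ∫ θ in -Real.pi..Real.pi, q2 t θ = 0 := by
    rw [intervalIntegral.integral_eq_sub_of_hasDerivAt (fun θ _ => hdq t ht θ)
      ((hslice hq2c t ht).intervalIntegrable _ _)]
    simp [hX, unitVec, unitVec']
  have hsum := intervalIntegral.integral_add (μ := volume)
    ((hslice hg2c t ht).intervalIntegrable (-Real.pi) Real.pi)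
    ((hslice hq2c t ht).intervalIntegrable (-Real.pi) Real.pi)
  rw [hq0, add_zero] at hsum
  rw [← hsum]
  refine intervalIntegral.integral_nonneg (by linarith [Real.pi_pos]) fun θ _ => ?_
  have h := lap_eq_unitVec (hD2 _ (hXU t ht θ)).differentiableAt θ
  have h' : g2 t θ + q2 t θ = Real.exp t ^ 2 * lap w (X t θ) := by
    rw [h]
    simp only [hg2, hq2, map_smul, map_neg, smul_apply, smul_eq_mul]
    ring
  rw [h']
  exact mul_nonneg (sq_nonneg _) (hlap _ (hXU t ht θ))

/-- A convex function on a left half-line that is bounded near `-∞` is monotone. -/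
lemma ConvexOn.le_of_tendsto_atBot {m : ℝ → ℝ} {T L : ℝ} (hm : ConvexOn ℝ (Set.Iio T) m)
    (hL : Tendsto m atBot (nhds L)) {t : ℝ} (ht : t < T) : L ≤ m t := by
  by_contra! hlt
  have hev : ∀ᶠ s in atBot, (L + m t) / 2 < m s := hL.eventually_const_lt (by linarith)
  obtain ⟨s₀, hs₀t, hs₀⟩ := ((eventually_lt_atBot t).and hev).exists
  set d := (m s₀ - m t) / (t - s₀)
  have hd : 0 < d := div_pos (by linarith) (by linarith)
  have hbig : ∀ s < s₀, m s₀ + d * (s₀ - s) ≤ m s := by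
    intro s hs
    have h := hm.slope_mono_adjacent (x := s) (y := s₀) (z := t) (hs.trans (hs₀t.trans ht)) ht hs hs₀t
    have h' : (m t - m s₀) / (t - s₀) = -d := by rw [← neg_sub, neg_div]
    rw [h', div_le_iff₀ (by linarith)] at h
    linarith
  have hup : ∀ᶠ s in atBot, m s < L + 1 := hL.eventually_lt_const (by linarith)
  obtain ⟨s, ⟨hs1, hs2⟩, hs3⟩ := ((hup.and (eventually_lt_atBot s₀)).and
    (eventually_lt_atBot (s₀ - (L + 1 - m s₀) / d))).exists
  have h1 := hbig s hs2
  have h2 : (L + 1 - m s₀) < d * (s₀ - s) := by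
    rw [mul_comm, ← div_lt_iff₀ hd]; linarith
  linarith

/-- Mean value inequality on circles for functions that are subharmonic off the center. -/
lemma le_circleIntegral_of_lap_nonneg {w : E2 → ℝ} {c : E2} {R r : ℝ} (hr : 0 < r) (hrR : r < R)
    (hwc : ContinuousAt w c) (hw : ContDiffOn ℝ 2 w (ball c R \ {c}))
    (hlap : ∀ x ∈ ball c R \ {c}, 0 ≤ lap w x) :
    2 * Real.pi * w c ≤ ∫ θ in -Real.pi..Real.pi, w (c + r • unitVec θ) := by
  have hR := hr.trans hrR
  have hlim : Tendsto (fun t => ∫ θ in -Real.pi..Real.pi, w (c + Real.exp t • unitVec θ)) atBot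
      (nhds (2 * Real.pi * w c)) := by
    rw [Metric.tendsto_nhds]
    intro ε hε
    obtain ⟨η, hη, hηw⟩ := Metric.continuousAt_iff.1 hwc (ε / (2 * Real.pi + 1)) (by positivity)
    filter_upwards [eventually_lt_atBot (Real.log (min η R))] with t ht
    have ht' := (Real.lt_log_iff_exp_lt (lt_min hη hR)).1 ht
    have hcont : Continuous fun θ => w (c + Real.exp t • unitVec θ) :=
      continuousOn_univ.1 (hw.continuousOn.comp (f := fun θ => c + Real.exp t • unitVec θ)
        (by fun_prop) fun θ _ => add_smul_unitVec_mem (Real.exp_pos t)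
          (ht'.trans_le (min_le_right _ _)) θ)
    have hconst : 2 * Real.pi * w c = ∫ θ in -Real.pi..Real.pi, w c := by
      rw [intervalIntegral.integral_const, smul_eq_mul]; ring
    rw [hconst, Real.dist_eq, ← intervalIntegral.integral_sub (hcont.intervalIntegrable _ _)
      intervalIntegrable_const, ← Real.norm_eq_abs]
    have hb : ∀ θ ∈ Set.uIoc (-Real.pi) Real.pi,
        ‖w (c + Real.exp t • unitVec θ) - w c‖ ≤ ε / (2 * Real.pi + 1) := by
      intro θ _
      rw [← dist_eq_norm]
      refine (hηw ?_).le
      rw [dist_eq_norm, add_sub_cancel_left, norm_smul, norm_unitVec, mul_one,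
        Real.norm_of_nonneg (Real.exp_pos t).le]
      exact ht'.trans_le (min_le_left _ _)
    refine (intervalIntegral.norm_integral_le_of_norm_le_const hb).trans_lt ?_
    have hpi := Real.pi_pos
    rw [abs_of_pos (by linarith), div_mul_eq_mul_div, div_lt_iff₀ (by linarith)]
    nlinarith
  have h := (convexOn_circleIntegral hR hw hlap).le_of_tendsto_atBot hlim
    (Real.log_lt_log hr hrR)
  simpa only [Real.exp_log hr] using h

lemma lap_sub {f g : E2 → ℝ} {x : E2} (hf : ContDiffAt ℝ 2 f x) (hg : ContDiffAt ℝ 2 g x) :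
    lap (fun y => f y - g y) x = lap f x - lap g x := by
  have key : ∀ {f : E2 → ℝ} (v : E2), ContDiffAt ℝ 2 f x →
      DifferentiableAt ℝ (fun y => fderiv ℝ f y v) x := fun v hf =>
    (((hf.fderiv_right (m := 1) (by norm_num)).differentiableAt (by norm_num))).clm_apply
      (differentiableAt_const v)
  simp only [lap, ← Finset.sum_sub_distrib]
  refine Finset.sum_congr rfl fun i _ => ?_
  rw [← sub_apply, ← fderiv_fun_sub (key _ hf) (key _ hg)]
  have hev : ∀ {f : E2 → ℝ}, ContDiffAt ℝ 2 f x → ∀ᶠ y in nhds x, DifferentiableAt ℝ f y :=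
    fun hf => (hf.eventually (by simp)).mono fun y hy => hy.differentiableAt (by norm_num)
  refine congrArg (fun L : E2 →L[ℝ] ℝ => L (EuclideanSpace.single i 1)) (EventuallyEq.fderiv_eq ?_)
  filter_upwards [hev hf, hev hg] with y h1 h2
  rw [fderiv_fun_sub h1 h2, sub_apply]

lemma lap_const (a : ℝ) (x : E2) : lap (fun _ => a) x = 0 := by
  simp [lap]

lemma lap_const_mul_norm_sub_sq (a : ℝ) (c x : E2) :
    lap (fun y => a * ‖y - c‖ ^ 2) x = 4 * a := by
  have h : ∀ y v : E2, fderiv ℝ (fun y => a * ‖y - c‖ ^ 2) y v = a * (2 * inner ℝ (y - c) v) := by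
    intro y v
    have := (((hasFDerivAt_id y).sub_const c).norm_sq).const_mul a
    erw [this.fderiv]
    simp [inner_sub_left]
  simp only [lap, h]
  have h2 : ∀ v : E2, fderiv ℝ (fun y : E2 => a * (2 * inner ℝ (y - c) v)) x v
      = a * (2 * inner ℝ v v) := by
    intro v
    have := (((((hasFDerivAt_id x).sub_const c).inner ℝ (hasFDerivAt_const v x)).const_mul
      2).const_mul a)
    erw [this.fderiv]
    simp
  simp only [h2, Fin.sum_univ_two]
  simp
  ring

/-- The plane point with given Cartesian coordinates. -/
def ofCoords (p : ℝ × ℝ) : E2 :=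
  p.1 • EuclideanSpace.single 0 1 + p.2 • EuclideanSpace.single 1 1

@[fun_prop]
lemma continuous_ofCoords : Continuous ofCoords := by
  unfold ofCoords; fun_prop

lemma exists_ofCoords_eq (c : E2) : ∃ q, ofCoords q = c := by
  refine ⟨(c 0, c 1), ?_⟩
  ext i
  fin_cases i <;> simp [ofCoords]

lemma ofCoords_add (p q : ℝ × ℝ) : ofCoords (p + q) = ofCoords p + ofCoords q := by
  simp only [ofCoords, Prod.fst_add, Prod.snd_add]
  module

lemma ofCoords_polarCoord_symm (p : ℝ × ℝ) : ofCoords (polarCoord.symm p) = p.1 • unitVec p.2 := by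
  simp only [ofCoords, polarCoord_symm_apply, unitVec, smul_add, smul_smul]

lemma isClosed_ofCoords_preimage (c : E2) (s : ℝ) : IsClosed (ofCoords ⁻¹' closedBall c s) :=
  isClosed_closedBall.preimage continuous_ofCoords

lemma isCompact_ofCoords_preimage (c : E2) (s : ℝ) : IsCompact (ofCoords ⁻¹' closedBall c s) := by
  refine (((isCompact_closedBall c s).image (f := fun x : E2 => (x 0, x 1))
    (by fun_prop)).of_isClosed_subset (isClosed_ofCoords_preimage c s)) fun p hp => ?_
  exact ⟨ofCoords p, hp, by simp [ofCoords]⟩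

lemma integrableOn_ofCoords {w : E2 → ℝ} {c : E2} {s : ℝ}
    (hw : ContinuousOn w (closedBall c s)) :
    IntegrableOn (fun p => w (ofCoords p)) (ofCoords ⁻¹' closedBall c s) :=
  (hw.comp continuous_ofCoords.continuousOn fun _ hp => hp).integrableOn_compact
    (isCompact_ofCoords_preimage c s)

/-- Integration over a disk in polar coordinates around its center. -/
lemma setIntegral_closedBall_eq {w : E2 → ℝ} {c : E2} {s : ℝ} (hs : 0 ≤ s)
    (hw : ContinuousOn w (closedBall c s)) :
    IntervalIntegrable (fun r => r * ∫ θ in -Real.pi..Real.pi, w (c + r • unitVec θ)) volume 0 s ∧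
    ∫ p in ofCoords ⁻¹' closedBall c s, w (ofCoords p) =
      ∫ r in (0 : ℝ)..s, r * ∫ θ in -Real.pi..Real.pi, w (c + r • unitVec θ) := by
  obtain ⟨q, rfl⟩ := exists_ofCoords_eq c
  have hpi : -Real.pi ≤ Real.pi := by linarith [Real.pi_pos]
  set G : ℝ × ℝ → ℝ := fun p => p.1 * w (ofCoords q + p.1 • unitVec p.2)
  have hmem : ∀ r θ : ℝ, 0 ≤ r → (ofCoords q + r • unitVec θ ∈ closedBall (ofCoords q) s ↔ r ≤ s) := by
    intro r θ hr
    rw [mem_closedBall, dist_eq_norm, add_sub_cancel_left, norm_smul, norm_unitVec, mul_one,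
      Real.norm_of_nonneg hr]
  have hGc : ContinuousOn G (Set.Icc 0 s ×ˢ Set.Icc (-Real.pi) Real.pi) := by
    refine ContinuousOn.mul (by fun_prop) (hw.comp (by fun_prop) fun p hp => ?_)
    exact (hmem _ _ hp.1.1).2 hp.1.2
  have hGi : IntegrableOn G (Set.Ioc 0 s ×ˢ Set.Ioc (-Real.pi) Real.pi) :=
    (hGc.integrableOn_compact (isCompact_Icc.prod isCompact_Icc)).mono_set
      (Set.prod_mono Set.Ioc_subset_Icc_self Set.Ioc_subset_Icc_self)
  have hinner : ∀ r, ∫ θ in Set.Ioc (-Real.pi) Real.pi, G (r, θ) =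
      r * ∫ θ in -Real.pi..Real.pi, w (ofCoords q + r • unitVec θ) := by
    intro r
    rw [intervalIntegral.integral_of_le hpi, ← integral_const_mul]
  constructor
  · rw [intervalIntegrable_iff_integrableOn_Ioc_of_le hs]
    have := hGi
    rw [IntegrableOn, Measure.volume_eq_prod, ← Measure.prod_restrict] at this
    exact this.integral_prod_left.congr (ae_of_all _ hinner)
  · rw [intervalIntegral.integral_of_le hs]
    simp only [← hinner]
    rw [← setIntegral_prod G (by rw [← Measure.volume_eq_prod]; exact hGi),
      ← Measure.volume_eq_prod,
      ← integral_indicator (isClosed_ofCoords_preimage _ _).measurableSet,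
      ← integral_add_right_eq_self _ q, ← integral_comp_polarCoord_symm,
      ← integral_indicator (measurableSet_Ioc.prod measurableSet_Ioc),
      ← integral_indicator polarCoord.open_target.measurableSet]
    refine integral_congr_ae ?_
    have hne : ∀ᵐ p : ℝ × ℝ, p.2 ≠ Real.pi := by
      rw [Measure.volume_eq_prod]
      exact Measure.quasiMeasurePreserving_snd.ae (Measure.ae_ne volume Real.pi)
    filter_upwards [hne] with p hp
    have hco : ofCoords (polarCoord.symm p + q) = ofCoords q + p.1 • unitVec p.2 := by
      rw [ofCoords_add, ofCoords_polarCoord_symm, add_comm]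
    have hD : 0 < p.1 →
        (polarCoord.symm p + q ∈ ofCoords ⁻¹' closedBall (ofCoords q) s ↔ p.1 ≤ s) := fun h => by
      rw [Set.mem_preimage, hco, hmem _ _ h.le]
    by_cases hp1 : p ∈ polarCoord.target
    · have hp' : 0 < p.1 ∧ -Real.pi < p.2 ∧ p.2 < Real.pi := hp1
      rw [Set.indicator_of_mem hp1]
      by_cases hps : p.1 ≤ s
      · rw [Set.indicator_of_mem ((hD hp'.1).2 hps), Set.indicator_of_mem, hco, smul_eq_mul]
        exact ⟨⟨hp'.1, hps⟩, hp'.2.1, hp'.2.2.le⟩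
      · rw [Set.indicator_of_notMem (mt (hD hp'.1).1 hps), Set.indicator_of_notMem, smul_zero]
        exact fun h => hps h.1.2
    · rw [Set.indicator_of_notMem hp1, Set.indicator_of_notMem]
      exact fun h => hp1 ⟨h.1.1, h.2.1, lt_of_le_of_ne h.2.2 hp⟩

/-- Harnack inequality for nonnegative functions with Laplacian in `[0, Λ]`. -/
lemma harnack_of_lap_bounded {w : E2 → ℝ} {y z : E2} {s R Λ : ℝ} (hs : 0 < s) (hR : 2 * s < R)
    (hw : ContDiffOn ℝ 2 w (ball y R)) (hw0 : ∀ x ∈ ball y R, 0 ≤ w x)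
    (hlap : ∀ x ∈ ball y R, 0 ≤ lap w x) (hlap' : ∀ x ∈ ball y R, lap w x ≤ Λ)
    (hz : dist z y ≤ s) : w z ≤ 4 * (w y + Λ * s ^ 2) := by
  have hpi := Real.pi_pos
  have hyR : y ∈ ball y R := mem_ball_self (by linarith)
  have hΛ : 0 ≤ Λ := (hlap y hyR).trans (hlap' y hyR)
  have hzR : ball z (R - s) ⊆ ball y R := ball_subset_ball' (by linarith)
  have hzy : closedBall z s ⊆ closedBall y (2 * s) := closedBall_subset_closedBall' (by linarith)
  have hyc : closedBall y (2 * s) ⊆ ball y R := closedBall_subset_ball hR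
  have hCy := hw.continuousOn.mono hyc
  obtain ⟨hiz, hez⟩ := setIntegral_closedBall_eq hs.le (hCy.mono hzy)
  obtain ⟨hiy, hey⟩ := setIntegral_closedBall_eq (by linarith : 0 ≤ 2 * s) hCy
  have hcirc : ∀ r ∈ Set.Icc 0 s,
      r * (2 * Real.pi * w z) ≤ r * ∫ θ in -Real.pi..Real.pi, w (z + r • unitVec θ) := by
    intro r hr
    rcases hr.1.eq_or_lt with rfl | hr0
    · simp
    refine mul_le_mul_of_nonneg_left (le_circleIntegral_of_lap_nonneg hr0 (R := R - s)
      (by linarith [hr.2]) ?_ (hw.mono (Set.sdiff_subset.trans hzR))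
      fun x hx => hlap x (hzR hx.1)) hr0.le
    exact hw.continuousOn.continuousAt (isOpen_ball.mem_nhds (hzR (mem_ball_self (by linarith))))
  have hcirc' : ∀ r ∈ Set.Icc 0 (2 * s), r * ∫ θ in -Real.pi..Real.pi, w (y + r • unitVec θ) ≤
      r * (2 * Real.pi * (w y + Λ * s ^ 2)) := by
    intro r hr
    rcases hr.1.eq_or_lt with rfl | hr0
    · simp
    refine mul_le_mul_of_nonneg_left ?_ hr0.le
    have hqs : ContDiff ℝ 2 fun x : E2 => Λ / 4 * ‖x - y‖ ^ 2 :=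
      contDiff_const.mul ((contDiff_id.sub contDiff_const).norm_sq ℝ)
    have h := le_circleIntegral_of_lap_nonneg (w := fun x => Λ / 4 * ‖x - y‖ ^ 2 - w x) hr0
      (hr.2.trans_lt hR)
      (hqs.continuous.continuousAt.sub (hw.continuousOn.continuousAt (isOpen_ball.mem_nhds hyR)))
      ((hqs.contDiffOn.sub hw).mono Set.sdiff_subset) fun x hx => by
        rw [lap_sub hqs.contDiffAt (hw.contDiffAt (isOpen_ball.mem_nhds hx.1)),
          lap_const_mul_norm_sub_sq]
        linarith [hlap' x hx.1]
    have hcont : Continuous fun θ => w (y + r • unitVec θ) :=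
      continuousOn_univ.1 (hw.continuousOn.comp (f := fun θ => y + r • unitVec θ)
        (by fun_prop) fun θ _ => (add_smul_unitVec_mem hr0 (hr.2.trans_lt hR) θ).1)
    have hn : ∀ θ, ‖y + r • unitVec θ - y‖ = r := fun θ => by
      rw [add_sub_cancel_left, norm_smul, norm_unitVec, mul_one, Real.norm_of_nonneg hr0.le]
    simp only [hn] at h
    rw [intervalIntegral.integral_sub intervalIntegrable_const (hcont.intervalIntegrable _ _),
      intervalIntegral.integral_const] at h
    simp only [sub_self, norm_zero, smul_eq_mul] at h
    have hr2 : r ^ 2 ≤ (2 * s) ^ 2 := pow_le_pow_left₀ hr0.le hr.2 2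
    have := mul_le_mul_of_nonneg_left hr2 (mul_nonneg hpi.le hΛ)
    nlinarith
  have hint : ∀ b K : ℝ, IntervalIntegrable (fun r => r * K) volume 0 b ∧
      ∫ r in (0 : ℝ)..b, r * K = b ^ 2 / 2 * K := fun b K =>
    ⟨Continuous.intervalIntegrable (by fun_prop) _ _, by
      rw [intervalIntegral.integral_mul_const, integral_id]; ring⟩
  have h1 : s ^ 2 / 2 * (2 * Real.pi * w z) ≤ ∫ p in ofCoords ⁻¹' closedBall z s, w (ofCoords p) := by
    rw [hez]
    rw [← (hint _ _).2]
    exact intervalIntegral.integral_mono_on hs.le (hint _ _).1 hiz hcirc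
  have h2 : ∫ p in ofCoords ⁻¹' closedBall y (2 * s), w (ofCoords p) ≤
      (2 * s) ^ 2 / 2 * (2 * Real.pi * (w y + Λ * s ^ 2)) := by
    rw [hey]
    rw [← (hint _ _).2]
    exact intervalIntegral.integral_mono_on (by linarith) hiy (hint _ _).1 hcirc'
  have h3 : ∫ p in ofCoords ⁻¹' closedBall z s, w (ofCoords p) ≤
      ∫ p in ofCoords ⁻¹' closedBall y (2 * s), w (ofCoords p) := by
    refine setIntegral_mono_set (integrableOn_ofCoords hCy) ?_
      (Set.preimage_mono hzy).eventuallyLE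
    exact (ae_restrict_mem (isClosed_ofCoords_preimage _ _).measurableSet).mono
      fun p hp => hw0 _ (hyc hp)
  have h4 : (s ^ 2 * Real.pi) * w z ≤ (s ^ 2 * Real.pi) * (4 * (w y + Λ * s ^ 2)) := by linarith
  exact le_of_mul_le_mul_left h4 (by positivity)

lemma norm_unitVec_sub_le (θ θ' : ℝ) : ‖unitVec θ - unitVec θ'‖ ≤ |θ - θ'| := by
  have h := convex_univ.norm_image_sub_le_of_norm_hasDerivWithin_le (f := unitVec)
    (f' := unitVec') (C := 1) (fun x _ => (hasDerivAt_unitVec x).hasDerivWithinAt)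
    (fun x _ => by simp [unitVec', EuclideanSpace.norm_eq]) (Set.mem_univ θ') (Set.mem_univ θ)
  rwa [one_mul, Real.norm_eq_abs] at h

lemma exists_eq_norm_smul_unitVec (x : E2) : ∃ θ, |θ| ≤ Real.pi ∧ x = ‖x‖ • unitVec θ := by
  have hn : ‖(⟨x 0, x 1⟩ : ℂ)‖ = ‖x‖ := by
    rw [Complex.norm_eq_sqrt_sq_add_sq, EuclideanSpace.norm_eq]
    simp
  refine ⟨Complex.arg ⟨x 0, x 1⟩, Complex.abs_arg_le_pi _, ?_⟩
  have h0 := Complex.norm_mul_cos_arg ⟨x 0, x 1⟩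
  have h1 := Complex.norm_mul_sin_arg ⟨x 0, x 1⟩
  rw [hn] at h0 h1
  ext i
  fin_cases i <;> simp [unitVec, h0, h1]

/-- If a nonnegative function on a disk, subharmonic off the center, vanishes at a point of
radius `ρ` and its Laplacian is at most `Λ / ρ ^ 2` at radii comparable to `ρ`, then its value at
the center is bounded in terms of `Λ`. -/
lemma apply_zero_le_of_lap_bounded {w : E2 → ℝ} {δ Λ : ℝ} {x₀ : E2} (hx₀ : x₀ ≠ 0)
    (hδ : 2 * ‖x₀‖ < δ) (hΛ : 0 ≤ Λ) (hwc : ContinuousAt w 0)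
    (hw : ContDiffOn ℝ 2 w (ball 0 δ \ {0})) (hw0 : ∀ x ∈ ball 0 δ \ {0}, 0 ≤ w x)
    (hlap : ∀ x ∈ ball 0 δ \ {0}, 0 ≤ lap w x)
    (hlap' : ∀ x, ‖x₀‖ / 4 < ‖x‖ → ‖x‖ < 2 * ‖x₀‖ → lap w x ≤ Λ / ‖x₀‖ ^ 2)
    (hwx₀ : w x₀ = 0) : w 0 ≤ 8 ^ 28 * Λ := by
  have hρ : 0 < ‖x₀‖ := norm_pos_iff.2 hx₀
  set ρ := ‖x₀‖
  have hpi := Real.pi_pos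
  have hstep : ∀ θ θ' : ℝ, |θ' - θ| ≤ 1 / 4 →
      w (ρ • unitVec θ') ≤ 4 * (w (ρ • unitVec θ) + Λ) := by
    intro θ θ' hθ
    have hn : ‖ρ • unitVec θ‖ = ρ := by
      rw [norm_smul, norm_unitVec, mul_one, Real.norm_of_nonneg hρ.le]
    have hann : ∀ x ∈ ball (ρ • unitVec θ) (3 / 4 * ρ), ρ / 4 < ‖x‖ ∧ ‖x‖ < 2 * ρ := by
      intro x hx
      rw [mem_ball, dist_eq_norm] at hx
      have h1 := norm_sub_norm_le x (ρ • unitVec θ)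
      have h2 := norm_sub_norm_le (ρ • unitVec θ) x
      rw [norm_sub_rev] at h2
      constructor <;> linarith
    have hsub : ball (ρ • unitVec θ) (3 / 4 * ρ) ⊆ ball 0 δ \ {0} := fun x hx =>
      ⟨by simpa using (hann x hx).2.trans hδ, fun h0 => by
        have := (hann x hx).1
        rw [Set.mem_singleton_iff.1 h0, norm_zero] at this
        linarith⟩
    have h := harnack_of_lap_bounded (s := ρ / 4) (by linarith) (by linarith) (hw.mono hsub)
      (fun x hx => hw0 x (hsub hx)) (fun x hx => hlap x (hsub hx))
      (fun x hx => hlap' x (hann x hx).1 (hann x hx).2) (z := ρ • unitVec θ') (by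
        rw [dist_eq_norm, ← smul_sub, norm_smul, Real.norm_of_nonneg hρ.le]
        have := (norm_unitVec_sub_le θ' θ).trans hθ
        nlinarith)
    have h' : Λ / ρ ^ 2 * (ρ / 4) ^ 2 = Λ / 16 := by field_simp; norm_num
    rw [h'] at h
    linarith
  obtain ⟨θ₀, hθ₀, hx₀θ⟩ := exists_eq_norm_smul_unitVec x₀
  have hchain : ∀ (m : ℕ) (θ : ℝ), |θ - θ₀| ≤ m / 4 → w (ρ • unitVec θ) ≤ 8 ^ m * Λ := by
    intro m
    induction m with
    | zero =>
      intro θ hθ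
      have : θ = θ₀ := by
        rw [Nat.cast_zero, zero_div] at hθ
        exact sub_eq_zero.1 (abs_nonpos_iff.1 hθ)
      rw [this, ← hx₀θ, hwx₀]
      positivity
    | succ m ih =>
      intro θ hθ
      have hm : (0 : ℝ) < m + 1 := by positivity
      push_cast at hθ
      have e1 : θ₀ + m / (m + 1) * (θ - θ₀) - θ₀ = m / (m + 1) * (θ - θ₀) := by ring
      have e2 : θ - (θ₀ + m / (m + 1) * (θ - θ₀)) = (θ - θ₀) / (m + 1) := by field_simp; ring
      have h1 := ih (θ₀ + m / (m + 1) * (θ - θ₀)) (by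
        rw [e1, abs_mul, abs_of_nonneg (by positivity)]
        calc (m : ℝ) / (m + 1) * |θ - θ₀| ≤ m / (m + 1) * ((m + 1) / 4) := by gcongr
          _ = m / 4 := by field_simp)
      have h2 := hstep (θ₀ + m / (m + 1) * (θ - θ₀)) θ (by
        rw [e2, abs_div, abs_of_pos hm, div_le_iff₀ hm]
        linarith)
      have h3 : 1 * Λ ≤ 8 ^ m * Λ := mul_le_mul_of_nonneg_right (one_le_pow₀ (by norm_num)) hΛ
      rw [pow_succ]
      linarith
  have hcirc := le_circleIntegral_of_lap_nonneg hρ (by linarith) hwc hw hlap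
  simp only [zero_add] at hcirc
  have hcont : Continuous fun θ => w (ρ • unitVec θ) :=
    continuousOn_univ.1 (hw.continuousOn.comp (f := fun θ => ρ • unitVec θ)
      (by fun_prop) fun θ _ => by
        simpa using add_smul_unitVec_mem (c := 0) hρ (by linarith : ρ < δ) θ)
  have hmono := intervalIntegral.integral_mono_on (μ := volume) (by linarith : -Real.pi ≤ Real.pi)
    (hcont.intervalIntegrable _ _) (intervalIntegrable_const (c := (8 : ℝ) ^ 28 * Λ))
    fun θ hθ => hchain 28 θ (by
      have h1 := abs_le.1 hθ₀
      have h2 := Real.pi_lt_d2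
      push_cast
      rw [abs_le]
      constructor <;> linarith [hθ.1, hθ.2])
  rw [intervalIntegral.integral_const, smul_eq_mul] at hmono
  have hfin : 2 * Real.pi * w 0 ≤ 2 * Real.pi * (8 ^ 28 * Λ) := by linarith
  exact le_of_mul_le_mul_left hfin (by positivity)

lemma rpow_le_of_comparable {a ρ p : ℝ} (hρ : 0 < ρ) (h₁ : ρ / 4 < a) (h₂ : a < 4 * ρ) :
    a ^ p ≤ 4 ^ |p| * ρ ^ p := by
  have ha : 0 < a := by linarith
  rw [← div_le_iff₀ (by positivity), ← Real.div_rpow ha.le hρ.le]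
  have hlow : 1 / 4 ≤ a / ρ := by rw [le_div_iff₀ hρ]; linarith
  have hup : a / ρ ≤ 4 := by rw [div_le_iff₀ hρ]; linarith
  rcases le_total 0 p with hp | hp
  · rw [abs_of_nonneg hp]
    exact Real.rpow_le_rpow (by positivity) hup hp
  · rw [abs_of_nonpos hp, Real.rpow_neg (by norm_num), ← Real.inv_rpow (by norm_num)]
    exact Real.rpow_le_rpow_of_nonpos (by norm_num) (by simpa using hlow) hp

/-- in the local blowup setup with simple blowup, there is `C' > 0` independent
of `k` with `maxᵢ ũᵢᵏ(0) ≥ μ·M_k − C'` for all `k`. -/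
theorem max_at_origin_lower_bound {n : ℕ} {δ γ : ℝ} {A : Matrix (Fin n) (Fin n) ℝ}
    {h u : ℕ → Fin n → E2 → ℝ} {M : ℕ → ℝ}
    (S : LocalBlowupSetup n δ γ A h u M)
    (hsimple : SimpleBlowup δ γ u) :
    ∃ C' : ℝ, 0 < C' ∧ ∀ k, ∃ i : Fin n, (1+γ) * M k - C' ≤ u k i 0 := by
  obtain ⟨C₀, hC₀⟩ := hsimple
  have hμ : 0 < 1 + γ := by linarith [S.hγ]
  have hδ := S.hδ
  have hA := S.hH1.2.1
  let i₀ : Fin n := ⟨0, S.hn⟩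
  have hc₂ : 0 < S.c₂ := S.c₁_pos.trans_le
    ((S.h_lb 0 i₀ 0 (mem_closedBall_self hδ.le)).trans (S.h_ub 0 i₀ 0 (mem_closedBall_self hδ.le)))
  set B := ∑ i, ∑ j, A i j
  have hB : 0 ≤ B := Finset.sum_nonneg fun i _ => Finset.sum_nonneg fun j _ => hA i j
  have hrow : ∀ i, ∑ j, A i j ≤ B := fun i =>
    Finset.single_le_sum (f := fun i => ∑ j, A i j)
      (fun i _ => Finset.sum_nonneg fun j _ => hA i j) (Finset.mem_univ i)
  set Λ := B * S.c₂ * 4 ^ |2 * γ| * Real.exp C₀ with hΛdef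
  have hΛ : 0 ≤ Λ := by positivity
  have hlarge : ∀ k, C₀ - 2 * (1 + γ) * Real.log (δ / 2) < (1 + γ) * M k →
      ∃ i, (1 + γ) * M k - 8 ^ 28 * Λ ≤ u k i 0 := by
    intro k hk
    obtain ⟨i, x₀, hx₀, hux₀⟩ := S.M_attained k
    refine ⟨i, ?_⟩
    by_cases hx0 : x₀ = 0
    · rw [← hx0, hux₀]
      have : 0 ≤ 8 ^ 28 * Λ := by positivity
      linarith
    have hρ : 0 < ‖x₀‖ := norm_pos_iff.2 hx0
    have hsim := hC₀ k i x₀ hx₀ hx0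
    rw [hux₀] at hsim
    have hxδ : 2 * ‖x₀‖ < δ := by
      by_contra! hle
      have := Real.log_le_log (by linarith) (by linarith : δ / 2 ≤ ‖x₀‖)
      nlinarith
    set w : E2 → ℝ := fun x => (1 + γ) * M k - u k i x with hw
    have hsub : ball (0 : E2) δ \ {0} ⊆ closedBall 0 δ :=
      Set.sdiff_subset.trans ball_subset_closedBall
    have hopen : IsOpen (ball (0 : E2) δ \ {0}) := isOpen_ball.sdiff isClosed_singleton
    have hlapw : ∀ x ∈ ball (0 : E2) δ \ {0}, lap w x =
        ∑ j, A i j * (‖x‖ ^ (2 * γ) * (h k j x * Real.exp (u k j x))) := by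
      intro x hx
      rw [hw, lap_sub contDiffAt_const ((S.u_c2 k i).contDiffAt (hopen.mem_nhds hx)), lap_const]
      linarith [S.pde k i x hx]
    have hh : ∀ j, ∀ x ∈ ball (0 : E2) δ \ {0}, 0 < h k j x := fun j x hx =>
      S.c₁_pos.trans_le (S.h_lb k j x (hsub hx))
    have hmain : w 0 ≤ 8 ^ 28 * Λ := by
      refine apply_zero_le_of_lap_bounded hx0 hxδ hΛ
        (continuousAt_const.sub ((S.u_cont k i).continuousAt (closedBall_mem_nhds 0 hδ)))
        (contDiffOn_const.sub (S.u_c2 k i))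
        (fun x hx => sub_nonneg.2 (S.M_max k i x (hsub hx))) (fun x hx => ?_)
        (fun x hx1 hx2 => ?_) (by simp [hw, hux₀])
      · rw [hlapw x hx]
        refine Finset.sum_nonneg fun j _ => mul_nonneg (hA i j) ?_
        have := hh j x hx
        positivity
      · have hx : x ∈ ball (0 : E2) δ \ {0} :=
          ⟨by simpa using hx2.trans hxδ, fun h0 => by
            rw [Set.mem_singleton_iff.1 h0, norm_zero] at hx1
            linarith⟩
        have hexp : ‖x₀‖ ^ (2 * γ) * Real.exp ((1 + γ) * M k) ≤ Real.exp C₀ / ‖x₀‖ ^ 2 := by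
          rw [le_div_iff₀ (by positivity), Real.rpow_def_of_pos hρ]
          have hsq : ‖x₀‖ ^ 2 = Real.exp (2 * Real.log ‖x₀‖) := by
            rw [two_mul, Real.exp_add, Real.exp_log hρ, sq]
          rw [hsq, ← Real.exp_add, ← Real.exp_add]
          exact Real.exp_le_exp.2 (by linarith)
        have hterm : ∀ j, ‖x‖ ^ (2 * γ) * (h k j x * Real.exp (u k j x)) ≤
            S.c₂ * 4 ^ |2 * γ| * (Real.exp C₀ / ‖x₀‖ ^ 2) := by
          intro j
          calc ‖x‖ ^ (2 * γ) * (h k j x * Real.exp (u k j x))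
              ≤ (4 ^ |2 * γ| * ‖x₀‖ ^ (2 * γ)) * (S.c₂ * Real.exp ((1 + γ) * M k)) := by
                have := hh j x hx
                gcongr
                · exact rpow_le_of_comparable hρ hx1 (by linarith)
                · exact S.h_ub k j x (hsub hx)
                · exact S.M_max k j x (hsub hx)
            _ = S.c₂ * 4 ^ |2 * γ| * (‖x₀‖ ^ (2 * γ) * Real.exp ((1 + γ) * M k)) := by ring
            _ ≤ _ := by gcongr
        rw [hlapw x hx]
        calc ∑ j, A i j * (‖x‖ ^ (2 * γ) * (h k j x * Real.exp (u k j x)))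
            ≤ ∑ j, A i j * (S.c₂ * 4 ^ |2 * γ| * (Real.exp C₀ / ‖x₀‖ ^ 2)) :=
              Finset.sum_le_sum fun j _ => mul_le_mul_of_nonneg_left (hterm j) (hA i j)
          _ = (∑ j, A i j) * (S.c₂ * 4 ^ |2 * γ| * (Real.exp C₀ / ‖x₀‖ ^ 2)) := by
              rw [Finset.sum_mul]
          _ ≤ B * (S.c₂ * 4 ^ |2 * γ| * (Real.exp C₀ / ‖x₀‖ ^ 2)) := by
              gcongr
              exact hrow i
          _ = Λ / ‖x₀‖ ^ 2 := by rw [hΛdef]; ring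
    simp only [hw] at hmain
    linarith
  obtain ⟨N, hN⟩ := eventually_atTop.1
    ((S.M_inf.const_mul_atTop hμ).eventually_gt_atTop (C₀ - 2 * (1 + γ) * Real.log (δ / 2)))
  have hsum : 0 ≤ ∑ k ∈ Finset.range N, |(1 + γ) * M k - u k i₀ 0| :=
    Finset.sum_nonneg fun _ _ => abs_nonneg _
  have hΛ' : 0 ≤ 8 ^ 28 * Λ := by positivity
  refine ⟨8 ^ 28 * Λ + ∑ k ∈ Finset.range N, |(1 + γ) * M k - u k i₀ 0| + 1, by linarith,
    fun k => ?_⟩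
  rcases le_or_gt N k with hk | hk
  · obtain ⟨i, hi⟩ := hlarge k (hN k hk)
    exact ⟨i, by linarith⟩
  · refine ⟨i₀, ?_⟩
    have h1 := Finset.single_le_sum (f := fun k => |(1 + γ) * M k - u k i₀ 0|)
      (fun _ _ => abs_nonneg _) (Finset.mem_range.2 hk)
    have h2 := le_abs_self ((1 + γ) * M k - u k i₀ 0)
    linarith
end
end

section
/- Under the local blowup setup with simple blowup, assume in addition that h_i^k(0) = 1 for all i, k, and that there is a nonempty subset I₁ ⊆ {1,…,n} such that, with ε_k = e^{−M_k/2} and ṽ_i^k(y) := ũ_i^k(ε_k y) − μ·M_k, the functions ṽ_i^k converge in C²_loc(ℝ²) to limits ṽ_i for i ∈ I₁, while ṽ_i^k → −∞ uniformly on compact subsets of ℝ² for i ∉ I₁. Set σ_i = (1/2π)∫_{ℝ²} |y|^{2γ} e^{ṽ_i(y)} dy for i ∈ I₁ and σ_i = 0 for i ∉ I₁; set σ_i^k = (1/2π)∫_{B_δ} h_i^k |x|^{2γ} e^{ũ_i^k} dx and m_i^k = Σ_{j=1}^n a_{ij} σ_j^k. Then: (a) σ_i^k → σ_i as k → ∞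 for every i = 1,…,n; (b) for i ∈ I₁, ũ_i^k(x) = −m_i^k log|x| − ((m_i^k − 2μ)/2)·M_k + O(1) for x ∈ ∂B_δ; (c) for i ∉ I₁, ũ_i^k(x) = −m_i^k log|x| − ((m_i^k − 2μ)/2)·M_k + (ũ_i^k(0) − μ·M_k) + O(1) for x ∈ ∂B_δ, where O(1) denotes quantities bounded uniformly in k. -/
open MeasureTheory Metric Filter

noncomputable section

/-- The (normalized) energy `σᵢᵏ = (1/2π) ∫_{B_δ} hᵢᵏ |x|^{2γ} e^{ũᵢᵏ}` of the `i`-th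
component in `B_δ`. -/
def sigmaK {n : ℕ} (δ γ : ℝ) (h u : ℕ → Fin n → E2 → ℝ) (k : ℕ) (i : Fin n) : ℝ :=
  (1/(2*Real.pi)) * ∫ x in closedBall (0:E2) δ, h k i x * ‖x‖ ^ (2*γ) * Real.exp (u k i x)

/-- `mᵢᵏ = Σⱼ aᵢⱼ σⱼᵏ`. -/
def mK {n : ℕ} (A : Matrix (Fin n) (Fin n) ℝ) (δ γ : ℝ) (h u : ℕ → Fin n → E2 → ℝ)
    (k : ℕ) (i : Fin n) : ℝ :=
  ∑ j, A i j * sigmaK δ γ h u k j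

/-- The standard basis vectors of the plane. -/
abbrev stdBasis (i : Fin 2) : E2 := EuclideanSpace.single i 1

/-- The point of the plane with logarithmic polar coordinates `(t, θ)`. -/
def cyl (t θ : ℝ) : E2 :=
  (Real.exp t * Real.cos θ) • stdBasis 0 + (Real.exp t * Real.sin θ) • stdBasis 1

/-- The point `cyl t θ` rotated by a right angle. -/
def cylPerp (t θ : ℝ) : E2 :=
  (-(Real.exp t * Real.sin θ)) • stdBasis 0 + (Real.exp t * Real.cos θ) • stdBasis 1

lemma norm_cyl (t θ : ℝ) : ‖cyl t θ‖ = Real.exp t := by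
  rw [EuclideanSpace.norm_eq]
  simp only [cyl, Fin.sum_univ_two, Real.norm_eq_abs, sq_abs]
  simp only [PiLp.add_apply, PiLp.smul_apply, PiLp.single_apply]
  simp only [if_true, smul_eq_mul, mul_one, zero_ne_one, one_ne_zero, if_false, mul_zero,
    add_zero, zero_add]
  rw [show (Real.exp t * Real.cos θ)^2 + (Real.exp t * Real.sin θ)^2
    = Real.exp t ^ 2 by rw [mul_pow, mul_pow, ← mul_add, Real.cos_sq_add_sin_sq, mul_one]]
  exact Real.sqrt_sq (Real.exp_pos t).le

lemma cyl_ne_zero (t θ : ℝ) : cyl t θ ≠ 0 := by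
  rw [← norm_pos_iff, norm_cyl]; exact Real.exp_pos t

lemma cyl_add_two_pi (t θ : ℝ) : cyl t (θ + 2 * Real.pi) = cyl t θ := by
  simp [cyl]

lemma cylPerp_add_two_pi (t θ : ℝ) : cylPerp t (θ + 2 * Real.pi) = cylPerp t θ := by
  simp [cylPerp]

lemma cyl_add (s t θ : ℝ) : cyl (s + t) θ = Real.exp s • cyl t θ := by
  simp [cyl, Real.exp_add, mul_assoc, smul_smul]

lemma hasDerivAt_cyl_fst (t θ : ℝ) : HasDerivAt (fun t => cyl t θ) (cyl t θ) t :=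
  (((Real.hasDerivAt_exp t).mul_const _).smul_const _).add
    (((Real.hasDerivAt_exp t).mul_const _).smul_const _)

lemma hasDerivAt_cyl_snd (t θ : ℝ) : HasDerivAt (fun θ => cyl t θ) (cylPerp t θ) θ := by
  have := ((((Real.hasDerivAt_cos θ).const_mul (Real.exp t)).smul_const (stdBasis 0)).add
    (((Real.hasDerivAt_sin θ).const_mul (Real.exp t)).smul_const (stdBasis 1)))
  refine this.congr_deriv ?_
  simp only [cylPerp]; module

lemma hasDerivAt_cylPerp_snd (t θ : ℝ) : HasDerivAt (fun θ => cylPerp t θ) (-cyl t θ) θ := by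
  have := ((((Real.hasDerivAt_sin θ).const_mul (Real.exp t)).neg.smul_const (stdBasis 0)).add
    (((Real.hasDerivAt_cos θ).const_mul (Real.exp t)).smul_const (stdBasis 1)))
  refine this.congr_deriv ?_
  simp only [cyl]; module

lemma continuous_cyl : Continuous fun q : ℝ × ℝ => cyl q.1 q.2 := by
  unfold cyl; fun_prop

lemma continuous_cylPerp : Continuous fun q : ℝ × ℝ => cylPerp q.1 q.2 := by
  unfold cylPerp; fun_prop

/-- Every nonzero point has logarithmic polar coordinates with angle in `[-π, π]`. -/
lemma exists_eq_cyl {x : E2} (hx : x ≠ 0) :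
    ∃ θ ∈ Set.Icc (-Real.pi) Real.pi, x = cyl (Real.log ‖x‖) θ := by
  set z : ℂ := ⟨x 0, x 1⟩ with hz
  have hn : ‖x‖ = ‖z‖ := by
    rw [EuclideanSpace.norm_eq, Fin.sum_univ_two, Complex.norm_eq_sqrt_sq_add_sq]; simp [hz]
  have hexp : Real.exp (Real.log ‖x‖) = ‖z‖ := by rw [Real.exp_log (norm_pos_iff.2 hx), hn]
  refine ⟨z.arg, ⟨(Complex.neg_pi_lt_arg z).le, Complex.arg_le_pi z⟩, ?_⟩
  ext i
  fin_cases i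
  · simp only [cyl, hexp, Complex.norm_mul_cos_arg]; simp [hz]
  · simp only [cyl, hexp, Complex.norm_mul_sin_arg]; simp [hz]

/-- Integration over the plane in logarithmic polar coordinates. -/
lemma integral_eq_integral_cyl (f : E2 → ℝ) :
    ∫ x, f x = ∫ q in (Set.univ : Set ℝ) ×ˢ Set.Ioo (-Real.pi) Real.pi,
      Real.exp (2 * q.1) * f (cyl q.1 q.2) := by
  have h1 : ∫ x, f x = ∫ p : ℝ × ℝ, f (WithLp.toLp 2 ![p.1, p.2]) := by
    have e1 := (PiLp.volume_preserving_toLp (Fin 2)).integral_comp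
      (MeasurableEquiv.toLp 2 (Fin 2 → ℝ)).measurableEmbedding f
    have e2 := (volume_preserving_finTwoArrow ℝ).symm.integral_comp
      (MeasurableEquiv.finTwoArrow).symm.measurableEmbedding (fun y => f (WithLp.toLp 2 y))
    rw [← e1, ← e2]
    rfl
  rw [h1, ← integral_comp_polarCoord_symm]
  set L : ℝ × ℝ → (ℝ × ℝ →L[ℝ] ℝ × ℝ) := fun q =>
    (Real.exp q.1 • ContinuousLinearMap.id ℝ ℝ).prodMap (ContinuousLinearMap.id ℝ ℝ) with hL
  have himg : (fun q : ℝ × ℝ => (Real.exp q.1, q.2)) ''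
      ((Set.univ : Set ℝ) ×ˢ Set.Ioo (-Real.pi) Real.pi) = polarCoord.target := by
    ext ⟨a, b⟩
    simp only [polarCoord_target, Set.mem_image, Set.mem_prod, Set.mem_univ, true_and,
      Prod.exists, Prod.mk.injEq, Set.mem_Ioi]
    constructor
    · rintro ⟨t, θ, h, rfl, rfl⟩; exact ⟨Real.exp_pos t, h⟩
    · rintro ⟨ha, hb⟩; exact ⟨Real.log a, b, hb, Real.exp_log ha, rfl⟩
  rw [← himg, integral_image_eq_integral_abs_det_fderiv_smul volume (f' := L)]
  · refine setIntegral_congr_fun (MeasurableSet.univ.prod measurableSet_Ioo) fun q hq => ?_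
    have hdet : (L q).det = Real.exp q.1 := by
      simp only [hL, ContinuousLinearMap.det, ContinuousLinearMap.coe_prodMap,
        LinearMap.det_prodMap]
      simp
    have : cyl q.1 q.2 = WithLp.toLp 2 ![Real.exp q.1 * Real.cos q.2,
        Real.exp q.1 * Real.sin q.2] := by
      ext i; fin_cases i <;> simp [cyl]
    simp only [hdet, this, polarCoord_symm_apply, smul_eq_mul, abs_of_pos (Real.exp_pos q.1)]
    rw [two_mul, Real.exp_add, mul_assoc]
  · exact MeasurableSet.univ.prod measurableSet_Ioo
  · intro q _
    have h1 : HasFDerivAt (fun q : ℝ × ℝ => Real.exp q.1)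
      (Real.exp q.1 • ContinuousLinearMap.fst ℝ ℝ ℝ) q :=
        (ContinuousLinearMap.fst ℝ ℝ ℝ).hasFDerivAt.exp
    have h2 : HasFDerivAt (fun q : ℝ × ℝ => q.2) (ContinuousLinearMap.snd ℝ ℝ ℝ) q :=
      (ContinuousLinearMap.snd ℝ ℝ ℝ).hasFDerivAt
    refine (h1.prodMk h2).hasFDerivWithinAt.congr_fderiv ?_
    ext <;> simp [hL]
  · intro p _ q _ h
    simp only [Prod.mk.injEq, Real.exp_eq_exp] at h
    exact Prod.ext h.1 h.2

/-- Integration over a closed disc in logarithmic polar coordinates. -/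
lemma setIntegral_closedBall_eq_integral_cyl (f : E2 → ℝ) (T : ℝ) :
    ∫ x in closedBall (0 : E2) (Real.exp T), f x =
      ∫ q in Set.Iic T ×ˢ Set.Ioo (-Real.pi) Real.pi,
      Real.exp (2 * q.1) * f (cyl q.1 q.2) := by
  rw [← integral_indicator measurableSet_closedBall, integral_eq_integral_cyl]
  have hs : Set.Iic T ×ˢ Set.Ioo (-Real.pi) Real.pi =
    ((Set.univ : Set ℝ) ×ˢ Set.Ioo (-Real.pi) Real.pi) ∩ {q : ℝ × ℝ | q.1 ≤ T} := by
    ext q; simp [and_comm]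
  rw [hs, ← setIntegral_indicator (measurableSet_le measurable_fst measurable_const)]
  congr 1
  ext q
  by_cases hq : q.1 ≤ T
  · rw [Set.indicator_of_mem (by simpa [norm_cyl] using hq), Set.indicator_of_mem (by simpa using hq)]
  · rw [Set.indicator_of_notMem (by simpa [norm_cyl] using hq),
      Set.indicator_of_notMem (by simpa using hq), mul_zero]

section Cylinder

variable {u : E2 → ℝ} {δ : ℝ}

lemma cyl_mem_closedBall {t θ : ℝ} (ht : Real.exp t ≤ δ) : cyl t θ ∈ closedBall (0 : E2) δ := by
  simpa [norm_cyl] using ht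

lemma cyl_mem_puncturedBall {t θ : ℝ} (ht : Real.exp t < δ) :
    cyl t θ ∈ ball (0 : E2) δ \ {0} :=
  ⟨by simpa [norm_cyl] using ht, cyl_ne_zero t θ⟩

lemma isOpen_puncturedBall : IsOpen (ball (0 : E2) δ \ {0}) :=
  isOpen_ball.sdiff isClosed_singleton

lemma hasDerivAt_comp_cyl_fst (hu : ContDiffOn ℝ 2 u (ball 0 δ \ {0})) {t : ℝ} (θ : ℝ)
    (ht : Real.exp t < δ) :
    HasDerivAt (fun t => u (cyl t θ)) (fderiv ℝ u (cyl t θ) (cyl t θ)) t := by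
  have h1 : DifferentiableAt ℝ u (cyl t θ) :=
    (hu.differentiableOn (by norm_num)).differentiableAt
      (isOpen_puncturedBall.mem_nhds (cyl_mem_puncturedBall ht))
  exact h1.hasFDerivAt.comp_hasDerivAt t (hasDerivAt_cyl_fst t θ)

lemma hasDerivAt_comp_cyl_snd (hu : ContDiffOn ℝ 2 u (ball 0 δ \ {0})) {t : ℝ} (θ : ℝ)
    (ht : Real.exp t < δ) :
    HasDerivAt (fun θ => u (cyl t θ)) (fderiv ℝ u (cyl t θ) (cylPerp t θ)) θ := by
  have h1 : DifferentiableAt ℝ u (cyl t θ) :=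
    (hu.differentiableOn (by norm_num)).differentiableAt
      (isOpen_puncturedBall.mem_nhds (cyl_mem_puncturedBall ht))
  exact h1.hasFDerivAt.comp_hasDerivAt θ (hasDerivAt_cyl_snd t θ)

lemma contDiffOn_fderiv_puncturedBall (hu : ContDiffOn ℝ 2 u (ball 0 δ \ {0})) :
    ContDiffOn ℝ 1 (fderiv ℝ u) (ball 0 δ \ {0}) :=
  hu.fderiv_of_isOpen isOpen_puncturedBall (by norm_num)

lemma differentiableAt_fderiv_cyl (hu : ContDiffOn ℝ 2 u (ball 0 δ \ {0})) {t : ℝ} (θ : ℝ)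
    (ht : Real.exp t < δ) : DifferentiableAt ℝ (fderiv ℝ u) (cyl t θ) :=
  ((contDiffOn_fderiv_puncturedBall hu).differentiableOn (by norm_num)).differentiableAt
      (isOpen_puncturedBall.mem_nhds (cyl_mem_puncturedBall ht))

/-- The second `t`-derivative of `u (cyl t θ)`. -/
def cylSecondFst (u : E2 → ℝ) (t θ : ℝ) : ℝ :=
  fderiv ℝ (fderiv ℝ u) (cyl t θ) (cyl t θ) (cyl t θ) + fderiv ℝ u (cyl t θ) (cyl t θ)

/-- The second `θ`-derivative of `u (cyl t θ)`. -/
def cylSecondSnd (u : E2 → ℝ) (t θ : ℝ) : ℝ :=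
  fderiv ℝ (fderiv ℝ u) (cyl t θ) (cylPerp t θ) (cylPerp t θ) - fderiv ℝ u (cyl t θ) (cyl t θ)

lemma hasDerivAt_fderiv_cyl_fst (hu : ContDiffOn ℝ 2 u (ball 0 δ \ {0})) {t : ℝ} (θ : ℝ)
    (ht : Real.exp t < δ) :
    HasDerivAt (fun t => fderiv ℝ u (cyl t θ) (cyl t θ)) (cylSecondFst u t θ) t := by
  have h1 : HasDerivAt (fun t => fderiv ℝ u (cyl t θ))
      (fderiv ℝ (fderiv ℝ u) (cyl t θ) (cyl t θ)) t :=
    (differentiableAt_fderiv_cyl hu θ ht).hasFDerivAt.comp_hasDerivAt t (hasDerivAt_cyl_fst t θ)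
  exact h1.clm_apply (hasDerivAt_cyl_fst t θ)

lemma hasDerivAt_fderiv_cyl_snd (hu : ContDiffOn ℝ 2 u (ball 0 δ \ {0})) {t : ℝ} (θ : ℝ)
    (ht : Real.exp t < δ) :
    HasDerivAt (fun θ => fderiv ℝ u (cyl t θ) (cylPerp t θ)) (cylSecondSnd u t θ) θ := by
  refine (((differentiableAt_fderiv_cyl hu θ ht).hasFDerivAt.comp_hasDerivAt θ
    (hasDerivAt_cyl_snd t θ)).clm_apply (hasDerivAt_cylPerp_snd t θ)).congr_deriv ?_
  simp [cylSecondSnd, sub_eq_add_neg]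

/-- The Laplacian in logarithmic polar coordinates. -/
lemma cylSecondFst_add_cylSecondSnd (hu : ContDiffOn ℝ 2 u (ball 0 δ \ {0})) {t : ℝ} (θ : ℝ)
    (ht : Real.exp t < δ) :
    cylSecondFst u t θ + cylSecondSnd u t θ = Real.exp (2 * t) * lap u (cyl t θ) := by
  have hd := differentiableAt_fderiv_cyl hu θ ht
  have hl : ∀ v : E2, fderiv ℝ (fun y => fderiv ℝ u y v) (cyl t θ) v =
      fderiv ℝ (fderiv ℝ u) (cyl t θ) v v := by
    intro v
    rw [fderiv_clm_apply hd (differentiableAt_const v)]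
    simp
  simp only [lap, hl, Fin.sum_univ_two, cylSecondFst, cylSecondSnd]
  set D := fderiv ℝ (fderiv ℝ u) (cyl t θ) with hD
  have e : Real.exp (2 * t) = Real.exp t ^ 2 := by rw [sq, ← Real.exp_add, two_mul]
  have hs : Real.sin θ ^ 2 = 1 - Real.cos θ ^ 2 := by rw [← Real.sin_sq_add_cos_sq θ]; ring
  simp only [cylPerp]
  rw [add_add_sub_cancel]
  rw [show D (cyl t θ) (cyl t θ) = D ((Real.exp t * Real.cos θ) • stdBasis 0 +
    (Real.exp t * Real.sin θ) • stdBasis 1) ((Real.exp t * Real.cos θ) • stdBasis 0 +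
    (Real.exp t * Real.sin θ) • stdBasis 1) from rfl]
  simp only [map_add, map_smul, add_apply, smul_apply,
    smul_eq_mul, e]
  ring_nf
  rw [hs]
  ring

lemma continuousOn_comp_cyl {f : E2 → ℝ} (hf : ContinuousOn f (closedBall 0 δ \ {0})) :
    ContinuousOn (fun q : ℝ × ℝ => f (cyl q.1 q.2)) {q | Real.exp q.1 ≤ δ} :=
  hf.comp continuous_cyl.continuousOn fun _ hq => ⟨cyl_mem_closedBall hq, cyl_ne_zero _ _⟩

lemma mapsTo_cyl : Set.MapsTo (fun q : ℝ × ℝ => cyl q.1 q.2) {q | Real.exp q.1 < δ}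
    (ball 0 δ \ {0}) := fun _ hq => cyl_mem_puncturedBall hq

lemma continuousOn_fderiv_cyl (hu : ContDiffOn ℝ 2 u (ball 0 δ \ {0})) :
    ContinuousOn (fun q : ℝ × ℝ => fderiv ℝ u (cyl q.1 q.2)) {q | Real.exp q.1 < δ} :=
  (contDiffOn_fderiv_puncturedBall hu).continuousOn.comp continuous_cyl.continuousOn mapsTo_cyl

lemma continuousOn_fderiv_fderiv_cyl (hu : ContDiffOn ℝ 2 u (ball 0 δ \ {0})) :
    ContinuousOn (fun q : ℝ × ℝ => fderiv ℝ (fderiv ℝ u) (cyl q.1 q.2))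
      {q | Real.exp q.1 < δ} :=
  ((contDiffOn_fderiv_puncturedBall hu).continuousOn_fderiv_of_isOpen isOpen_puncturedBall
    le_rfl).comp continuous_cyl.continuousOn mapsTo_cyl

lemma continuousOn_fderiv_cyl_apply (hu : ContDiffOn ℝ 2 u (ball 0 δ \ {0})) :
    ContinuousOn (fun q : ℝ × ℝ => fderiv ℝ u (cyl q.1 q.2) (cyl q.1 q.2))
      {q | Real.exp q.1 < δ} :=
  (continuousOn_fderiv_cyl hu).clm_apply continuous_cyl.continuousOn

lemma continuousOn_cylSecondFst (hu : ContDiffOn ℝ 2 u (ball 0 δ \ {0})) :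
    ContinuousOn (fun q : ℝ × ℝ => cylSecondFst u q.1 q.2) {q | Real.exp q.1 < δ} :=
  (((continuousOn_fderiv_fderiv_cyl hu).clm_apply continuous_cyl.continuousOn).clm_apply
    continuous_cyl.continuousOn).add (continuousOn_fderiv_cyl_apply hu)

lemma continuousOn_cylSecondSnd (hu : ContDiffOn ℝ 2 u (ball 0 δ \ {0})) :
    ContinuousOn (fun q : ℝ × ℝ => cylSecondSnd u q.1 q.2) {q | Real.exp q.1 < δ} :=
  (((continuousOn_fderiv_fderiv_cyl hu).clm_apply continuous_cylPerp.continuousOn).clm_apply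
    continuous_cylPerp.continuousOn).sub (continuousOn_fderiv_cyl_apply hu)

end Cylinder

/-- Differentiation under the integral sign over a compact interval, for a jointly continuous
derivative. -/
lemma hasDerivAt_intervalIntegral_of_continuousOn_s1 {F F' : ℝ → ℝ → ℝ} {T t a b : ℝ} (ht : t < T)
    (hab : a ≤ b)
    (hF : ContinuousOn (fun q : ℝ × ℝ => F q.1 q.2) {q | q.1 < T})
    (hF' : ContinuousOn (fun q : ℝ × ℝ => F' q.1 q.2) {q | q.1 < T})
    (hd : ∀ s θ, s < T → HasDerivAt (fun s => F s θ) (F' s θ) s) :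
    HasDerivAt (fun t => ∫ θ in a..b, F t θ) (∫ θ in a..b, F' t θ) t := by
  have slice : ∀ {G : ℝ → ℝ → ℝ}, ContinuousOn (fun q : ℝ × ℝ => G q.1 q.2) {q | q.1 < T} →
      ∀ s, s < T → Continuous (G s) := by
    intro G hG s hs
    have : ContinuousOn ((fun q : ℝ × ℝ => G q.1 q.2) ∘ fun θ => (s, θ)) Set.univ :=
      hG.comp (by fun_prop) fun θ _ => hs
    simpa [continuousOn_univ] using! this
  obtain ⟨T', h1, h2⟩ := exists_between ht
  have hK : IsCompact (Set.Icc (t - 1) T' ×ˢ Set.Icc a b) := isCompact_Icc.prod isCompact_Icc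
  obtain ⟨C, hC⟩ := hK.exists_bound_of_continuousOn
    (hF'.mono fun q hq => lt_of_le_of_lt hq.1.2 h2)
  refine (intervalIntegral.hasDerivAt_integral_of_dominated_loc_of_deriv_le
    (s := Set.Ioo (t - 1) T') (bound := fun _ => C) (F' := F') (Ioo_mem_nhds (by linarith) h1)
    ?_ ?_ ?_ ?_ ?_ ?_).2
  · filter_upwards [Iio_mem_nhds ht] with s hs
    exact (slice hF s hs).aestronglyMeasurable
  · exact (slice hF t ht).intervalIntegrable _ _
  · exact (slice hF' t ht).aestronglyMeasurable
  · refine Eventually.of_forall fun θ hθ s hs => hC (s, θ) ⟨⟨hs.1.le, hs.2.le⟩, ?_⟩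
    rw [Set.uIoc_of_le hab] at hθ
    exact ⟨hθ.1.le, hθ.2⟩
  · exact intervalIntegrable_const
  · exact Eventually.of_forall fun θ _ s hs => hd s θ (hs.2.trans h2)

/-- A function with positive second derivative at a point has no local maximum there. -/
lemma IsLocalMax.second_deriv_nonpos {f f' : ℝ → ℝ} {x f'' : ℝ} (hmax : IsLocalMax f x)
    (hf : ∀ᶠ y in nhds x, HasDerivAt f (f' y) y) (hf' : HasDerivAt f' f'' x) : f'' ≤ 0 := by
  by_contra! hpos
  have hd : deriv f =ᶠ[nhds x] f' := hf.mono fun y hy => hy.deriv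
  have h2 : deriv (deriv f) x = f'' := by rw [hd.deriv_eq, hf'.deriv]
  have hmin := isLocalMin_of_deriv_deriv_pos (h2 ▸ hpos) hmax.deriv_eq_zero
    hf.self_of_nhds.continuousAt
  have hconst : f =ᶠ[nhds x] fun _ => f x := by
    filter_upwards [hmax, hmin] with y h1 h2 using le_antisymm h1 h2
  have h0 : deriv f =ᶠ[nhds x] fun _ => 0 := by
    filter_upwards [hconst.eventuallyEq_nhds] with y hy
    rw [hy.deriv_eq, deriv_const]
  rw [h0.deriv_eq, deriv_const] at h2
  exact hpos.ne h2

/-- Weak maximum principle on a rectangle for a strictly subharmonic function. -/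
lemma le_of_subharmonic_rectangle {G Gt Gtt Gs Gss : ℝ → ℝ → ℝ} {a b c d B : ℝ}
    (hG : ContinuousOn (fun q : ℝ × ℝ => G q.1 q.2) (Set.Icc a b ×ˢ Set.Icc c d))
    (h1 : ∀ t ∈ Set.Ioo a b, ∀ s ∈ Set.Ioo c d, HasDerivAt (fun t => G t s) (Gt t s) t)
    (h2 : ∀ t ∈ Set.Ioo a b, ∀ s ∈ Set.Ioo c d, HasDerivAt (fun t => Gt t s) (Gtt t s) t)
    (h3 : ∀ t ∈ Set.Ioo a b, ∀ s ∈ Set.Ioo c d, HasDerivAt (fun s => G t s) (Gs t s) s)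
    (h4 : ∀ t ∈ Set.Ioo a b, ∀ s ∈ Set.Ioo c d, HasDerivAt (fun s => Gs t s) (Gss t s) s)
    (hpos : ∀ t ∈ Set.Ioo a b, ∀ s ∈ Set.Ioo c d, 0 < Gtt t s + Gss t s)
    (ha : ∀ s ∈ Set.Icc c d, G a s ≤ B) (hb : ∀ s ∈ Set.Icc c d, G b s ≤ B)
    (hc : ∀ t ∈ Set.Icc a b, G t c ≤ B) (hd : ∀ t ∈ Set.Icc a b, G t d ≤ B)
    {t s : ℝ} (ht : t ∈ Set.Icc a b) (hs : s ∈ Set.Icc c d) : G t s ≤ B := by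
  have hK : IsCompact (Set.Icc a b ×ˢ Set.Icc c d) := isCompact_Icc.prod isCompact_Icc
  obtain ⟨⟨t0, s0⟩, hmem, hmax⟩ := hK.exists_isMaxOn ⟨(t, s), ht, hs⟩ hG
  have hmax' : ∀ t' ∈ Set.Icc a b, ∀ s' ∈ Set.Icc c d, G t' s' ≤ G t0 s0 :=
    fun t' ht' s' hs' => hmax (Set.mk_mem_prod ht' hs')
  refine (hmax' t ht s hs).trans ?_
  obtain ⟨ht0, hs0⟩ : t0 ∈ Set.Icc a b ∧ s0 ∈ Set.Icc c d := hmem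
  rcases eq_or_lt_of_le ht0.1 with rfl | hta
  · exact ha s0 hs0
  rcases eq_or_lt_of_le ht0.2 with rfl | htb
  · exact hb s0 hs0
  rcases eq_or_lt_of_le hs0.1 with rfl | hsc
  · exact hc t0 ht0
  rcases eq_or_lt_of_le hs0.2 with rfl | hsd
  · exact hd t0 ht0
  exfalso
  have ht0' : t0 ∈ Set.Ioo a b := ⟨hta, htb⟩
  have hs0' : s0 ∈ Set.Ioo c d := ⟨hsc, hsd⟩
  have e1 : Gtt t0 s0 ≤ 0 := by
    refine IsLocalMax.second_deriv_nonpos (f := fun t => G t s0) (f' := fun t => Gt t s0)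
      (x := t0) ?_ ?_ (h2 t0 ht0' s0 hs0')
    · filter_upwards [Ioo_mem_nhds hta htb] with t' ht'
      exact hmax' t' ⟨ht'.1.le, ht'.2.le⟩ s0 hs0
    · filter_upwards [Ioo_mem_nhds hta htb] with t' ht' using h1 t' ht' s0 hs0'
  have e2 : Gss t0 s0 ≤ 0 := by
    refine IsLocalMax.second_deriv_nonpos (f := fun s => G t0 s) (f' := fun s => Gs t0 s)
      (x := s0) ?_ ?_ (h4 t0 ht0' s0 hs0')
    · filter_upwards [Ioo_mem_nhds hsc hsd] with s' hs'
      exact hmax' t0 ht0 s' ⟨hs'.1.le, hs'.2.le⟩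
    · filter_upwards [Ioo_mem_nhds hsc hsd] with s' hs' using h3 t0 ht0' s' hs'
  linarith [hpos t0 ht0' s0 hs0']

/-- Circles of small radius are mapped close to the central value. -/
lemma eventually_abs_comp_cyl_sub_lt {u : E2 → ℝ} {T : ℝ}
    (hu : ContinuousOn u (closedBall 0 (Real.exp T))) {ε : ℝ} (hε : 0 < ε) :
    ∀ᶠ t in atBot, ∀ θ, |u (cyl t θ) - u 0| < ε := by
  have hc : ContinuousAt u 0 := hu.continuousAt (closedBall_mem_nhds _ (Real.exp_pos T))
  obtain ⟨r, hr, h⟩ := Metric.continuousAt_iff.1 hc ε hε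
  filter_upwards [Iio_mem_atBot (Real.log r)] with t ht θ
  have := @h (cyl t θ) (by
    rw [dist_zero_right, norm_cyl]; exact (Real.lt_log_iff_exp_lt hr).1 ht)
  rwa [Real.dist_eq] at this

lemma comp_cyl_reflection_le {u : E2 → ℝ} {T C Λ : ℝ}
    (hcont : ContinuousOn u (closedBall 0 (Real.exp T)))
    (hu : ContDiffOn ℝ 2 u (ball 0 (Real.exp T) \ {0}))
    (hlap : ∀ t θ, t < T → |Real.exp (2 * t) * lap u (cyl t θ)| ≤ Λ)
    (hosc : ∀ x ∈ sphere (0 : E2) (Real.exp T), ∀ y ∈ sphere (0 : E2) (Real.exp T),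
      |u x - u y| ≤ C) {t : ℝ} (ht : t ≤ T) (α : ℝ) {θ : ℝ} (hθ : θ ∈ Set.Icc 0 Real.pi) :
    u (cyl t (α + θ)) - u (cyl t (α - θ)) ≤ max C 1 + (2 * Λ + 1) / 2 * Real.pi ^ 2 := by
  have hΛ : 0 ≤ Λ := (abs_nonneg _).trans (hlap (T - 1) 0 (by linarith))
  set L := 2 * Λ + 1 with hL
  obtain ⟨a, ha1, ha2⟩ := ((eventually_abs_comp_cyl_sub_lt hcont (half_pos one_pos)).and
    (Iio_mem_atBot t)).exists
  have ha2 : a < t := ha2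
  have hlt : ∀ {s : ℝ}, s ∈ Set.Ioo a T → Real.exp s < Real.exp T :=
    fun hs => Real.exp_lt_exp.2 hs.2
  have hbar : ∀ s ∈ Set.Icc 0 Real.pi, 0 ≤ L / 2 * (s * (Real.pi - s)) := fun s hs =>
    mul_nonneg (by positivity) (mul_nonneg hs.1 (sub_nonneg.2 hs.2))
  have hadd : ∀ s : ℝ, HasDerivAt (fun s => α + s) 1 s := fun s => (hasDerivAt_id s).const_add α
  have hsub : ∀ s : ℝ, HasDerivAt (fun s => α - s) (-1) s := fun s =>
    (hasDerivAt_id s).const_sub α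
  have key : u (cyl t (α + θ)) - u (cyl t (α - θ)) - L / 2 * (θ * (Real.pi - θ)) ≤ max C 1 := by
    refine le_of_subharmonic_rectangle (a := a) (b := T) (c := 0) (d := Real.pi)
      (G := fun t θ => u (cyl t (α + θ)) - u (cyl t (α - θ)) - L / 2 * (θ * (Real.pi - θ)))
      (Gt := fun t θ => fderiv ℝ u (cyl t (α + θ)) (cyl t (α + θ)) -
        fderiv ℝ u (cyl t (α - θ)) (cyl t (α - θ)))
      (Gtt := fun t θ => cylSecondFst u t (α + θ) - cylSecondFst u t (α - θ))
      (Gs := fun t θ => fderiv ℝ u (cyl t (α + θ)) (cylPerp t (α + θ)) +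
        fderiv ℝ u (cyl t (α - θ)) (cylPerp t (α - θ)) - L / 2 * (Real.pi - 2 * θ))
      (Gss := fun t θ => cylSecondSnd u t (α + θ) - cylSecondSnd u t (α - θ) + L)
      ?_ ?_ ?_ ?_ ?_ ?_ ?_ ?_ ?_ ?_ ⟨ha2.le, ht⟩ hθ
    · have hc := continuousOn_comp_cyl (hcont.mono (Set.sdiff_subset (t := {0})))
      refine ContinuousOn.sub (ContinuousOn.sub ?_ ?_) (by fun_prop)
      · exact hc.comp (f := fun q : ℝ × ℝ => (q.1, α + q.2)) (by fun_prop)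
          fun q hq => Real.exp_le_exp.2 hq.1.2
      · exact hc.comp (f := fun q : ℝ × ℝ => (q.1, α - q.2)) (by fun_prop)
          fun q hq => Real.exp_le_exp.2 hq.1.2
    · intro s hs φ _
      exact ((hasDerivAt_comp_cyl_fst hu (α + φ) (hlt hs)).sub
        (hasDerivAt_comp_cyl_fst hu (α - φ) (hlt hs))).sub_const _
    · intro s hs φ _
      exact (hasDerivAt_fderiv_cyl_fst hu (α + φ) (hlt hs)).sub
        (hasDerivAt_fderiv_cyl_fst hu (α - φ) (hlt hs))
    · intro s hs φ _
      have h1 := (hasDerivAt_comp_cyl_snd hu (α + φ) (hlt hs)).comp φ (hadd φ)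
      have h2 := (hasDerivAt_comp_cyl_snd hu (α - φ) (hlt hs)).comp φ (hsub φ)
      have h3 := ((hasDerivAt_id φ).mul ((hasDerivAt_id φ).const_sub Real.pi)).const_mul (L / 2)
      refine ((h1.sub h2).sub h3).congr_deriv ?_
      simp only [id]; ring
    · intro s hs φ _
      have h1 := (hasDerivAt_fderiv_cyl_snd hu (α + φ) (hlt hs)).comp φ (hadd φ)
      have h2 := (hasDerivAt_fderiv_cyl_snd hu (α - φ) (hlt hs)).comp φ (hsub φ)
      have h3 := (((hasDerivAt_id φ).const_mul 2).const_sub Real.pi).const_mul (L / 2)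
      refine ((h1.add h2).sub h3).congr_deriv ?_
      ring
    · intro s hs φ _
      have e1 := cylSecondFst_add_cylSecondSnd hu (α + φ) (hlt hs)
      have e2 := cylSecondFst_add_cylSecondSnd hu (α - φ) (hlt hs)
      have b1 := abs_le.1 (hlap s (α + φ) hs.2)
      have b2 := abs_le.1 (hlap s (α - φ) hs.2)
      linarith [b1.1, b2.2]
    · intro φ hφ
      have b1 := abs_lt.1 (ha1 (α + φ))
      have b2 := abs_lt.1 (ha1 (α - φ))
      have := hbar φ hφ
      have := le_max_right C 1
      linarith [b1.2, b2.1]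
    · intro φ hφ
      have := hosc (cyl T (α + φ)) (by simp [norm_cyl]) (cyl T (α - φ)) (by simp [norm_cyl])
      linarith [le_abs_self (u (cyl T (α + φ)) - u (cyl T (α - φ))), hbar φ hφ, le_max_left C 1]
    · intro s _
      simp
    · intro s _
      have : cyl s (α + Real.pi) = cyl s (α - Real.pi) := by
        rw [← cyl_add_two_pi s (α - Real.pi)]; congr 1; ring
      simp [this]
  have hq : L / 2 * (θ * (Real.pi - θ)) ≤ L / 2 * Real.pi ^ 2 := by
    refine mul_le_mul_of_nonneg_left ?_ (by positivity)
    nlinarith [hθ.1, hθ.2, Real.pi_pos]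
  linarith

/-- A function with bounded cylindrical Laplacian and bounded oscillation on the boundary of
a disc has bounded oscillation on every concentric circle. -/
lemma abs_comp_cyl_sub_le {u : E2 → ℝ} {T C Λ : ℝ}
    (hcont : ContinuousOn u (closedBall 0 (Real.exp T)))
    (hu : ContDiffOn ℝ 2 u (ball 0 (Real.exp T) \ {0}))
    (hlap : ∀ t θ, t < T → |Real.exp (2 * t) * lap u (cyl t θ)| ≤ Λ)
    (hosc : ∀ x ∈ sphere (0 : E2) (Real.exp T), ∀ y ∈ sphere (0 : E2) (Real.exp T),
      |u x - u y| ≤ C) {t : ℝ} (ht : t ≤ T) {θ₁ θ₂ : ℝ}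
    (h₁ : θ₁ ∈ Set.Icc (-Real.pi) Real.pi) (h₂ : θ₂ ∈ Set.Icc (-Real.pi) Real.pi) :
    |u (cyl t θ₁) - u (cyl t θ₂)| ≤ max C 1 + (2 * Λ + 1) / 2 * Real.pi ^ 2 := by
  have core : ∀ φ₁ φ₂ : ℝ, φ₂ ≤ φ₁ → φ₁ ≤ φ₂ + 2 * Real.pi →
      u (cyl t φ₁) - u (cyl t φ₂) ≤ max C 1 + (2 * Λ + 1) / 2 * Real.pi ^ 2 := by
    intro φ₁ φ₂ h h'
    have := comp_cyl_reflection_le hcont hu hlap hosc ht ((φ₁ + φ₂) / 2) (θ := (φ₁ - φ₂) / 2)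
      ⟨by linarith, by linarith⟩
    rwa [show (φ₁ + φ₂) / 2 + (φ₁ - φ₂) / 2 = φ₁ by ring,
      show (φ₁ + φ₂) / 2 - (φ₁ - φ₂) / 2 = φ₂ by ring] at this
  have full : ∀ φ₁ ∈ Set.Icc (-Real.pi) Real.pi, ∀ φ₂ ∈ Set.Icc (-Real.pi) Real.pi,
      u (cyl t φ₁) - u (cyl t φ₂) ≤ max C 1 + (2 * Λ + 1) / 2 * Real.pi ^ 2 := by
    intro φ₁ k₁ φ₂ k₂
    rcases le_total φ₂ φ₁ with h | h
    · exact core _ _ h (by linarith [k₁.2, k₂.1])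
    · rw [← cyl_add_two_pi t φ₁]
      exact core _ _ (by linarith [k₁.1, k₂.2]) (by linarith)
  rw [abs_le]
  constructor
  · linarith [full _ h₂ _ h₁]
  · exact full _ h₁ _ h₂

lemma continuousOn_intervalIntegral_of_continuousOn {F : ℝ → ℝ → ℝ} {T a b : ℝ}
    (hF : ContinuousOn (fun q : ℝ × ℝ => F q.1 q.2) {q | q.1 ≤ T}) :
    ContinuousOn (fun t => ∫ θ in a..b, F t θ) (Set.Iic T) := by
  have hc : Continuous (Function.uncurry fun t θ => F (min t T) θ) := by
    have : ContinuousOn ((fun q : ℝ × ℝ => F q.1 q.2) ∘ fun q : ℝ × ℝ => (min q.1 T, q.2))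
        Set.univ := hF.comp (by fun_prop) fun q _ => min_le_right q.1 T
    simpa [continuousOn_univ] using! this
  refine (intervalIntegral.continuous_parametric_intervalIntegral_of_continuous'
    (μ := volume) hc a b
    ).continuousOn.congr fun t ht => ?_
  simp only [min_eq_left (show t ≤ T from ht)]

/-- The average of a function on the circle of radius `exp t`. -/
def circAvg (u : E2 → ℝ) (t : ℝ) : ℝ :=
  (2 * Real.pi)⁻¹ * ∫ θ in (-Real.pi)..Real.pi, u (cyl t θ)

lemma continuousOn_circAvg {u : E2 → ℝ} {T : ℝ}
    (hu : ContinuousOn u (closedBall 0 (Real.exp T))) :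
    ContinuousOn (circAvg u) (Set.Iic T) := by
  refine ContinuousOn.mul continuousOn_const (continuousOn_intervalIntegral_of_continuousOn ?_)
  simpa [Real.exp_le_exp] using continuousOn_comp_cyl (hu.mono (Set.sdiff_subset (t := {0})))

lemma continuous_comp_cyl {u : E2 → ℝ} {T t : ℝ}
    (hu : ContinuousOn u (closedBall 0 (Real.exp T))) (ht : t ≤ T) :
    Continuous fun θ => u (cyl t θ) := by
  have := (continuousOn_comp_cyl (hu.mono (Set.sdiff_subset (t := {0})))).comp
    (f := fun θ : ℝ => (t, θ)) (s := Set.univ) (by fun_prop)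
    fun θ _ => Real.exp_le_exp.2 ht
  simpa [continuousOn_univ] using! this

/-- If a function is within `K` of a constant on a circle, so is its average. -/
lemma abs_circAvg_sub_le {u : E2 → ℝ} {T t c K : ℝ}
    (hu : ContinuousOn u (closedBall 0 (Real.exp T))) (ht : t ≤ T)
    (h : ∀ θ ∈ Set.Icc (-Real.pi) Real.pi, |u (cyl t θ) - c| ≤ K) : |circAvg u t - c| ≤ K := by
  have hc := continuous_comp_cyl hu ht
  have hpi : -Real.pi ≤ Real.pi := by linarith [Real.pi_pos]
  have e : circAvg u t - c = (2 * Real.pi)⁻¹ * ∫ θ in (-Real.pi)..Real.pi, (u (cyl t θ) - c) := by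
    rw [intervalIntegral.integral_sub (hc.intervalIntegrable _ _) intervalIntegrable_const,
      intervalIntegral.integral_const, circAvg, mul_sub, smul_eq_mul]
    field_simp
    ring
  rw [e, abs_mul, abs_of_pos (by positivity : 0 < (2 * Real.pi)⁻¹)]
  have h2 : |∫ θ in (-Real.pi)..Real.pi, (u (cyl t θ) - c)| ≤ K * |Real.pi - -Real.pi| := by
    rw [← Real.norm_eq_abs]
    refine intervalIntegral.norm_integral_le_of_norm_le_const fun θ hθ => ?_
    rw [Set.uIoc_of_le hpi] at hθ
    exact h θ ⟨hθ.1.le, hθ.2⟩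
  rw [abs_of_nonneg (by linarith : (0:ℝ) ≤ Real.pi - -Real.pi)] at h2
  calc _ ≤ (2 * Real.pi)⁻¹ * (K * (Real.pi - -Real.pi)) :=
        mul_le_mul_of_nonneg_left h2 (by positivity)
    _ = K := by field_simp; ring

lemma tendsto_circAvg_atBot {u : E2 → ℝ} {T : ℝ}
    (hu : ContinuousOn u (closedBall 0 (Real.exp T))) :
    Tendsto (circAvg u) atBot (nhds (u 0)) := by
  rw [Metric.tendsto_nhds]
  intro ε hε
  filter_upwards [eventually_abs_comp_cyl_sub_lt hu (half_pos hε), Iic_mem_atBot T] with t h ht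
  rw [Real.dist_eq]
  exact (abs_circAvg_sub_le hu ht fun θ _ => (h θ).le).trans_lt (half_lt_self hε)

lemma hasDerivAt_integral_Iic {f : ℝ → ℝ} {T t : ℝ} (hf : IntegrableOn f (Set.Iic T))
    (hc : ContinuousOn f (Set.Iic T)) (ht : t < T) :
    HasDerivAt (fun t => ∫ s in Set.Iic t, f s) (f t) t := by
  have hcat : ContinuousAt f t := hc.continuousAt (Iic_mem_nhds ht)
  have hInteg : ∀ s, s ≤ T → IntegrableOn f (Set.Iic s) := fun s hs =>
    hf.mono_set (Set.Iic_subset_Iic.2 hs)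
  have h1 : HasDerivAt (fun s => ∫ x in t..s, f x) (f t) t := by
    refine intervalIntegral.integral_hasDerivAt_right (by simp) ?_ hcat
    exact ⟨Set.Iic T, Iic_mem_nhds ht, hf.aestronglyMeasurable⟩
  refine (h1.const_add (∫ s in Set.Iic t, f s)).congr_of_eventuallyEq ?_
  filter_upwards [Iio_mem_nhds ht] with s hs
  rw [← intervalIntegral.integral_Iic_sub_Iic (hInteg t ht.le) (hInteg s (le_of_lt hs))]
  ring

/-- The divergence theorem for circular averages: the logarithmic derivative of the average is
minus the normalized mass of the enclosed disc. -/
lemma hasDerivAt_circAvg {u : E2 → ℝ} {T : ℝ} {F : ℝ → ℝ → ℝ}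
    (hcont : ContinuousOn u (closedBall 0 (Real.exp T)))
    (hu : ContDiffOn ℝ 2 u (ball 0 (Real.exp T) \ {0}))
    (hF : ContinuousOn (fun q : ℝ × ℝ => F q.1 q.2) {q | q.1 ≤ T})
    (hlap : ∀ t θ, t < T → Real.exp (2 * t) * lap u (cyl t θ) = -F t θ)
    (hInteg : IntegrableOn (fun t => (2 * Real.pi)⁻¹ * ∫ θ in (-Real.pi)..Real.pi, F t θ)
      (Set.Iic T)) {t : ℝ} (ht : t < T) :
    HasDerivAt (circAvg u)
      (-∫ s in Set.Iic t, (2 * Real.pi)⁻¹ * ∫ θ in (-Real.pi)..Real.pi, F s θ) t := by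
  set ρ : ℝ → ℝ := fun t => (2 * Real.pi)⁻¹ * ∫ θ in (-Real.pi)..Real.pi, F t θ with hρ
  set U₁ : ℝ → ℝ := fun t => (2 * Real.pi)⁻¹ *
    ∫ θ in (-Real.pi)..Real.pi, fderiv ℝ u (cyl t θ) (cyl t θ) with hU₁
  have hpi : -Real.pi ≤ Real.pi := by linarith [Real.pi_pos]
  have hset : {q : ℝ × ℝ | q.1 < T} = {q | Real.exp q.1 < Real.exp T} := by
    ext q; simp
  have hρc : ContinuousOn ρ (Set.Iic T) :=
    continuousOn_const.mul (continuousOn_intervalIntegral_of_continuousOn hF)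
  have slice : ∀ {G : ℝ → ℝ → ℝ}, ContinuousOn (fun q : ℝ × ℝ => G q.1 q.2) {q | q.1 < T} →
      ∀ s, s < T → Continuous (G s) := by
    intro G hG s hs
    have : ContinuousOn ((fun q : ℝ × ℝ => G q.1 q.2) ∘ fun θ => (s, θ)) Set.univ :=
      hG.comp (by fun_prop) fun θ _ => hs
    simpa [continuousOn_univ] using! this
  have d1 : ∀ s, s < T → HasDerivAt (circAvg u) (U₁ s) s := by
    intro s hs
    refine HasDerivAt.const_mul (2 * Real.pi)⁻¹ (hasDerivAt_intervalIntegral_of_continuousOn_s1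
      (F := fun t θ => u (cyl t θ)) (F' := fun t θ => fderiv ℝ u (cyl t θ) (cyl t θ)) hs hpi
      ?_ ?_ ?_)
    · refine (continuousOn_comp_cyl (hcont.mono (Set.sdiff_subset (t := {0})))).mono ?_
      intro q hq; exact Real.exp_le_exp.2 (le_of_lt hq)
    · rw [hset]; exact continuousOn_fderiv_cyl_apply hu
    · intro t θ ht'; exact hasDerivAt_comp_cyl_fst hu θ (Real.exp_lt_exp.2 ht')
  have d2 : ∀ s, s < T → HasDerivAt U₁ (-ρ s) s := by
    intro s hs
    have h := (hasDerivAt_intervalIntegral_of_continuousOn_s1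
      (F := fun t θ => fderiv ℝ u (cyl t θ) (cyl t θ)) (F' := cylSecondFst u) hs hpi
      (by rw [hset]; exact continuousOn_fderiv_cyl_apply hu)
      (by rw [hset]; exact continuousOn_cylSecondFst hu)
      (fun t θ ht' => hasDerivAt_fderiv_cyl_fst hu θ (Real.exp_lt_exp.2 ht'))).const_mul
        (2 * Real.pi)⁻¹
    refine h.congr_deriv ?_
    have e1 : ∫ θ in (-Real.pi)..Real.pi, cylSecondSnd u s θ = 0 := by
      rw [intervalIntegral.integral_eq_sub_of_hasDerivAt
        (f := fun θ => fderiv ℝ u (cyl s θ) (cylPerp s θ))]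
      · have a1 : cyl s Real.pi = cyl s (-Real.pi) := by
          rw [← cyl_add_two_pi s (-Real.pi)]; congr 1; ring
        have a2 : cylPerp s Real.pi = cylPerp s (-Real.pi) := by
          rw [← cylPerp_add_two_pi s (-Real.pi)]; congr 1; ring
        simp only [a1, a2, sub_self]
      · intro θ _; exact hasDerivAt_fderiv_cyl_snd hu θ (Real.exp_lt_exp.2 hs)
      · exact (slice (by rw [hset]; exact continuousOn_cylSecondSnd hu) s hs
          ).intervalIntegrable _ _
    have e2 : ∫ θ in (-Real.pi)..Real.pi, cylSecondFst u s θ =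
        ∫ θ in (-Real.pi)..Real.pi, (-F s θ - cylSecondSnd u s θ) := by
      refine intervalIntegral.integral_congr fun θ _ => ?_
      rw [← hlap s θ hs, ← cylSecondFst_add_cylSecondSnd hu θ (Real.exp_lt_exp.2 hs)]
      ring
    have cF : Continuous fun θ => -F s θ :=
      (slice (hF.mono fun q (hq : q.1 < T) => hq.le) s hs).neg
    have cS : Continuous (cylSecondSnd u s) :=
      slice (by rw [hset]; exact continuousOn_cylSecondSnd hu) s hs
    rw [e2, intervalIntegral.integral_sub (cF.intervalIntegrable _ _)
      (cS.intervalIntegrable _ _), e1, intervalIntegral.integral_neg]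
    simp only [hρ]; ring
  set P : ℝ → ℝ := fun t => ∫ s in Set.Iic t, ρ s with hP
  have d3 : ∀ s ∈ Set.Iio T, HasDerivAt (fun s => U₁ s + P s) 0 s := by
    intro s hs
    exact ((d2 s hs).add (hasDerivAt_integral_Iic hInteg hρc hs)).congr_deriv (by ring)
  obtain ⟨c, hc⟩ : ∃ c, ∀ s ∈ Set.Iio T, U₁ s + P s = c := by
    refine IsOpen.exists_is_const_of_deriv_eq_zero (𝕜 := ℝ) isOpen_Iio isPreconnected_Iio
      (fun s hs => (d3 s hs).differentiableAt.differentiableWithinAt)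
      fun s hs => (d3 s hs).deriv
  have hP0 : Tendsto P atBot (nhds 0) := by
    have := intervalIntegral_tendsto_integral_Iic T hInteg tendsto_id
    have h2 : Tendsto (fun i => (∫ x in Set.Iic T, ρ x) - ∫ x in i..T, ρ x) atBot (nhds 0) := by
      simpa using this.const_sub (∫ x in Set.Iic T, ρ x)
    refine h2.congr' ?_
    filter_upwards [Iic_mem_atBot T] with s hs
    rw [← intervalIntegral.integral_Iic_sub_Iic (hInteg.mono_set (Set.Iic_subset_Iic.2 hs)) hInteg]
    ring
  have hU₁c : Tendsto U₁ atBot (nhds c) := by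
    have h2 : Tendsto (fun s => c - P s) atBot (nhds c) := by simpa using hP0.const_sub c
    refine h2.congr' ?_
    filter_upwards [Iio_mem_atBot T] with s hs
    rw [← hc s hs]; ring
  have hc0 : c = 0 := by
    have hmv : ∀ s : ℝ, s < T → ∃ ξ ∈ Set.Ioo (s - 1) s,
        U₁ ξ = circAvg u s - circAvg u (s - 1) := by
      intro s hs
      obtain ⟨ξ, hξ, h⟩ := exists_hasDerivAt_eq_slope (circAvg u) U₁ (show s - 1 < s by linarith)
        (fun x hx => (d1 x (hx.2.trans_lt hs)).continuousAt.continuousWithinAt)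
        (fun x hx => d1 x (hx.2.trans hs))
      exact ⟨ξ, hξ, by rw [h]; simp⟩
    choose! ξ hξ hval using hmv
    have t1 : Tendsto ξ atBot atBot := by
      refine tendsto_atBot_mono' _ ?_ tendsto_id
      filter_upwards [Iio_mem_atBot T] with s hs using (hξ s hs).2.le
    have t2 : Tendsto (fun s => circAvg u s - circAvg u (s - 1)) atBot (nhds 0) := by
      have a := tendsto_circAvg_atBot hcont
      have b := a.comp (tendsto_atBot_add_const_right atBot (-1 : ℝ) tendsto_id)
      have := a.sub b
      rw [sub_self] at this
      exact this
    refine tendsto_nhds_unique (hU₁c.comp t1) (t2.congr' ?_)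
    filter_upwards [Iio_mem_atBot T] with s hs using (hval s hs).symm
  have : U₁ t = -P t := by
    have := hc t ht
    rw [hc0] at this
    linarith
  exact this ▸ d1 t ht

/-- For a matrix satisfying (H1) and (H2), a lower bound `c < (A σ)ᵢ` valid on the support of a
nonnegative vector `σ` propagates to all indices. -/
lemma lt_mulVec_of_lt_on_support {n : ℕ} {A : Matrix (Fin n) (Fin n) ℝ} (hH1 : H1 A)
    (hH2 : H2 A) {I : Finset (Fin n)} (hI : I.Nonempty) {σ : Fin n → ℝ} {c : ℝ}
    (hσ : ∀ j, 0 ≤ σ j) (hσI : ∀ j ∉ I, σ j = 0) (hlt : ∀ i ∈ I, c < ∑ j, A i j * σ j)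
    (i : Fin n) : c < ∑ j, A i j * σ j := by
  classical
  obtain ⟨hsymm, hA0, hirr, hdet⟩ := hH1
  obtain ⟨-, hoff, hrow⟩ := hH2
  set m : Fin n → ℝ := fun i => ∑ j, A i j * σ j with hm
  have hm0 : ∀ i, 0 ≤ m i := fun i => Finset.sum_nonneg fun j _ => mul_nonneg (hA0 i j) (hσ j)
  have hinv : ∀ i, ∑ j, A⁻¹ i j * m j = σ i := by
    intro i
    have h : A⁻¹.mulVec (A.mulVec σ) = σ := by
      rw [Matrix.mulVec_mulVec, Matrix.nonsing_inv_mul A hdet, Matrix.one_mulVec]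
    exact congrFun h i
  by_contra! hcon
  obtain ⟨i₀, -, hmin⟩ := Finset.exists_min_image Finset.univ m ⟨i, Finset.mem_univ i⟩
  have hi₀ : m i₀ ≤ c := (hmin i (Finset.mem_univ i)).trans hcon
  set J : Finset (Fin n) := Finset.univ.filter fun j => m j = m i₀ with hJ
  have hJI : ∀ j ∈ J, j ∉ I := by
    intro j hj hjI
    have h1 : m j = m i₀ := by simpa [hJ] using hj
    have h2 : c < m j := hlt j hjI
    linarith
  have hzero : ∀ i ∈ J, ∀ j ∉ J, A⁻¹ i j = 0 := by
    intro i hi j hj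
    have hmi : m i = m i₀ := by simpa [hJ] using hi
    have hmj : m j ≠ m i₀ := by simpa [hJ] using hj
    have hnn : ∀ l ∈ Finset.univ, 0 ≤ A⁻¹ i l * (m l - m i) := by
      intro l _
      rcases eq_or_ne l i with rfl | hne
      · simp
      · exact mul_nonneg (hoff i l hne.symm) (by linarith [hmin l (Finset.mem_univ l)])
    have hsum : ∑ l, A⁻¹ i l * (m l - m i) + (∑ l, A⁻¹ i l) * m i = 0 := by
      rw [Finset.sum_mul, ← Finset.sum_add_distrib, ← hσI i (hJI i hi), ← hinv i]
      exact Finset.sum_congr rfl fun l _ => by ring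
    have hsum0 : ∑ l, A⁻¹ i l * (m l - m i) = 0 :=
      le_antisymm (by linarith [mul_nonneg (hrow i) (hm0 i)]) (Finset.sum_nonneg hnn)
    have := (Finset.sum_eq_zero_iff_of_nonneg hnn).1 hsum0 j (Finset.mem_univ j)
    rcases mul_eq_zero.1 this with h | h
    · exact h
    · exact absurd (by linarith) hmj
  have hinvsymm : ∀ i j, A⁻¹ i j = A⁻¹ j i := by
    intro i j
    have h : (A⁻¹).transpose = A⁻¹ := by rw [Matrix.transpose_nonsing_inv, hsymm.eq]
    exact (congrFun (congrFun h j) i)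
  set D : Matrix (Fin n) (Fin n) ℝ := Matrix.diagonal fun j => if j ∈ J then 1 else 0 with hD
  have hcomm : D * A⁻¹ = A⁻¹ * D := by
    ext i j
    rw [hD, Matrix.diagonal_mul, Matrix.mul_diagonal]
    by_cases hi : i ∈ J <;> by_cases hj : j ∈ J
    · simp [hi, hj]
    · simp [hi, hj, hzero i hi j hj]
    · simp [hi, hj, hinvsymm i j, hzero j hj i hi]
    · simp [hi, hj]
  have hcomm' : A * D = D * A := by
    calc A * D = A * (D * A⁻¹) * A := by
          rw [Matrix.mul_assoc, Matrix.mul_assoc, Matrix.nonsing_inv_mul A hdet, Matrix.mul_one]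
      _ = D * A := by
          rw [hcomm, ← Matrix.mul_assoc, Matrix.mul_nonsing_inv A hdet, Matrix.one_mul]
  refine hirr ⟨J, ⟨i₀, by simp [hJ]⟩, ?_, ?_⟩
  · obtain ⟨a, ha⟩ := hI
    exact ⟨a, by rw [Finset.mem_compl]; exact fun h => hJI a h ha⟩
  · intro i hi j hj
    have := congrFun (congrFun hcomm' i) j
    rw [hD, Matrix.diagonal_mul, Matrix.mul_diagonal] at this
    simpa [hi, Finset.mem_compl.1 hj] using this.symm

lemma le_of_hasDerivAt_nonneg {f f' : ℝ → ℝ} {a b : ℝ} (hab : a ≤ b)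
    (hc : ContinuousOn f (Set.Icc a b)) (hd : ∀ t ∈ Set.Ioo a b, HasDerivAt f (f' t) t)
    (h : ∀ t ∈ Set.Ioo a b, 0 ≤ f' t) : f a ≤ f b := by
  refine monotoneOn_of_deriv_nonneg (convex_Icc a b) hc ?_ ?_ (Set.left_mem_Icc.2 hab)
    (Set.right_mem_Icc.2 hab) hab
  · rw [interior_Icc]
    exact fun t ht => (hd t ht).differentiableAt.differentiableWithinAt
  · rw [interior_Icc]
    exact fun t ht => (hd t ht).deriv ▸ h t ht

/-- The one-dimensional system satisfied by the circular averages `U`, the angular densities `ρ`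
and the masses `P` of a simple blowup sequence in the logarithmic radial variable `t ≤ T`. -/
structure CylSystem {n : ℕ} (A : Matrix (Fin n) (Fin n) ℝ) (I : Finset (Fin n))
    (μ T b c E : ℝ) (M : ℕ → ℝ) (U ρ P : ℕ → Fin n → ℝ → ℝ) (U₀ : ℕ → Fin n → ℝ)
    (Pinf : Fin n → ℝ → ℝ) : Prop where
  μ_pos : 0 < μ
  b_pos : 0 < b
  c_pos : 0 < c
  A_nonneg : ∀ i j, 0 ≤ A i j
  M_inf : Tendsto M atTop atTop
  ρ_nonneg : ∀ k j t, t ≤ T → 0 ≤ ρ k j t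
  ρ_le_exp : ∀ k j t, t ≤ T → ρ k j t ≤ c * Real.exp (2 * μ * t + μ * M k)
  le_ρ : ∀ k j t, t ≤ T → b * Real.exp (U k j t + 2 * μ * t) ≤ ρ k j t
  ρ_le : ∀ k j t, t ≤ T → ρ k j t ≤ c * Real.exp (U k j t + 2 * μ * t)
  U_cont : ∀ k i, ContinuousOn (U k i) (Set.Iic T)
  U_deriv : ∀ k i t, t < T → HasDerivAt (U k i) (-∑ j, A i j * P k j t) t
  P_cont : ∀ k i, ContinuousOn (P k i) (Set.Iic T)
  P_deriv : ∀ k i t, t < T → HasDerivAt (P k i) (ρ k i t) t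
  P_atBot : ∀ k i, Tendsto (P k i) atBot (nhds 0)
  U_atBot : ∀ k i, Tendsto (U k i) atBot (nhds (U₀ k i))
  P_le : ∀ k i, P k i T ≤ E
  U_le : ∀ k i t, t ≤ T → U k i t ≤ μ * M k
  U₀_ge : ∀ i ∈ I, ∃ B, ∀ᶠ k in atTop, μ * M k - B ≤ U₀ k i
  P_tendsto : ∀ i τ, Tendsto (fun k => P k i (τ - M k / 2)) atTop (nhds (Pinf i τ))
  Pinf_zero : ∀ i ∉ I, ∀ τ, Pinf i τ = 0

namespace CylSystem

variable {n : ℕ} {A : Matrix (Fin n) (Fin n) ℝ} {I : Finset (Fin n)}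
    {μ T b c E : ℝ} {M : ℕ → ℝ} {U ρ P : ℕ → Fin n → ℝ → ℝ} {U₀ : ℕ → Fin n → ℝ}
    {Pinf : Fin n → ℝ → ℝ}

lemma P_mono (S : CylSystem A I μ T b c E M U ρ P U₀ Pinf) (k : ℕ) (i : Fin n) {s t : ℝ}
    (hst : s ≤ t) (ht : t ≤ T) : P k i s ≤ P k i t :=
  le_of_hasDerivAt_nonneg hst
    ((S.P_cont k i).mono fun _ hx => hx.2.trans ht)
    (fun x hx => S.P_deriv k i x (hx.2.trans_le ht))
    fun x hx => S.ρ_nonneg k i x (hx.2.le.trans ht)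

lemma P_nonneg (S : CylSystem A I μ T b c E M U ρ P U₀ Pinf) (k : ℕ) (i : Fin n) {t : ℝ}
    (ht : t ≤ T) : 0 ≤ P k i t := by
  refine le_of_tendsto (S.P_atBot k i) ?_
  filter_upwards [Iic_mem_atBot t] with s hs using S.P_mono k i hs ht

lemma hasDerivAt_exp_aux (μ a K t : ℝ) (hμ : μ ≠ 0) :
    HasDerivAt (fun t => K / μ * Real.exp (μ * t + a)) (K * Real.exp (μ * t + a)) t := by
  have h := ((((hasDerivAt_id t).const_mul μ).add_const a).exp).const_mul (K / μ)
  refine h.congr_deriv ?_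
  simp only [id]
  field_simp

lemma tendsto_exp_aux {μ : ℝ} (a K : ℝ) (hμ : 0 < μ) :
    Tendsto (fun t => K * Real.exp (μ * t + a)) atBot (nhds 0) := by
  have h1 : Tendsto (fun t : ℝ => μ * t + a) atBot atBot :=
    tendsto_atBot_add_const_right _ a (tendsto_id.const_mul_atBot hμ)
  simpa using (Real.tendsto_exp_atBot.comp h1).const_mul K

lemma P_le_exp (S : CylSystem A I μ T b c E M U ρ P U₀ Pinf) (k : ℕ) (i : Fin n) {t : ℝ}
    (ht : t ≤ T) : P k i t ≤ c / (2 * μ) * Real.exp (2 * μ * t + μ * M k) := by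
  have hμ := S.μ_pos
  set f : ℝ → ℝ := fun t => c / (2 * μ) * Real.exp (2 * μ * t + μ * M k) - P k i t with hf
  have hlim : Tendsto f atBot (nhds 0) := by
    simpa using (tendsto_exp_aux (μ * M k) (c / (2 * μ)) (by positivity : 0 < 2 * μ)).sub
      (S.P_atBot k i)
  have : 0 ≤ f t := by
    refine le_of_tendsto hlim ?_
    filter_upwards [Iic_mem_atBot t] with s hs
    refine le_of_hasDerivAt_nonneg
      (f' := fun t => c * Real.exp (2 * μ * t + μ * M k) - ρ k i t) hs ?_ ?_ ?_
    · exact ContinuousOn.sub (by fun_prop) ((S.P_cont k i).mono fun _ hx => hx.2.trans ht)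
    · intro x hx
      exact (hasDerivAt_exp_aux (2 * μ) (μ * M k) c x (by positivity)).sub
        (S.P_deriv k i x (hx.2.trans_le ht))
    · intro x hx
      exact sub_nonneg.2 (S.ρ_le_exp k i x (hx.2.le.trans ht))
  simpa [hf] using this

lemma sum_A_nonneg (S : CylSystem A I μ T b c E M U ρ P U₀ Pinf) (k : ℕ) (i : Fin n) {t : ℝ}
    (ht : t ≤ T) : 0 ≤ ∑ j, A i j * P k j t :=
  Finset.sum_nonneg fun j _ => mul_nonneg (S.A_nonneg i j) (S.P_nonneg k j ht)

lemma sum_A_mono (S : CylSystem A I μ T b c E M U ρ P U₀ Pinf) (k : ℕ) (i : Fin n) {s t : ℝ}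
    (hst : s ≤ t) (ht : t ≤ T) : ∑ j, A i j * P k j s ≤ ∑ j, A i j * P k j t :=
  Finset.sum_le_sum fun j _ => mul_le_mul_of_nonneg_left (S.P_mono k j hst ht) (S.A_nonneg i j)

lemma U_le_U₀ (S : CylSystem A I μ T b c E M U ρ P U₀ Pinf) (k : ℕ) (i : Fin n) {t : ℝ}
    (ht : t ≤ T) : U k i t ≤ U₀ k i := by
  refine ge_of_tendsto (S.U_atBot k i) ?_
  filter_upwards [Iic_mem_atBot t] with s hs
  have := le_of_hasDerivAt_nonneg (f := fun t => -U k i t) (f' := fun t => ∑ j, A i j * P k j t)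
    hs ((S.U_cont k i).mono fun _ hx => hx.2.trans ht).neg
    (fun x hx => by simpa using! (S.U_deriv k i x (hx.2.trans_le ht)).neg)
    fun x hx => S.sum_A_nonneg k i (hx.2.le.trans ht)
  linarith

lemma U₀_le (S : CylSystem A I μ T b c E M U ρ P U₀ Pinf) (k : ℕ) (i : Fin n) {t : ℝ}
    (ht : t ≤ T) : U₀ k i ≤ U k i t +
      (∑ j, A i j) * (c / (2 * μ)) / (2 * μ) * Real.exp (2 * μ * t + μ * M k) := by
  have hμ := S.μ_pos
  set K := (∑ j, A i j) * (c / (2 * μ)) with hK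
  have hlim : Tendsto (fun t => U k i t + K / (2 * μ) * Real.exp (2 * μ * t + μ * M k)) atBot
      (nhds (U₀ k i)) := by
    simpa using (S.U_atBot k i).add
      (tendsto_exp_aux (μ * M k) (K / (2 * μ)) (by positivity : 0 < 2 * μ))
  refine le_of_tendsto hlim ?_
  filter_upwards [Iic_mem_atBot t] with s hs
  refine le_of_hasDerivAt_nonneg (f := fun t => U k i t +
      K / (2 * μ) * Real.exp (2 * μ * t + μ * M k)) (f' := fun t => -∑ j, A i j * P k j t +
      K * Real.exp (2 * μ * t + μ * M k)) hs ?_ ?_ ?_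
  · exact ((S.U_cont k i).mono fun _ hx => hx.2.trans ht).add (by fun_prop)
  · intro x hx
    exact (S.U_deriv k i x (hx.2.trans_le ht)).add
      (hasDerivAt_exp_aux (2 * μ) (μ * M k) K x (by positivity))
  · intro x hx
    have : ∑ j, A i j * P k j x ≤ K * Real.exp (2 * μ * x + μ * M k) := by
      rw [hK, mul_assoc, Finset.sum_mul]
      exact Finset.sum_le_sum fun j _ => mul_le_mul_of_nonneg_left
        (S.P_le_exp k j (hx.2.le.trans ht)) (S.A_nonneg i j)
    linarith

lemma eventually_scaled_le (S : CylSystem A I μ T b c E M U ρ P U₀ Pinf) (τ : ℝ) :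
    ∀ᶠ k in atTop, τ - M k / 2 ≤ T := by
  filter_upwards [S.M_inf.eventually_ge_atTop (2 * (τ - T))] with k hk
  linarith

lemma scaled_exponent (τ : ℝ) (k : ℕ) :
    2 * μ * (τ - M k / 2) + μ * M k = 2 * μ * τ := by ring

lemma Pinf_nonneg (S : CylSystem A I μ T b c E M U ρ P U₀ Pinf) (i : Fin n) (τ : ℝ) :
    0 ≤ Pinf i τ := by
  refine ge_of_tendsto (S.P_tendsto i τ) ?_
  filter_upwards [S.eventually_scaled_le τ] with k hk using S.P_nonneg k i hk

lemma Pinf_le (S : CylSystem A I μ T b c E M U ρ P U₀ Pinf) (i : Fin n) (τ : ℝ) :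
    Pinf i τ ≤ E := by
  refine le_of_tendsto (S.P_tendsto i τ) ?_
  filter_upwards [S.eventually_scaled_le τ] with k hk
  exact (S.P_mono k i hk le_rfl).trans (S.P_le k i)

lemma Pinf_mono (S : CylSystem A I μ T b c E M U ρ P U₀ Pinf) (i : Fin n) :
    Monotone (Pinf i) := by
  intro s t hst
  refine le_of_tendsto_of_tendsto (S.P_tendsto i s) (S.P_tendsto i t) ?_
  filter_upwards [S.eventually_scaled_le t] with k hk
  exact S.P_mono k i (by linarith) hk

/-- The limiting mass. -/
def mass (Pinf : Fin n → ℝ → ℝ) (i : Fin n) : ℝ := ⨆ τ, Pinf i τ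

lemma bddAbove_Pinf (S : CylSystem A I μ T b c E M U ρ P U₀ Pinf) (i : Fin n) :
    BddAbove (Set.range (Pinf i)) :=
  ⟨E, by rintro _ ⟨τ, rfl⟩; exact S.Pinf_le i τ⟩

lemma tendsto_Pinf (S : CylSystem A I μ T b c E M U ρ P U₀ Pinf) (i : Fin n) :
    Tendsto (Pinf i) atTop (nhds (mass Pinf i)) :=
  tendsto_atTop_ciSup (S.Pinf_mono i) (S.bddAbove_Pinf i)

/-- On the components that survive in the limit, finiteness of the mass forces the decay rate to
exceed `2μ`. -/
lemma lt_sum_mass_of_mem (S : CylSystem A I μ T b c E M U ρ P U₀ Pinf) {i : Fin n}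
    (hi : i ∈ I) : 2 * μ < ∑ j, A i j * mass Pinf j := by
  have hμ := S.μ_pos
  by_contra! hle
  obtain ⟨B, hB⟩ := S.U₀_ge i hi
  set K := (∑ j, A i j) * (c / (2 * μ)) / (2 * μ) with hK
  set b' := b * Real.exp (-B - K - 1) with hb'
  have hb'pos : 0 < b' := mul_pos S.b_pos (Real.exp_pos _)
  have hE : 0 ≤ E := (S.Pinf_nonneg i 0).trans (S.Pinf_le i 0)
  set τ := (E + 1) / b' with hτ
  have hτpos : 0 < τ := by positivity
  have hlim : Tendsto (fun k => ∑ j, A i j * P k j (τ - M k / 2)) atTop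
      (nhds (∑ j, A i j * Pinf j τ)) :=
    tendsto_finsetSum _ fun j _ => (S.P_tendsto j τ).const_mul _
  have hlt : ∑ j, A i j * Pinf j τ < 2 * μ + 1 / τ := by
    have : ∑ j, A i j * Pinf j τ ≤ ∑ j, A i j * mass Pinf j :=
      Finset.sum_le_sum fun j _ => mul_le_mul_of_nonneg_left
        (le_ciSup (S.bddAbove_Pinf j) τ) (S.A_nonneg i j)
    have : 0 < 1 / τ := by positivity
    linarith
  obtain ⟨k, hk1, hk2, hk3⟩ := (hB.and ((S.eventually_scaled_le τ).and
    (hlim.eventually_lt_const hlt))).exists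
  have hU : ∀ t ∈ Set.Icc (-(M k / 2)) (τ - M k / 2), -B - K - 1 ≤ U k i t + 2 * μ * t := by
    intro t ht
    have h0T : -(M k / 2) ≤ T := by linarith
    have h1 := le_of_hasDerivAt_nonneg (f := fun t => U k i t + (2 * μ + 1 / τ) * t)
      (f' := fun t => -(∑ j, A i j * P k j t) + (2 * μ + 1 / τ)) ht.1
      (((S.U_cont k i).mono fun _ hx => hx.2.trans (ht.2.trans hk2)).add (by fun_prop))
      (fun x hx => (S.U_deriv k i x (hx.2.trans_le (ht.2.trans hk2))).add
        (by simpa using (hasDerivAt_id x).const_mul (2 * μ + 1 / τ)))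
      (fun x hx => by
        have := S.sum_A_mono k i (hx.2.le.trans ht.2) hk2
        linarith)
    have h2 := S.U₀_le k i h0T
    have h3 : Real.exp (2 * μ * -(M k / 2) + μ * M k) = 1 := by
      rw [← Real.exp_zero]; congr 1; ring
    rw [h3, mul_one, ← hK] at h2
    have h4 : 1 / τ * (t + M k / 2) ≤ 1 := by
      rw [div_mul_eq_mul_div, one_mul, div_le_one hτpos]
      linarith [ht.2]
    nlinarith
  have hmain := le_of_hasDerivAt_nonneg (f := fun t => P k i t - b' * t)
    (f' := fun t => ρ k i t - b') (a := -(M k / 2)) (b := τ - M k / 2) (by linarith)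
    (((S.P_cont k i).mono fun _ hx => hx.2.trans hk2).sub (by fun_prop))
    (fun x hx => (S.P_deriv k i x (hx.2.trans_le hk2)).sub
        (by simpa using (hasDerivAt_id x).const_mul b'))
    (fun x hx => by
      refine sub_nonneg.2 (le_trans ?_ (S.le_ρ k i x (hx.2.le.trans hk2)))
      exact mul_le_mul_of_nonneg_left (Real.exp_le_exp.2 (hU x ⟨hx.1.le, hx.2.le⟩)) S.b_pos.le)
  have h5 : 0 ≤ P k i (-(M k / 2)) := S.P_nonneg k i (by linarith)
  have h6 : P k i (τ - M k / 2) ≤ E := (S.P_mono k i hk2 le_rfl).trans (S.P_le k i)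
  have h7 : b' * τ = E + 1 := by rw [hτ]; field_simp
  nlinarith

/-- Exponential decay of the densities in the neck region. -/
lemma exists_neck_decay (S : CylSystem A I μ T b c E M U ρ P U₀ Pinf) (hH1 : H1 A) (hH2 : H2 A)
    (hI : I.Nonempty) : ∃ τ η : ℝ, 0 < η ∧ ∀ᶠ k in atTop, ∀ i t, τ - M k / 2 ≤ t → t ≤ T →
      U k i t + 2 * μ * t ≤ 2 * μ * τ - η * (t - (τ - M k / 2)) := by
  have hmass0 : ∀ j, 0 ≤ mass Pinf j := fun j =>
    (S.Pinf_nonneg j 0).trans (le_ciSup (S.bddAbove_Pinf j) 0)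
  have hmassI : ∀ j ∉ I, mass Pinf j = 0 := fun j hj => by
    simp [mass, S.Pinf_zero j hj]
  have hlt := lt_mulVec_of_lt_on_support hH1 hH2 hI hmass0 hmassI
    fun i hi => S.lt_sum_mass_of_mem hi
  obtain ⟨η, hη, hηlt⟩ : ∃ η > 0, ∀ i, 2 * μ + η < ∑ j, A i j * mass Pinf j := by
    have : ∀ᶠ η in nhdsWithin (0 : ℝ) (Set.Ioi 0), ∀ i, 2 * μ + η < ∑ j, A i j * mass Pinf j := by
      rw [eventually_all]
      intro i
      have : Tendsto (fun η : ℝ => 2 * μ + η) (nhdsWithin 0 (Set.Ioi 0)) (nhds (2 * μ + 0)) :=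
        (by fun_prop : Continuous fun η : ℝ => 2 * μ + η).continuousAt.tendsto.mono_left
          nhdsWithin_le_nhds
      rw [add_zero] at this
      exact this.eventually_lt_const (hlt i)
    obtain ⟨η, h1, h2⟩ := (this.and self_mem_nhdsWithin).exists
    exact ⟨η, h2, h1⟩
  obtain ⟨τ, hτ⟩ : ∃ τ, ∀ i, 2 * μ + η < ∑ j, A i j * Pinf j τ := by
    have : ∀ᶠ τ in atTop, ∀ i, 2 * μ + η < ∑ j, A i j * Pinf j τ := by
      rw [eventually_all]
      intro i
      exact (tendsto_finsetSum _ fun j _ => (S.tendsto_Pinf j).const_mul _).eventually_const_lt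
        (hηlt i)
    exact this.exists
  refine ⟨τ, η, hη, ?_⟩
  have hev : ∀ᶠ k in atTop, ∀ i, 2 * μ + η < ∑ j, A i j * P k j (τ - M k / 2) := by
    rw [eventually_all]
    intro i
    exact (tendsto_finsetSum _ fun j _ => (S.P_tendsto j τ).const_mul _).eventually_const_lt
        (hτ i)
  filter_upwards [hev] with k hk i t hst ht
  have h1 := le_of_hasDerivAt_nonneg (f := fun t => -(U k i t + (2 * μ + η) * t))
    (f' := fun t => -(-(∑ j, A i j * P k j t) + (2 * μ + η))) hst
    (((S.U_cont k i).mono fun _ hx => hx.2.trans ht).add (by fun_prop)).neg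
    (fun x hx => ((S.U_deriv k i x (hx.2.trans_le ht)).add
      (by simpa using (hasDerivAt_id x).const_mul (2 * μ + η))).neg)
    (fun x hx => by
      have := S.sum_A_mono k i hx.1.le (hx.2.le.trans ht)
      linarith [hk i])
  have h2 := S.U_le k i _ (hst.trans ht)
  nlinarith

/-- Boundary asymptotics of the circular averages. -/
lemma exists_boundary_bound (S : CylSystem A I μ T b c E M U ρ P U₀ Pinf) {τ η : ℝ} (hη : 0 < η)
    (hneck : ∀ᶠ k in atTop, ∀ i t, τ - M k / 2 ≤ t → t ≤ T →
      U k i t + 2 * μ * t ≤ 2 * μ * τ - η * (t - (τ - M k / 2))) :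
    ∃ C, ∀ᶠ k in atTop, ∀ i,
      |U k i T - (-(∑ j, A i j * P k j T) * T - (∑ j, A i j * P k j T) / 2 * M k + U₀ k i)|
        ≤ C := by
  have hμ := S.μ_pos
  have hc := S.c_pos
  set G := c * Real.exp (2 * μ * τ) with hG
  have hGpos : 0 < G := by positivity
  have hbound : ∀ i, ∃ C, ∀ᶠ k in atTop,
      |U k i T - (-(∑ j, A i j * P k j T) * T - (∑ j, A i j * P k j T) / 2 * M k + U₀ k i)|
        ≤ C := by
    intro i
    set a := ∑ j, A i j with ha
    have ha0 : 0 ≤ a := Finset.sum_nonneg fun j _ => S.A_nonneg i j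
    set K := a * (G / η) with hK
    refine ⟨a * E * |τ| + K / η + a * (c / (2 * μ)) / (2 * μ) * Real.exp (2 * μ * τ), ?_⟩
    filter_upwards [hneck, S.eventually_scaled_le τ] with k hk hsT
    set s := τ - M k / 2 with hs
    set m := ∑ j, A i j * P k j T with hm
    have hder : ∀ K' x : ℝ, HasDerivAt (fun t => K' / η * Real.exp (-η * t + η * s))
        (-(K' * Real.exp (-η * x + η * s))) x := by
      intro K' x
      refine ((hasDerivAt_exp_aux (-η) (η * s) K' x (by linarith)).neg).congr_of_eventuallyEq ?_
      filter_upwards with t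
      simp only [Pi.neg_apply]
      rw [div_neg]; ring
    have hρ : ∀ j t, s ≤ t → t ≤ T → ρ k j t ≤ G * Real.exp (-η * t + η * s) := by
      intro j t hst ht
      refine (S.ρ_le k j t ht).trans ?_
      rw [hG, mul_assoc c, ← Real.exp_add]
      refine mul_le_mul_of_nonneg_left (Real.exp_le_exp.2 ?_) hc.le
      linarith [hk j t hst ht]
    have htail : ∀ j t, s ≤ t → t ≤ T →
        P k j T - P k j t ≤ G / η * Real.exp (-η * t + η * s) := by
      intro j t hst ht
      have h1 := le_of_hasDerivAt_nonneg
        (f := fun t => -(P k j t + G / η * Real.exp (-η * t + η * s)))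
        (f' := fun t => -(ρ k j t + -(G * Real.exp (-η * t + η * s)))) ht
        (((S.P_cont k j).mono fun _ hx => hx.2).add (by fun_prop)).neg
        (fun x hx => ((S.P_deriv k j x hx.2).add (hder G x)).neg)
        (fun x hx => by linarith [hρ j x (hst.trans hx.1.le) hx.2.le])
      have : 0 ≤ G / η * Real.exp (-η * T + η * s) := by positivity
      linarith
    have hlin : ∀ x, HasDerivAt (fun t => m * t) m x := fun x => by
      simpa using (hasDerivAt_id x).const_mul m
    have hupper := le_of_hasDerivAt_nonneg
      (f := fun t => -(U k i t + m * t + K / η * Real.exp (-η * t + η * s)))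
      (f' := fun t => -(-(∑ j, A i j * P k j t) + m + -(K * Real.exp (-η * t + η * s)))) hsT
      ((((S.U_cont k i).mono fun _ hx => hx.2).add (by fun_prop)).add (by fun_prop)).neg
      (fun x hx => (((S.U_deriv k i x hx.2).add (hlin x)).add (hder K x)).neg)
      (fun x hx => by
        have : m - ∑ j, A i j * P k j x ≤ K * Real.exp (-η * x + η * s) := by
          rw [hm, ← Finset.sum_sub_distrib, hK, ha, mul_assoc, Finset.sum_mul]
          refine Finset.sum_le_sum fun j _ => ?_
          rw [← mul_sub]
          exact mul_le_mul_of_nonneg_left (htail j x hx.1.le hx.2.le) (S.A_nonneg i j)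
        linarith)
    have hlower := le_of_hasDerivAt_nonneg (f := fun t => U k i t + m * t)
      (f' := fun t => -(∑ j, A i j * P k j t) + m) hsT
      (((S.U_cont k i).mono fun _ hx => hx.2).add (by fun_prop))
      (fun x hx => (S.U_deriv k i x hx.2).add (hlin x))
      (fun x hx => by linarith [S.sum_A_mono k i hx.2.le le_rfl])
    have e0 : Real.exp (-η * s + η * s) = 1 := by rw [← Real.exp_zero]; congr 1; ring
    have hT0 : 0 ≤ K / η * Real.exp (-η * T + η * s) := by positivity
    have hU1 := S.U_le_U₀ k i hsT
    have hU2 := S.U₀_le k i hsT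
    rw [hs, scaled_exponent, ← hs] at hU2
    have hm0 : 0 ≤ m := S.sum_A_nonneg k i le_rfl
    have hmE : m ≤ a * E := by
      rw [hm, ha, Finset.sum_mul]
      exact Finset.sum_le_sum fun j _ => mul_le_mul_of_nonneg_left (S.P_le k j) (S.A_nonneg i j)
    have hmτ : |m * τ| ≤ a * E * |τ| := by
      rw [abs_mul, abs_of_nonneg hm0]
      exact mul_le_mul_of_nonneg_right hmE (abs_nonneg τ)
    simp only [e0, mul_one] at hupper hlower
    have hms : m * s = m * τ - m / 2 * M k := by rw [hs]; ring
    have hKη : 0 ≤ K / η := by positivity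
    have hlast : 0 ≤ a * (c / (2 * μ)) / (2 * μ) * Real.exp (2 * μ * τ) := by positivity
    have hb := abs_le.1 hmτ
    rw [abs_le]
    constructor <;> linarith [hb.1, hb.2]
  choose C hC using hbound
  refine ⟨∑ i, |C i|, ?_⟩
  filter_upwards [eventually_all.2 hC] with k hk i
  exact ((hk i).trans (le_abs_self _)).trans
    (Finset.single_le_sum (f := fun i => |C i|) (fun i _ => abs_nonneg _) (Finset.mem_univ i))

end CylSystem

lemma integrableOn_prod_Ioo_of_fst {G : ℝ → ℝ} {s : Set ℝ} (hG : IntegrableOn G s) (a b : ℝ) :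
    IntegrableOn (fun q : ℝ × ℝ => G q.1) (s ×ˢ Set.Ioo a b) := by
  have h : IntegrableOn (fun _ : ℝ => (1 : ℝ)) (Set.Ioo a b) :=
    integrableOn_const (by simp) (by simp)
  have := Integrable.mul_prod hG h
  simpa [IntegrableOn, Measure.volume_eq_prod, Measure.prod_restrict] using! this

lemma integrableOn_exp_affine_Iic {a : ℝ} (ha : 0 < a) (c d t : ℝ) :
    IntegrableOn (fun s : ℝ => c * Real.exp (a * s + d)) (Set.Iic t) := by
  have : IntegrableOn (fun s : ℝ => c * Real.exp d * Real.exp (a * s)) (Set.Iic t) :=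
    (integrableOn_exp_mul_Iic ha t).const_mul (c * Real.exp d)
  refine this.congr_fun (fun s _ => ?_) measurableSet_Iic
  simp only [Real.exp_add]
  ring

/-- The energy density `h |x|^{2γ} e^u` in logarithmic polar coordinates, `μ = 1 + γ`. -/
def cylDensity (μ : ℝ) (h u : E2 → ℝ) (t θ : ℝ) : ℝ :=
  h (cyl t θ) * Real.exp (u (cyl t θ) + 2 * μ * t)

/-- The angular average of the energy density. -/
def angDensity (μ : ℝ) (h u : E2 → ℝ) (t : ℝ) : ℝ :=
  (2 * Real.pi)⁻¹ * ∫ θ in (-Real.pi)..Real.pi, cylDensity μ h u t θ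

/-- The normalized energy in the disc of radius `exp t`. -/
def cylMass (μ : ℝ) (h u : E2 → ℝ) (t : ℝ) : ℝ :=
  ∫ s in Set.Iic t, angDensity μ h u s

section Density

variable {μ T : ℝ} {h u : E2 → ℝ}

lemma exp_mul_norm_cyl_rpow (γ t θ : ℝ) :
    Real.exp (2 * t) * ‖cyl t θ‖ ^ (2 * γ) = Real.exp (2 * (1 + γ) * t) := by
  rw [norm_cyl, ← Real.exp_mul, ← Real.exp_add]
  ring_nf

lemma exp_mul_density_eq (γ t θ : ℝ) (h u : E2 → ℝ) :
    Real.exp (2 * t) * (‖cyl t θ‖ ^ (2 * γ) * (h (cyl t θ) * Real.exp (u (cyl t θ)))) =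
      cylDensity (1 + γ) h u t θ := by
  rw [← mul_assoc, exp_mul_norm_cyl_rpow, cylDensity, Real.exp_add]
  ring

lemma continuousOn_cylDensity (hh : ContinuousOn h (closedBall 0 (Real.exp T)))
    (hu : ContinuousOn u (closedBall 0 (Real.exp T))) :
    ContinuousOn (fun q : ℝ × ℝ => cylDensity μ h u q.1 q.2) {q | q.1 ≤ T} := by
  have e : {q : ℝ × ℝ | q.1 ≤ T} = {q | Real.exp q.1 ≤ Real.exp T} := by
    simp [Real.exp_le_exp]
  have h1 := continuousOn_comp_cyl (hh.mono (Set.sdiff_subset (t := {0})))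
  have h2 := continuousOn_comp_cyl (hu.mono (Set.sdiff_subset (t := {0})))
  rw [e]
  exact h1.mul ((h2.add (by fun_prop)).rexp)

lemma continuous_cylDensity_snd (hh : ContinuousOn h (closedBall 0 (Real.exp T)))
    (hu : ContinuousOn u (closedBall 0 (Real.exp T))) {t : ℝ} (ht : t ≤ T) :
    Continuous fun θ => cylDensity μ h u t θ := by
  have := (continuousOn_cylDensity (μ := μ) hh hu).comp
    (f := fun θ : ℝ => (t, θ)) (s := Set.univ) (by fun_prop) fun θ _ => ht
  simpa [continuousOn_univ] using! this

lemma continuousOn_angDensity (hh : ContinuousOn h (closedBall 0 (Real.exp T)))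
    (hu : ContinuousOn u (closedBall 0 (Real.exp T))) :
    ContinuousOn (angDensity μ h u) (Set.Iic T) :=
  continuousOn_const.mul (continuousOn_intervalIntegral_of_continuousOn
    (continuousOn_cylDensity hh hu))

lemma angDensity_mono_const (hh : ContinuousOn h (closedBall 0 (Real.exp T)))
    (hu : ContinuousOn u (closedBall 0 (Real.exp T))) {t c d : ℝ} (ht : t ≤ T)
    (hb : ∀ θ ∈ Set.Icc (-Real.pi) Real.pi,
      c ≤ cylDensity μ h u t θ ∧ cylDensity μ h u t θ ≤ d) :
    c ≤ angDensity μ h u t ∧ angDensity μ h u t ≤ d := by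
  have hpi : -Real.pi ≤ Real.pi := by linarith [Real.pi_pos]
  have hc := continuous_cylDensity_snd (μ := μ) hh hu ht
  have e : ∀ x : ℝ, x = (2 * Real.pi)⁻¹ * ∫ _ in (-Real.pi)..Real.pi, x := by
    intro x
    rw [intervalIntegral.integral_const, smul_eq_mul]
    field_simp
    ring
  constructor
  · rw [e c]
    exact mul_le_mul_of_nonneg_left (intervalIntegral.integral_mono_on hpi
      intervalIntegrable_const (hc.intervalIntegrable _ _) fun θ hθ => (hb θ hθ).1) (by positivity)
  · rw [e d]
    exact mul_le_mul_of_nonneg_left (intervalIntegral.integral_mono_on hpi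
      (hc.intervalIntegrable _ _) intervalIntegrable_const fun θ hθ => (hb θ hθ).2) (by positivity)

lemma cylDensity_nonneg (h_nn : ∀ x ∈ closedBall (0 : E2) (Real.exp T), 0 ≤ h x) {t : ℝ}
    (ht : t ≤ T) (θ : ℝ) : 0 ≤ cylDensity μ h u t θ :=
  mul_nonneg (h_nn _ (cyl_mem_closedBall (Real.exp_le_exp.2 ht))) (Real.exp_pos _).le

lemma cylDensity_le {c₂ m : ℝ} (h_nn : ∀ x ∈ closedBall (0 : E2) (Real.exp T), 0 ≤ h x)
    (h_le : ∀ x ∈ closedBall (0 : E2) (Real.exp T), h x ≤ c₂) {t θ : ℝ} (ht : t ≤ T)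
    (hm : u (cyl t θ) + 2 * μ * t ≤ m) : cylDensity μ h u t θ ≤ c₂ * Real.exp m := by
  have hmem := cyl_mem_closedBall (θ := θ) (Real.exp_le_exp.2 ht)
  exact mul_le_mul (h_le _ hmem) (Real.exp_le_exp.2 hm) (Real.exp_pos _).le
    ((h_nn _ hmem).trans (h_le _ hmem))

variable {c₂ m : ℝ}

lemma cylDensity_le_exp
    (h_nn : ∀ x ∈ closedBall (0 : E2) (Real.exp T), 0 ≤ h x)
    (h_le : ∀ x ∈ closedBall (0 : E2) (Real.exp T), h x ≤ c₂)
    (u_le : ∀ x ∈ closedBall (0 : E2) (Real.exp T), u x ≤ m)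
    {t : ℝ} (ht : t ≤ T) (θ : ℝ) :
    cylDensity μ h u t θ ≤ c₂ * Real.exp (2 * μ * t + m) :=
  cylDensity_le h_nn h_le ht (by
    linarith [u_le _ (cyl_mem_closedBall (θ := θ) (Real.exp_le_exp.2 ht))])

lemma integrableOn_cylDensity
    (hμ : 0 < μ)
    (hh : ContinuousOn h (closedBall 0 (Real.exp T)))
    (hu : ContinuousOn u (closedBall 0 (Real.exp T)))
    (h_nn : ∀ x ∈ closedBall (0 : E2) (Real.exp T), 0 ≤ h x)
    (h_le : ∀ x ∈ closedBall (0 : E2) (Real.exp T), h x ≤ c₂)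
    (u_le : ∀ x ∈ closedBall (0 : E2) (Real.exp T), u x ≤ m)
    {t : ℝ} (ht : t ≤ T) :
    IntegrableOn (fun q : ℝ × ℝ => cylDensity μ h u q.1 q.2)
      (Set.Iic t ×ˢ Set.Ioo (-Real.pi) Real.pi) := by
  have hms : MeasurableSet (Set.Iic t ×ˢ Set.Ioo (-Real.pi) Real.pi) :=
    measurableSet_Iic.prod measurableSet_Ioo
  refine Integrable.mono' (integrableOn_prod_Ioo_of_fst
    (integrableOn_exp_affine_Iic (a := 2 * μ) (by positivity) c₂ m t) _ _) ?_ ?_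
  · exact ((continuousOn_cylDensity hh hu).mono fun q hq =>
      le_trans hq.1 ht).aestronglyMeasurable hms
  · refine (ae_restrict_iff' hms).2 (Eventually.of_forall fun q hq => ?_)
    have hq1 : q.1 ≤ T := le_trans hq.1 ht
    rw [Real.norm_eq_abs, abs_of_nonneg (cylDensity_nonneg h_nn hq1 q.2)]
    exact cylDensity_le_exp h_nn h_le u_le hq1 q.2

lemma angDensity_nonneg_and_le
    (hh : ContinuousOn h (closedBall 0 (Real.exp T)))
    (hu : ContinuousOn u (closedBall 0 (Real.exp T)))
    (h_nn : ∀ x ∈ closedBall (0 : E2) (Real.exp T), 0 ≤ h x)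
    (h_le : ∀ x ∈ closedBall (0 : E2) (Real.exp T), h x ≤ c₂)
    (u_le : ∀ x ∈ closedBall (0 : E2) (Real.exp T), u x ≤ m)
    {t : ℝ} (ht : t ≤ T) :
    0 ≤ angDensity μ h u t ∧ angDensity μ h u t ≤ c₂ * Real.exp (2 * μ * t + m) :=
  angDensity_mono_const hh hu ht fun θ _ =>
    ⟨cylDensity_nonneg h_nn ht θ, cylDensity_le_exp h_nn h_le u_le ht θ⟩

lemma integrableOn_angDensity
    (hμ : 0 < μ)
    (hh : ContinuousOn h (closedBall 0 (Real.exp T)))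
    (hu : ContinuousOn u (closedBall 0 (Real.exp T)))
    (h_nn : ∀ x ∈ closedBall (0 : E2) (Real.exp T), 0 ≤ h x)
    (h_le : ∀ x ∈ closedBall (0 : E2) (Real.exp T), h x ≤ c₂)
    (u_le : ∀ x ∈ closedBall (0 : E2) (Real.exp T), u x ≤ m) :
    IntegrableOn (angDensity μ h u) (Set.Iic T) := by
  refine Integrable.mono' (integrableOn_exp_affine_Iic (a := 2 * μ) (by positivity) c₂ m T)
    ((continuousOn_angDensity hh hu).aestronglyMeasurable measurableSet_Iic) ?_
  refine (ae_restrict_iff' measurableSet_Iic).2 (Eventually.of_forall fun t ht => ?_)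
  have := angDensity_nonneg_and_le (μ := μ) hh hu h_nn h_le u_le ht
  rw [Real.norm_eq_abs, abs_of_nonneg this.1]
  exact this.2

lemma cylMass_eq_setIntegral
    (hμ : 0 < μ)
    (hh : ContinuousOn h (closedBall 0 (Real.exp T)))
    (hu : ContinuousOn u (closedBall 0 (Real.exp T)))
    (h_nn : ∀ x ∈ closedBall (0 : E2) (Real.exp T), 0 ≤ h x)
    (h_le : ∀ x ∈ closedBall (0 : E2) (Real.exp T), h x ≤ c₂)
    (u_le : ∀ x ∈ closedBall (0 : E2) (Real.exp T), u x ≤ m)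
    {t : ℝ} (ht : t ≤ T) :
    cylMass μ h u t = (2 * Real.pi)⁻¹ *
      ∫ q in Set.Iic t ×ˢ Set.Ioo (-Real.pi) Real.pi, cylDensity μ h u q.1 q.2 := by
  have hpi : -Real.pi ≤ Real.pi := by linarith [Real.pi_pos]
  have := setIntegral_prod _ (integrableOn_cylDensity hμ hh hu h_nn h_le u_le ht)
  rw [Measure.volume_eq_prod, this, cylMass, ← integral_const_mul]
  simp only [angDensity, intervalIntegral.integral_of_le hpi, integral_Ioc_eq_integral_Ioo]

lemma hasDerivAt_cylMass
    (hμ : 0 < μ)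
    (hh : ContinuousOn h (closedBall 0 (Real.exp T)))
    (hu : ContinuousOn u (closedBall 0 (Real.exp T)))
    (h_nn : ∀ x ∈ closedBall (0 : E2) (Real.exp T), 0 ≤ h x)
    (h_le : ∀ x ∈ closedBall (0 : E2) (Real.exp T), h x ≤ c₂)
    (u_le : ∀ x ∈ closedBall (0 : E2) (Real.exp T), u x ≤ m)
    {t : ℝ} (ht : t < T) :
    HasDerivAt (cylMass μ h u) (angDensity μ h u t) t :=
  hasDerivAt_integral_Iic (integrableOn_angDensity hμ hh hu h_nn h_le u_le)
    (continuousOn_angDensity hh hu) ht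

lemma continuousOn_cylMass
    (hμ : 0 < μ)
    (hh : ContinuousOn h (closedBall 0 (Real.exp T)))
    (hu : ContinuousOn u (closedBall 0 (Real.exp T)))
    (h_nn : ∀ x ∈ closedBall (0 : E2) (Real.exp T), 0 ≤ h x)
    (h_le : ∀ x ∈ closedBall (0 : E2) (Real.exp T), h x ≤ c₂)
    (u_le : ∀ x ∈ closedBall (0 : E2) (Real.exp T), u x ≤ m) :
    ContinuousOn (cylMass μ h u) (Set.Iic T) := by
  have hInteg := integrableOn_angDensity hμ hh hu h_nn h_le u_le
  intro t ht
  have h1 : ContinuousOn (fun s => ∫ x in (t - 1)..s, angDensity μ h u x) (Set.Icc (t - 1) T) := by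
    have hle : t - 1 ≤ T := by linarith [show t ≤ T from ht]
    rw [← Set.uIcc_of_le hle]
    refine intervalIntegral.continuousOn_primitive_interval (hInteg.mono_set ?_)
    rw [Set.uIcc_of_le hle]
    exact fun x hx => hx.2
  have h2 : ContinuousWithinAt (fun s => ∫ x in (t - 1)..s, angDensity μ h u x)
      (Set.Iic T) t := by
    refine (h1 t ⟨by linarith, ht⟩).mono_of_mem_nhdsWithin ?_
    rw [← Set.Ici_inter_Iic]
    exact Filter.inter_mem (mem_nhdsWithin_of_mem_nhds (Ici_mem_nhds (by linarith)))
      self_mem_nhdsWithin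
  refine (h2.const_add (∫ x in Set.Iic (t - 1), angDensity μ h u x)).congr (fun s hs => ?_) ?_ <;>
  · rw [← intervalIntegral.integral_Iic_sub_Iic
      (hInteg.mono_set (Set.Iic_subset_Iic.2 (by linarith [show t ≤ T from ht])))
      (hInteg.mono_set (Set.Iic_subset_Iic.2 (by assumption))), cylMass]
    ring

lemma tendsto_cylMass_atBot
    (hμ : 0 < μ)
    (hh : ContinuousOn h (closedBall 0 (Real.exp T)))
    (hu : ContinuousOn u (closedBall 0 (Real.exp T)))
    (h_nn : ∀ x ∈ closedBall (0 : E2) (Real.exp T), 0 ≤ h x)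
    (h_le : ∀ x ∈ closedBall (0 : E2) (Real.exp T), h x ≤ c₂)
    (u_le : ∀ x ∈ closedBall (0 : E2) (Real.exp T), u x ≤ m) :
    Tendsto (cylMass μ h u) atBot (nhds 0) := by
  have hμ2 : 0 < 2 * μ := by positivity
  refine squeeze_zero' (g := fun t => c₂ / (2 * μ) * Real.exp (2 * μ * t + m)) ?_ ?_
    (CylSystem.tendsto_exp_aux _ _ hμ2)
  · filter_upwards [Iic_mem_atBot T] with t ht
    exact setIntegral_nonneg measurableSet_Iic fun s hs =>
      (angDensity_nonneg_and_le hh hu h_nn h_le u_le (le_trans hs ht)).1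
  · filter_upwards [Iic_mem_atBot T] with t ht
    have h1 : cylMass μ h u t ≤ ∫ s in Set.Iic t, c₂ * Real.exp (2 * μ * s + m) :=
      setIntegral_mono_on
        ((integrableOn_angDensity hμ hh hu h_nn h_le u_le).mono_set (Set.Iic_subset_Iic.2 ht))
        (integrableOn_exp_affine_Iic hμ2 _ _ _) measurableSet_Iic
        fun s hs => (angDensity_nonneg_and_le hh hu h_nn h_le u_le (le_trans hs ht)).2
    refine h1.trans (le_of_eq ?_)
    simp only [Real.exp_add]
    rw [integral_const_mul, integral_mul_const, integral_exp_mul_Iic hμ2]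
    ring

end Density

lemma sigmaK_eq_cylMass {n : ℕ} {γ T c₂ m : ℝ} {h u : ℕ → Fin n → E2 → ℝ} {k : ℕ} {i : Fin n}
    (hμ : 0 < 1 + γ) (hh : ContinuousOn (h k i) (closedBall 0 (Real.exp T)))
    (hu : ContinuousOn (u k i) (closedBall 0 (Real.exp T)))
    (h_nn : ∀ x ∈ closedBall (0 : E2) (Real.exp T), 0 ≤ h k i x)
    (h_le : ∀ x ∈ closedBall (0 : E2) (Real.exp T), h k i x ≤ c₂)
    (u_le : ∀ x ∈ closedBall (0 : E2) (Real.exp T), u k i x ≤ m) :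
    sigmaK (Real.exp T) γ h u k i = cylMass (1 + γ) (h k i) (u k i) T := by
  rw [sigmaK, cylMass_eq_setIntegral hμ hh hu h_nn h_le u_le le_rfl,
    setIntegral_closedBall_eq_integral_cyl, one_div]
  congr 2
  funext q
  rw [← exp_mul_density_eq]
  ring

lemma setIntegral_Iic_prod_translate (f : ℝ × ℝ → ℝ) (τ a : ℝ) {J : Set ℝ}
    (hJ : MeasurableSet J) :
    ∫ q in Set.Iic (τ - a) ×ˢ J, f q = ∫ q in (Set.univ : Set ℝ) ×ˢ J,
      {q : ℝ × ℝ | q.1 ≤ τ}.indicator (fun q => f (q.1 - a, q.2)) q := by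
  rw [← integral_indicator (measurableSet_Iic.prod hJ),
    ← integral_indicator (MeasurableSet.univ.prod hJ),
    ← integral_sub_right_eq_self _ ((a, 0) : ℝ × ℝ)]
  congr 1
  funext q
  rcases q with ⟨s, θ⟩
  by_cases h1 : s ≤ τ <;> by_cases h2 : θ ∈ J <;>
    simp [Set.indicator, h1, h2]

/-- Dominated convergence for rescaled masses. -/
lemma tendsto_cylMass_of_dominated {μ T c₂ : ℝ} {h u : ℕ → E2 → ℝ} {m a τ : ℕ → ℝ}
    (hμ : 0 < μ) (hh : ∀ k, ContinuousOn (h k) (closedBall 0 (Real.exp T)))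
    (hu : ∀ k, ContinuousOn (u k) (closedBall 0 (Real.exp T)))
    (h_nn : ∀ k, ∀ x ∈ closedBall (0 : E2) (Real.exp T), 0 ≤ h k x)
    (h_le : ∀ k, ∀ x ∈ closedBall (0 : E2) (Real.exp T), h k x ≤ c₂)
    (u_le : ∀ k, ∀ x ∈ closedBall (0 : E2) (Real.exp T), u k x ≤ m k)
    {Q : Set ℝ} {G : ℝ → ℝ} {w : ℝ → ℝ → ℝ}
    (hτ : ∀ᶠ k in atTop, τ k - a k ≤ T) (hQ : ∀ s, ∀ᶠ k in atTop, (s ≤ τ k ↔ s ∈ Q))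
    (hG : Integrable G) (hGnn : ∀ s, 0 ≤ G s)
    (hdom : ∀ᶠ k in atTop, ∀ s, ∀ θ ∈ Set.Ioo (-Real.pi) Real.pi, s ≤ τ k →
      cylDensity μ (h k) (u k) (s - a k) θ ≤ G s)
    (hlim : ∀ s θ, Tendsto (fun k => cylDensity μ (h k) (u k) (s - a k) θ) atTop
      (nhds (w s θ))) :
    Tendsto (fun k => cylMass μ (h k) (u k) (τ k - a k)) atTop
      (nhds ((2 * Real.pi)⁻¹ * ∫ q in (Set.univ : Set ℝ) ×ˢ Set.Ioo (-Real.pi) Real.pi,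
        {q : ℝ × ℝ | q.1 ∈ Q}.indicator (fun q => w q.1 q.2) q)) := by
  have hms : MeasurableSet ((Set.univ : Set ℝ) ×ˢ Set.Ioo (-Real.pi) Real.pi) :=
    MeasurableSet.univ.prod measurableSet_Ioo
  have key : Tendsto (fun k => ∫ q in (Set.univ : Set ℝ) ×ˢ Set.Ioo (-Real.pi) Real.pi,
      {q : ℝ × ℝ | q.1 ≤ τ k}.indicator
        (fun q => cylDensity μ (h k) (u k) (q.1 - a k) q.2) q) atTop
      (nhds (∫ q in (Set.univ : Set ℝ) ×ˢ Set.Ioo (-Real.pi) Real.pi,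
        {q : ℝ × ℝ | q.1 ∈ Q}.indicator (fun q => w q.1 q.2) q)) := by
    refine tendsto_integral_filter_of_dominated_convergence (fun q => G q.1) ?_ ?_ ?_ ?_
    · filter_upwards [hτ] with k hk
      have hcl : MeasurableSet {q : ℝ × ℝ | q.1 ≤ τ k} :=
        measurableSet_le measurable_fst measurable_const
      refine (aestronglyMeasurable_indicator_iff hcl).2 (ContinuousOn.aestronglyMeasurable ?_ hcl)
      exact (continuousOn_cylDensity (μ := μ) (hh k) (hu k)).comp
        (f := fun q : ℝ × ℝ => (q.1 - a k, q.2)) (by fun_prop)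
        fun q hq => (sub_le_sub_right hq (a k)).trans hk
    · filter_upwards [hτ, hdom] with k hk hd
      refine (ae_restrict_iff' hms).2 (Eventually.of_forall fun q hq => ?_)
      by_cases hqτ : q.1 ≤ τ k
      · rw [Set.indicator_of_mem (by exact hqτ), Real.norm_eq_abs,
          abs_of_nonneg (cylDensity_nonneg (h_nn k) ((sub_le_sub_right hqτ (a k)).trans hk) _)]
        exact hd _ _ hq.2 hqτ
      · rw [Set.indicator_of_notMem (by exact hqτ), norm_zero]
        exact hGnn _
    · exact integrableOn_prod_Ioo_of_fst (integrableOn_univ.2 hG) _ _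
    · refine Eventually.of_forall fun q => ?_
      by_cases hq : q.1 ∈ Q
      · rw [Set.indicator_of_mem (by exact hq)]
        refine (hlim q.1 q.2).congr' ?_
        filter_upwards [hQ q.1] with k hk
        rw [Set.indicator_of_mem (by exact hk.2 hq)]
      · rw [Set.indicator_of_notMem (by exact hq)]
        refine tendsto_const_nhds.congr' ?_
        filter_upwards [hQ q.1] with k hk
        rw [Set.indicator_of_notMem (by exact fun h => hq (hk.1 h))]
  refine (key.const_mul (2 * Real.pi)⁻¹).congr' ?_
  filter_upwards [hτ] with k hk
  rw [cylMass_eq_setIntegral hμ (hh k) (hu k) (h_nn k) (h_le k) (u_le k) hk,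
    setIntegral_Iic_prod_translate _ _ _ measurableSet_Ioo]

namespace LocalBlowupSetup

variable {n : ℕ} {γ T : ℝ} {A : Matrix (Fin n) (Fin n) ℝ} {h u : ℕ → Fin n → E2 → ℝ} {M : ℕ → ℝ}

lemma one_add_pos (S : LocalBlowupSetup n (Real.exp T) γ A h u M) : 0 < 1 + γ := by
  linarith [S.hγ]

lemma h_cont (S : LocalBlowupSetup n (Real.exp T) γ A h u M) (k : ℕ) (i : Fin n) :
    ContinuousOn (h k i) (closedBall 0 (Real.exp T)) := (S.h_c1 k i).continuousOn

lemma h_nonneg (S : LocalBlowupSetup n (Real.exp T) γ A h u M) (k : ℕ) (i : Fin n) :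
    ∀ x ∈ closedBall (0 : E2) (Real.exp T), 0 ≤ h k i x :=
  fun x hx => S.c₁_pos.le.trans (S.h_lb k i x hx)

lemma c₂_pos (S : LocalBlowupSetup n (Real.exp T) γ A h u M) : 0 < S.c₂ := by
  have h0 : (0 : E2) ∈ closedBall (0 : E2) (Real.exp T) := by simp [Real.exp_nonneg]
  exact S.c₁_pos.trans_le ((S.h_lb 0 ⟨0, S.hn⟩ 0 h0).trans (S.h_ub 0 ⟨0, S.hn⟩ 0 h0))

lemma exp_mul_lap_cyl (S : LocalBlowupSetup n (Real.exp T) γ A h u M) (k : ℕ) (i : Fin n)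
    {t : ℝ} (ht : t < T) (θ : ℝ) : Real.exp (2 * t) * lap (u k i) (cyl t θ) =
      -∑ j, A i j * cylDensity (1 + γ) (h k j) (u k j) t θ := by
  have := S.pde k i _ (cyl_mem_puncturedBall (θ := θ) (Real.exp_lt_exp.2 ht))
  rw [eq_neg_of_add_eq_zero_left this, mul_neg, Finset.mul_sum]
  congr 1
  refine Finset.sum_congr rfl fun j _ => ?_
  rw [← exp_mul_density_eq]
  ring

/-- Uniform oscillation bound on circles. -/
lemma exists_oscillation_bound (S : LocalBlowupSetup n (Real.exp T) γ A h u M)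
    (hs : SimpleBlowup (Real.exp T) γ u) : ∃ K, ∀ k i t, t ≤ T →
      ∀ θ₁ ∈ Set.Icc (-Real.pi) Real.pi, ∀ θ₂ ∈ Set.Icc (-Real.pi) Real.pi,
        |u k i (cyl t θ₁) - u k i (cyl t θ₂)| ≤ K := by
  obtain ⟨Cs, hCs⟩ := hs
  have hA : ∀ i j, 0 ≤ A i j := S.hH1.2.1
  set Λ : ℝ := ∑ i, ∑ j, A i j * (S.c₂ * Real.exp Cs) with hΛ
  refine ⟨max S.C 1 + (2 * Λ + 1) / 2 * Real.pi ^ 2, fun k i t ht θ₁ h₁ θ₂ h₂ => ?_⟩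
  refine abs_comp_cyl_sub_le (S.u_cont k i) (S.u_c2 k i) (fun t θ ht => ?_) (S.osc k i) ht h₁ h₂
  have hd : ∀ j, 0 ≤ cylDensity (1 + γ) (h k j) (u k j) t θ := fun j =>
    cylDensity_nonneg (S.h_nonneg k j) ht.le θ
  rw [S.exp_mul_lap_cyl k i ht, abs_neg,
    abs_of_nonneg (Finset.sum_nonneg fun j _ => mul_nonneg (hA i j) (hd j))]
  have hpos : 0 ≤ S.c₂ * Real.exp Cs := mul_nonneg S.c₂_pos.le (Real.exp_pos _).le
  refine le_trans ?_ (Finset.single_le_sum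
    (f := fun i => ∑ j, A i j * (S.c₂ * Real.exp Cs))
    (fun i _ => Finset.sum_nonneg fun j _ => mul_nonneg (hA i j) hpos) (Finset.mem_univ i))
  refine Finset.sum_le_sum fun j _ => mul_le_mul_of_nonneg_left ?_ (hA i j)
  refine cylDensity_le (S.h_nonneg k j) (S.h_ub k j) ht.le ?_
  have := hCs k j (cyl t θ) (cyl_mem_closedBall (Real.exp_le_exp.2 ht.le)) (cyl_ne_zero t θ)
  rwa [norm_cyl, Real.log_exp] at this

lemma tendsto_exp_neg_half (S : LocalBlowupSetup n (Real.exp T) γ A h u M) :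
    Tendsto (fun k => Real.exp (-(M k) / 2)) atTop (nhds 0) :=
  Real.tendsto_exp_atBot.comp
    ((tendsto_neg_atTop_atBot.comp S.M_inf).atBot_div_const two_pos)

lemma tendsto_h_scaled (S : LocalBlowupSetup n (Real.exp T) γ A h u M)
    (h0 : ∀ k i, h k i 0 = 1) (i : Fin n) (y : E2) :
    Tendsto (fun k => h k i (Real.exp (-(M k) / 2) • y)) atTop (nhds 1) := by
  have hy : Tendsto (fun k => ‖Real.exp (-(M k) / 2) • y‖) atTop (nhds 0) := by
    have := (S.tendsto_exp_neg_half.smul_const y).norm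
    simpa using this
  refine tendsto_iff_norm_sub_tendsto_zero.2 (squeeze_zero' (Eventually.of_forall fun k =>
    norm_nonneg _) (g := fun k => S.c₃ * ‖Real.exp (-(M k) / 2) • y‖) ?_
    (by simpa using hy.const_mul S.c₃))
  filter_upwards [hy.eventually_lt_const (Real.exp_pos T)] with k hk
  have := (convex_closedBall (0 : E2) (Real.exp T)).norm_image_sub_le_of_norm_fderivWithin_le
    ((S.h_c1 k i).differentiableOn (by norm_num)) (S.h_grad k i)
    (by simp [Real.exp_nonneg] : (0 : E2) ∈ closedBall (0 : E2) (Real.exp T))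
    (by simpa using hk.le : Real.exp (-(M k) / 2) • y ∈ closedBall (0 : E2) (Real.exp T))
  rwa [h0, sub_zero] at this

lemma cylDensity_scaled (μ : ℝ) (h u : E2 → ℝ) (m s θ : ℝ) :
    cylDensity μ h u (s - m / 2) θ = h (Real.exp (-m / 2) • cyl s θ) *
      Real.exp (u (Real.exp (-m / 2) • cyl s θ) - μ * m + 2 * μ * s) := by
  rw [cylDensity, ← cyl_add]
  have : -m / 2 + s = s - m / 2 := by ring
  rw [this]
  congr 2
  ring

end LocalBlowupSetup

lemma tendsto_of_tendstoLocallyUniformly_iteratedFDeriv_zero {f : ℕ → E2 → ℝ} {g : E2 → ℝ}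
    (h : TendstoLocallyUniformly (fun k => iteratedFDeriv ℝ 0 (f k)) (iteratedFDeriv ℝ 0 g) atTop)
    (y : E2) : Tendsto (fun k => f k y) atTop (nhds (g y)) := by
  have h1 := (tendstoLocallyUniformlyOn_univ.2 h).tendsto_at (Set.mem_univ y)
  have h2 := (((continuousMultilinearCurryFin0 ℝ E2 ℝ).continuous.tendsto _).comp h1)
  simpa [Function.comp_def] using! h2

lemma circAvg_le {u : E2 → ℝ} {T t m : ℝ} (hu : ContinuousOn u (closedBall 0 (Real.exp T)))
    (ht : t ≤ T) (h : ∀ θ, u (cyl t θ) ≤ m) : circAvg u t ≤ m := by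
  have hpi : -Real.pi ≤ Real.pi := by linarith [Real.pi_pos]
  have e : m = (2 * Real.pi)⁻¹ * ∫ _ in (-Real.pi)..Real.pi, m := by
    rw [intervalIntegral.integral_const, smul_eq_mul]
    field_simp
    ring
  rw [e]
  exact mul_le_mul_of_nonneg_left (intervalIntegral.integral_mono_on hpi
    ((continuous_comp_cyl hu ht).intervalIntegrable _ _) intervalIntegrable_const
    fun θ _ => h θ) (by positivity)

/-- The limiting energy density in logarithmic polar coordinates. -/
def limitDensity {n : ℕ} (μ : ℝ) (I : Finset (Fin n)) (v : Fin n → E2 → ℝ) (i : Fin n)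
    (s θ : ℝ) : ℝ :=
  if i ∈ I then Real.exp (v i (cyl s θ) + 2 * μ * s) else 0

/-- The limiting energy in the disc of radius `exp τ`. -/
def limitMass {n : ℕ} (μ : ℝ) (I : Finset (Fin n)) (v : Fin n → E2 → ℝ) (i : Fin n)
    (τ : ℝ) : ℝ :=
  (2 * Real.pi)⁻¹ * ∫ q in (Set.univ : Set ℝ) ×ˢ Set.Ioo (-Real.pi) Real.pi,
    {q : ℝ × ℝ | q.1 ∈ Set.Iic τ}.indicator (fun q => limitDensity μ I v i q.1 q.2) q

namespace LocalBlowupSetup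

variable {n : ℕ} {γ T : ℝ} {A : Matrix (Fin n) (Fin n) ℝ} {h u : ℕ → Fin n → E2 → ℝ} {M : ℕ → ℝ}
  {I₁ : Finset (Fin n)} {v : Fin n → E2 → ℝ}

lemma tendsto_cylDensity_scaled (S : LocalBlowupSetup n (Real.exp T) γ A h u M)
    (h0 : ∀ k i, h k i 0 = 1)
    (hconv : ∀ i ∈ I₁, ∀ y : E2,
      Tendsto (fun k => u k i (Real.exp (-(M k) / 2) • y) - (1 + γ) * M k) atTop (nhds (v i y)))
    (hdiv : ∀ i ∉ I₁, ∀ R C : ℝ, ∃ N : ℕ, ∀ k ≥ N, ∀ y : E2, ‖y‖ ≤ R →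
      u k i (Real.exp (-(M k) / 2) • y) - (1 + γ) * M k ≤ C) (i : Fin n) (s θ : ℝ) :
    Tendsto (fun k => cylDensity (1 + γ) (h k i) (u k i) (s - M k / 2) θ) atTop
      (nhds (limitDensity (1 + γ) I₁ v i s θ)) := by
  simp only [cylDensity_scaled]
  have hh := S.tendsto_h_scaled h0 i (cyl s θ)
  unfold limitDensity
  split_ifs with hi
  · simpa using hh.mul ((Real.continuous_exp.tendsto _).comp
      ((hconv i hi (cyl s θ)).add_const (2 * (1 + γ) * s)))
  · have : Tendsto (fun k => u k i (Real.exp (-(M k) / 2) • cyl s θ) - (1 + γ) * M k)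
        atTop atBot := by
      refine tendsto_atBot.2 fun C => ?_
      obtain ⟨N, hN⟩ := hdiv i hi ‖cyl s θ‖ C
      filter_upwards [eventually_ge_atTop N] with k hk using hN k hk _ le_rfl
    simpa using hh.mul (Real.tendsto_exp_atBot.comp
      (tendsto_atBot_add_const_right _ (2 * (1 + γ) * s) this))

lemma cylDensity_scaled_le (S : LocalBlowupSetup n (Real.exp T) γ A h u M) (k : ℕ) (i : Fin n)
    {s : ℝ} (hs : s - M k / 2 ≤ T) (θ : ℝ) :
    cylDensity (1 + γ) (h k i) (u k i) (s - M k / 2) θ ≤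
      S.c₂ * Real.exp (2 * (1 + γ) * s + 0) := by
  have := cylDensity_le_exp (μ := 1 + γ) (S.h_nonneg k i) (S.h_ub k i) (S.M_max k i) hs θ
  have e : 2 * (1 + γ) * (s - M k / 2) + (1 + γ) * M k = 2 * (1 + γ) * s + 0 := by ring
  rwa [e] at this

lemma tendsto_cylMass_scaled (S : LocalBlowupSetup n (Real.exp T) γ A h u M)
    (h0 : ∀ k i, h k i 0 = 1)
    (hconv : ∀ i ∈ I₁, ∀ y : E2,
      Tendsto (fun k => u k i (Real.exp (-(M k) / 2) • y) - (1 + γ) * M k) atTop (nhds (v i y)))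
    (hdiv : ∀ i ∉ I₁, ∀ R C : ℝ, ∃ N : ℕ, ∀ k ≥ N, ∀ y : E2, ‖y‖ ≤ R →
      u k i (Real.exp (-(M k) / 2) • y) - (1 + γ) * M k ≤ C) (i : Fin n) (τ : ℝ) :
    Tendsto (fun k => cylMass (1 + γ) (h k i) (u k i) (τ - M k / 2)) atTop
      (nhds (limitMass (1 + γ) I₁ v i τ)) := by
  have hμ := S.one_add_pos
  have hτ : ∀ᶠ k in atTop, τ - M k / 2 ≤ T := by
    filter_upwards [S.M_inf.eventually_ge_atTop (2 * (τ - T))] with k hk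
    linarith
  refine tendsto_cylMass_of_dominated (τ := fun _ => τ) (Q := Set.Iic τ)
    (G := (Set.Iic τ).indicator fun s => S.c₂ * Real.exp (2 * (1 + γ) * s + 0)) hμ
    (fun k => S.h_cont k i) (fun k => S.u_cont k i) (fun k => S.h_nonneg k i)
    (fun k => S.h_ub k i) (fun k => S.M_max k i) hτ (fun s => Eventually.of_forall fun _ => Iff.rfl)
    ((integrable_indicator_iff measurableSet_Iic).2
      (integrableOn_exp_affine_Iic (by positivity) _ _ _)) ?_ ?_
    (S.tendsto_cylDensity_scaled h0 hconv hdiv i)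
  · exact fun s => Set.indicator_nonneg
      (fun _ _ => mul_nonneg S.c₂_pos.le (Real.exp_pos _).le) _
  · filter_upwards [hτ] with k hk s θ _ hs
    rw [Set.indicator_of_mem (by exact hs)]
    exact S.cylDensity_scaled_le k i (by linarith) θ

lemma cylMass_le (S : LocalBlowupSetup n (Real.exp T) γ A h u M) (k : ℕ) (i : Fin n) :
    cylMass (1 + γ) (h k i) (u k i) T ≤ S.C / (2 * Real.pi) := by
  rw [← sigmaK_eq_cylMass S.one_add_pos (S.h_cont k i) (S.u_cont k i) (S.h_nonneg k i)
    (S.h_ub k i) (S.M_max k i), sigmaK, one_div, mul_comm, ← div_eq_mul_inv]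
  refine div_le_div_of_nonneg_right (le_of_eq_of_le ?_ (S.energy k i)) (by positivity)
  congr 1
  funext x
  ring

/-- The one-dimensional system attached to a simple blowup sequence. -/
lemma cylSystem (S : LocalBlowupSetup n (Real.exp T) γ A h u M) (h0 : ∀ k i, h k i 0 = 1)
    (hconv : ∀ i ∈ I₁, ∀ y : E2,
      Tendsto (fun k => u k i (Real.exp (-(M k) / 2) • y) - (1 + γ) * M k) atTop (nhds (v i y)))
    (hdiv : ∀ i ∉ I₁, ∀ R C : ℝ, ∃ N : ℕ, ∀ k ≥ N, ∀ y : E2, ‖y‖ ≤ R →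
      u k i (Real.exp (-(M k) / 2) • y) - (1 + γ) * M k ≤ C) {K : ℝ} (hK0 : 0 ≤ K)
    (hK : ∀ k i t, t ≤ T → ∀ θ ∈ Set.Icc (-Real.pi) Real.pi,
        |u k i (cyl t θ) - circAvg (u k i) t| ≤ K) :
    CylSystem A I₁ (1 + γ) T (S.c₁ * Real.exp (-K)) (S.c₂ * Real.exp K) (S.C / (2 * Real.pi)) M
      (fun k i => circAvg (u k i)) (fun k i => angDensity (1 + γ) (h k i) (u k i))
      (fun k i => cylMass (1 + γ) (h k i) (u k i)) (fun k i => u k i 0)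
      (limitMass (1 + γ) I₁ v) where
  μ_pos := S.one_add_pos
  b_pos := mul_pos S.c₁_pos (Real.exp_pos _)
  c_pos := mul_pos S.c₂_pos (Real.exp_pos _)
  A_nonneg := S.hH1.2.1
  M_inf := S.M_inf
  ρ_nonneg k j t ht := (angDensity_nonneg_and_le (S.h_cont k j) (S.u_cont k j) (S.h_nonneg k j)
    (S.h_ub k j) (S.M_max k j) ht).1
  ρ_le_exp k j t ht := by
    refine (angDensity_nonneg_and_le (S.h_cont k j) (S.u_cont k j) (S.h_nonneg k j)
      (S.h_ub k j) (S.M_max k j) ht).2.trans ?_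
    refine mul_le_mul_of_nonneg_right ?_ (Real.exp_pos _).le
    exact le_mul_of_one_le_right S.c₂_pos.le (Real.one_le_exp hK0)
  le_ρ k j t ht := by
    refine (angDensity_mono_const (S.h_cont k j) (S.u_cont k j) ht
      (d := S.c₂ * Real.exp (circAvg (u k j) t + K + 2 * (1 + γ) * t)) fun θ hθ => ⟨?_, ?_⟩).1
    · rw [mul_assoc, ← Real.exp_add]
      refine mul_le_mul (S.h_lb k j _ (cyl_mem_closedBall (Real.exp_le_exp.2 ht)))
        (Real.exp_le_exp.2 ?_) (Real.exp_pos _).le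
        (S.h_nonneg k j _ (cyl_mem_closedBall (Real.exp_le_exp.2 ht)))
      linarith [(abs_le.1 (hK k j t ht θ hθ)).1]
    · exact cylDensity_le (S.h_nonneg k j) (S.h_ub k j) ht (by
        linarith [(abs_le.1 (hK k j t ht θ hθ)).2])
  ρ_le k j t ht := by
    refine (angDensity_mono_const (S.h_cont k j) (S.u_cont k j) ht (c := 0)
      fun θ hθ => ⟨cylDensity_nonneg (S.h_nonneg k j) ht θ, ?_⟩).2
    rw [mul_assoc, ← Real.exp_add]
    exact cylDensity_le (S.h_nonneg k j) (S.h_ub k j) ht (by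
        linarith [(abs_le.1 (hK k j t ht θ hθ)).2])
  U_cont k i := continuousOn_circAvg (S.u_cont k i)
  U_deriv k i t ht := by
    have hci : ∀ j t, t ≤ T → Continuous fun θ => cylDensity (1 + γ) (h k j) (u k j) t θ :=
      fun j t ht => continuous_cylDensity_snd (S.h_cont k j) (S.u_cont k j) ht
    have hInteg : ∀ j, IntegrableOn (angDensity (1 + γ) (h k j) (u k j)) (Set.Iic T) := fun j =>
      integrableOn_angDensity S.one_add_pos (S.h_cont k j) (S.u_cont k j) (S.h_nonneg k j)
        (S.h_ub k j) (S.M_max k j)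
    have e : ∀ t ≤ T, (2 * Real.pi)⁻¹ * ∫ θ in (-Real.pi)..Real.pi,
        ∑ j, A i j * cylDensity (1 + γ) (h k j) (u k j) t θ =
        ∑ j, A i j * angDensity (1 + γ) (h k j) (u k j) t := by
      intro t ht
      have hii : ∀ j ∈ Finset.univ, IntervalIntegrable
          (fun θ => A i j * cylDensity (1 + γ) (h k j) (u k j) t θ) volume
          (-Real.pi) Real.pi := fun j _ =>
        (continuous_const.mul (hci j t ht)).intervalIntegrable _ _
      rw [intervalIntegral.integral_finsetSum hii, Finset.mul_sum]
      refine Finset.sum_congr rfl fun j _ => ?_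
      rw [intervalIntegral.integral_const_mul, angDensity]
      ring
    have hInteg' : IntegrableOn (fun t => ∑ j, A i j * angDensity (1 + γ) (h k j) (u k j) t)
        (Set.Iic T) := integrable_finsetSum _ fun j _ => (hInteg j).const_mul _
    refine (hasDerivAt_circAvg (S.u_cont k i) (S.u_c2 k i)
      (F := fun t θ => ∑ j, A i j * cylDensity (1 + γ) (h k j) (u k j) t θ) ?_
      (fun t θ ht => S.exp_mul_lap_cyl k i ht θ) ?_ ht).congr_deriv ?_
    · exact continuousOn_finsetSum _ fun j _ =>
        continuousOn_const.mul (continuousOn_cylDensity (S.h_cont k j) (S.u_cont k j))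
    · exact hInteg'.congr_fun (fun t ht => (e t ht).symm) measurableSet_Iic
    · rw [setIntegral_congr_fun measurableSet_Iic fun s (hs : s ≤ t) => e s (hs.trans ht.le),
        integral_finsetSum _ fun j _ =>
          (((hInteg j).mono_set (Set.Iic_subset_Iic.2 ht.le)).const_mul _)]
      simp only [integral_const_mul, cylMass]
  P_cont k i := continuousOn_cylMass S.one_add_pos (S.h_cont k i) (S.u_cont k i)
    (S.h_nonneg k i) (S.h_ub k i) (S.M_max k i)
  P_deriv k i t ht := hasDerivAt_cylMass S.one_add_pos (S.h_cont k i) (S.u_cont k i)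
    (S.h_nonneg k i) (S.h_ub k i) (S.M_max k i) ht
  P_atBot k i := tendsto_cylMass_atBot S.one_add_pos (S.h_cont k i) (S.u_cont k i)
    (S.h_nonneg k i) (S.h_ub k i) (S.M_max k i)
  U_atBot k i := tendsto_circAvg_atBot (S.u_cont k i)
  P_le k i := S.cylMass_le k i
  U_le k i t ht := circAvg_le (S.u_cont k i) ht fun θ =>
    S.M_max k i _ (cyl_mem_closedBall (Real.exp_le_exp.2 ht))
  U₀_ge i hi := by
    refine ⟨1 - v i 0, ?_⟩
    have := hconv i hi 0
    simp only [smul_zero] at this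
    filter_upwards [this.eventually_const_lt (sub_one_lt (v i 0))] with k hk
    linarith
  P_tendsto i τ := S.tendsto_cylMass_scaled h0 hconv hdiv i τ
  Pinf_zero i hi τ := by simp [limitMass, limitDensity, hi, Set.indicator]

end LocalBlowupSetup

lemma limitMass_univ {n : ℕ} (γ : ℝ) (I₁ : Finset (Fin n)) (v : Fin n → E2 → ℝ) (i : Fin n) :
    (2 * Real.pi)⁻¹ * ∫ q in (Set.univ : Set ℝ) ×ˢ Set.Ioo (-Real.pi) Real.pi,
      {q : ℝ × ℝ | q.1 ∈ (Set.univ : Set ℝ)}.indicator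
        (fun q => limitDensity (1 + γ) I₁ v i q.1 q.2) q =
    if i ∈ I₁ then
      (1 / (2 * Real.pi)) * ∫ y : E2, ‖y‖ ^ (2 * γ) * Real.exp (v i y) else 0 := by
  simp only [Set.mem_univ, Set.ofPred_true, Set.indicator_univ]
  split_ifs with hi
  · rw [integral_eq_integral_cyl, one_div]
    congr 2
    funext q
    rw [← mul_assoc, exp_mul_norm_cyl_rpow, ← Real.exp_add, limitDensity, if_pos hi, add_comm]
  · simp [limitDensity, hi]

namespace LocalBlowupSetup

variable {n : ℕ} {γ T : ℝ} {A : Matrix (Fin n) (Fin n) ℝ} {h u : ℕ → Fin n → E2 → ℝ} {M : ℕ → ℝ}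
  {I₁ : Finset (Fin n)} {v : Fin n → E2 → ℝ}

/-- No energy is lost in the neck region. -/
lemma tendsto_cylMass (S : LocalBlowupSetup n (Real.exp T) γ A h u M)
    (h0 : ∀ k i, h k i 0 = 1)
    (hconv : ∀ i ∈ I₁, ∀ y : E2,
      Tendsto (fun k => u k i (Real.exp (-(M k) / 2) • y) - (1 + γ) * M k) atTop (nhds (v i y)))
    (hdiv : ∀ i ∉ I₁, ∀ R C : ℝ, ∃ N : ℕ, ∀ k ≥ N, ∀ y : E2, ‖y‖ ≤ R →
      u k i (Real.exp (-(M k) / 2) • y) - (1 + γ) * M k ≤ C) {K τ η : ℝ}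
    (hK : ∀ k i t, t ≤ T → ∀ θ ∈ Set.Icc (-Real.pi) Real.pi,
        |u k i (cyl t θ) - circAvg (u k i) t| ≤ K) (hη : 0 < η)
    (hneck : ∀ᶠ k in atTop, ∀ i t, τ - M k / 2 ≤ t → t ≤ T →
      circAvg (u k i) t + 2 * (1 + γ) * t ≤ 2 * (1 + γ) * τ - η * (t - (τ - M k / 2)))
    (i : Fin n) :
    Tendsto (fun k => cylMass (1 + γ) (h k i) (u k i) T) atTop
      (nhds (if i ∈ I₁ then
        (1 / (2 * Real.pi)) * ∫ y : E2, ‖y‖ ^ (2 * γ) * Real.exp (v i y) else 0)) := by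
  have hμ := S.one_add_pos
  have hc := S.c₂_pos
  have hInteg : IntegrableOn (fun s => S.c₂ * Real.exp (-η * s + (K + 2 * (1 + γ) * τ + η * τ)))
      (Set.Ioi τ) := by
    have : IntegrableOn (fun s : ℝ => S.c₂ * Real.exp (K + 2 * (1 + γ) * τ + η * τ) *
        Real.exp (-η * s)) (Set.Ioi τ) :=
      (integrableOn_exp_mul_Ioi (by linarith) τ).const_mul _
    refine this.congr_fun (fun s _ => ?_) measurableSet_Ioi
    simp only [Real.exp_add]
    ring
  rw [← limitMass_univ]
  have := tendsto_cylMass_of_dominated (h := fun k => h k i) (u := fun k => u k i)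
    (a := fun k => M k / 2) (τ := fun k => T + M k / 2) (Q := Set.univ)
    (G := fun s => (Set.Iic τ).indicator (fun s => S.c₂ * Real.exp (2 * (1 + γ) * s + 0)) s +
      (Set.Ioi τ).indicator
        (fun s => S.c₂ * Real.exp (-η * s + (K + 2 * (1 + γ) * τ + η * τ))) s) hμ
    (fun k => S.h_cont k i) (fun k => S.u_cont k i) (fun k => S.h_nonneg k i)
    (fun k => S.h_ub k i) (fun k => S.M_max k i)
    (Eventually.of_forall fun k => by simp) (fun s => ?_)
    (((integrable_indicator_iff measurableSet_Iic).2
      (integrableOn_exp_affine_Iic (by positivity) _ _ _)).add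
      ((integrable_indicator_iff measurableSet_Ioi).2 hInteg)) (fun s => ?_) ?_
    (S.tendsto_cylDensity_scaled h0 hconv hdiv i)
  · simpa using this
  · filter_upwards [S.M_inf.eventually_ge_atTop (2 * (s - T))] with k hk
    exact iff_of_true (by linarith) trivial
  · exact add_nonneg (Set.indicator_nonneg (fun _ _ => by positivity) _)
      (Set.indicator_nonneg (fun _ _ => by positivity) _)
  · filter_upwards [hneck] with k hk s θ hθ hs
    have hsT : s - M k / 2 ≤ T := by linarith
    rcases le_or_gt s τ with hsτ | hsτ
    · rw [Set.indicator_of_mem (by exact hsτ), Set.indicator_of_notMem (by simpa using hsτ),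
        add_zero]
      exact S.cylDensity_scaled_le k i hsT θ
    · rw [Set.indicator_of_notMem (by simpa using hsτ), Set.indicator_of_mem (by exact hsτ),
        zero_add]
      refine cylDensity_le (S.h_nonneg k i) (S.h_ub k i) hsT ?_
      have h1 := (abs_le.1 (hK k i _ hsT θ (Set.Ioo_subset_Icc_self hθ))).2
      have h2 := hk i (s - M k / 2) (by linarith) hsT
      linarith

end LocalBlowupSetup

lemma exists_bound_of_eventually {ι : Type*} {X : Type*} (F : ℕ → ι → X → ℝ)
    (hev : ∃ C, ∀ᶠ k in atTop, ∀ i x, F k i x ≤ C) (hk : ∀ k, ∃ C, ∀ i x, F k i x ≤ C) :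
    ∃ C, ∀ k i x, F k i x ≤ C := by
  obtain ⟨C, hC⟩ := hev
  obtain ⟨N, hN⟩ := eventually_atTop.1 hC
  choose D hD using hk
  refine ⟨|C| + ∑ k ∈ Finset.range N, |D k|, fun k i x => ?_⟩
  rcases lt_or_ge k N with hkN | hkN
  · have := Finset.single_le_sum (f := fun k => |D k|) (fun k _ => abs_nonneg _)
      (Finset.mem_range.2 hkN)
    exact (hD k i x).trans ((le_abs_self _).trans (this.trans
      (le_add_of_nonneg_left (abs_nonneg _))))
  · exact (hN k hkN i x).trans ((le_abs_self _).trans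
      (le_add_of_nonneg_right (Finset.sum_nonneg fun _ _ => abs_nonneg _)))

namespace LocalBlowupSetup

variable {n : ℕ} {γ T : ℝ} {A : Matrix (Fin n) (Fin n) ℝ} {h u : ℕ → Fin n → E2 → ℝ} {M : ℕ → ℝ}
  {I₁ : Finset (Fin n)} {v : Fin n → E2 → ℝ}

/-- A bound on the boundary circle, valid for all large `k`, holds for all `k`. -/
lemma exists_bound_sphere_of_eventually (S : LocalBlowupSetup n (Real.exp T) γ A h u M)
    (J : Finset (Fin n)) (b : ℕ → Fin n → ℝ)
    (hev : ∃ C, ∀ᶠ k in atTop, ∀ i ∈ J, ∀ x ∈ sphere (0 : E2) (Real.exp T),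
      |u k i x - b k i| ≤ C) :
    ∃ C, ∀ k, ∀ i ∈ J, ∀ x ∈ sphere (0 : E2) (Real.exp T), |u k i x - b k i| ≤ C := by
  obtain ⟨C, hC⟩ := exists_bound_of_eventually
    (fun k (i : J) (x : sphere (0 : E2) (Real.exp T)) => |u k i x - b k i|)
    (by
      obtain ⟨C, hC⟩ := hev
      exact ⟨C, hC.mono fun k hk i x => hk i i.2 x x.2⟩)
    (fun k => by
      have hx0 : cyl T 0 ∈ sphere (0 : E2) (Real.exp T) := by simp [norm_cyl]
      refine ⟨S.C + ∑ i, |u k i (cyl T 0) - b k i|, fun i x => ?_⟩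
      have h1 := S.osc k i x x.2 _ hx0
      have h2 := Finset.single_le_sum (f := fun i => |u k i (cyl T 0) - b k i|)
        (fun _ _ => abs_nonneg _) (Finset.mem_univ (i : Fin n))
      exact (abs_sub_le _ _ _).trans (add_le_add h1 h2))
  exact ⟨C, fun k i hi x hx => hC k ⟨i, hi⟩ ⟨x, hx⟩⟩

end LocalBlowupSetup

/-- in the local blowup setup with simple blowup, assume `hᵢᵏ(0) = 1`, and that
after the scaling `ṽᵢᵏ(y) = ũᵢᵏ(ε_k y) − μ M_k` (with `ε_k = e^{−M_k/2}`) the components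
in a nonempty set `I₁` converge in `C²_loc(ℝ²)` to limits `ṽᵢ`, while the other components
tend to `−∞` uniformly on compact sets.  With `σᵢ = (1/2π)∫_{ℝ²}|y|^{2γ}e^{ṽᵢ}` for `i ∈ I₁`
and `σᵢ = 0` otherwise, one has (a) `σᵢᵏ → σᵢ`; (b) for `i ∈ I₁`,
`ũᵢᵏ = −mᵢᵏ log|x| − ((mᵢᵏ−2μ)/2) M_k + O(1)` on `∂B_δ`; (c) for `i ∉ I₁`,
`ũᵢᵏ = −mᵢᵏ log|x| − ((mᵢᵏ−2μ)/2) M_k + (ũᵢᵏ(0) − μ M_k) + O(1)` on `∂B_δ`. -/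
theorem simple_blowup_boundary_asymptotics {n : ℕ} {δ γ : ℝ}
    {A : Matrix (Fin n) (Fin n) ℝ} {h u : ℕ → Fin n → E2 → ℝ} {M : ℕ → ℝ}
    (S : LocalBlowupSetup n δ γ A h u M)
    (hsimple : SimpleBlowup δ γ u)
    (h0 : ∀ k i, h k i 0 = 1)
    (I₁ : Finset (Fin n)) (hI₁ : I₁.Nonempty)
    (v : Fin n → E2 → ℝ)
    (hconv : ∀ i ∈ I₁, ∀ m : ℕ, m ≤ 2 →
      TendstoLocallyUniformly
        (fun k => iteratedFDeriv ℝ m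
          (fun y : E2 => u k i (Real.exp (-(M k)/2) • y) - (1+γ) * M k))
        (iteratedFDeriv ℝ m (v i)) atTop)
    (hdiv : ∀ i ∉ I₁, ∀ R C : ℝ, ∃ N : ℕ, ∀ k ≥ N, ∀ y : E2, ‖y‖ ≤ R →
      u k i (Real.exp (-(M k)/2) • y) - (1+γ) * M k ≤ C)
    (σ : Fin n → ℝ)
    (hσ : ∀ i, σ i = if i ∈ I₁ then
      (1/(2*Real.pi)) * ∫ y : E2, ‖y‖ ^ (2*γ) * Real.exp (v i y) else 0) :
    (∀ i, Tendsto (fun k => sigmaK δ γ h u k i) atTop (nhds (σ i))) ∧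
    (∃ C : ℝ, ∀ k, ∀ i ∈ I₁, ∀ x ∈ sphere (0:E2) δ,
      |u k i x - (-(mK A δ γ h u k i) * Real.log ‖x‖
        - ((mK A δ γ h u k i - 2*(1+γ))/2) * M k)| ≤ C) ∧
    (∃ C : ℝ, ∀ k, ∀ i ∉ I₁, ∀ x ∈ sphere (0:E2) δ,
      |u k i x - (-(mK A δ γ h u k i) * Real.log ‖x‖
        - ((mK A δ γ h u k i - 2*(1+γ))/2) * M k
        + (u k i 0 - (1+γ) * M k))| ≤ C) := by
  obtain ⟨T, rfl⟩ : ∃ T, δ = Real.exp T := ⟨Real.log δ, (Real.exp_log S.hδ).symm⟩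
  have hpt : ∀ i ∈ I₁, ∀ y : E2, Tendsto
      (fun k => u k i (Real.exp (-(M k) / 2) • y) - (1 + γ) * M k) atTop (nhds (v i y)) :=
    fun i hi y => tendsto_of_tendstoLocallyUniformly_iteratedFDeriv_zero (hconv i hi 0 (by simp)) y
  obtain ⟨K, hosc⟩ := S.exists_oscillation_bound hsimple
  have hK : ∀ k i t, t ≤ T → ∀ θ ∈ Set.Icc (-Real.pi) Real.pi,
      |u k i (cyl t θ) - circAvg (u k i) t| ≤ K := by
    intro k i t ht θ hθ
    rw [abs_sub_comm]
    exact abs_circAvg_sub_le (S.u_cont k i) ht fun φ hφ => hosc k i t ht φ hφ θ hθ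
  have hK0 : 0 ≤ K := (abs_nonneg _).trans
    (hK 0 ⟨0, S.hn⟩ T le_rfl 0 ⟨by linarith [Real.pi_pos], Real.pi_pos.le⟩)
  have Sys := S.cylSystem h0 hpt hdiv hK0 hK
  obtain ⟨τ, η, hη, hneck⟩ := Sys.exists_neck_decay S.hH1 S.hH2 hI₁
  have hσK : ∀ k i, sigmaK (Real.exp T) γ h u k i = cylMass (1 + γ) (h k i) (u k i) T :=
    fun k i => sigmaK_eq_cylMass S.one_add_pos (S.h_cont k i) (S.u_cont k i) (S.h_nonneg k i)
      (S.h_ub k i) (S.M_max k i)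
  have hmK : ∀ k i, mK A (Real.exp T) γ h u k i =
      ∑ j, A i j * cylMass (1 + γ) (h k j) (u k j) T := fun k i => by simp only [mK, hσK]
  obtain ⟨B, hB⟩ := Sys.exists_boundary_bound hη hneck
  have hcircle : ∃ C, ∀ᶠ k in atTop, ∀ i, ∀ x ∈ sphere (0 : E2) (Real.exp T),
      |u k i x - (-(mK A (Real.exp T) γ h u k i) * T
        - ((mK A (Real.exp T) γ h u k i - 2 * (1 + γ)) / 2) * M k
        + (u k i 0 - (1 + γ) * M k))| ≤ C := by
    refine ⟨K + B, ?_⟩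
    filter_upwards [hB] with k hk i x hx
    have hxn : ‖x‖ = Real.exp T := by simpa using hx
    have hx0 : x ≠ 0 := by
      rw [← norm_pos_iff, hxn]
      exact Real.exp_pos T
    obtain ⟨θ, hθ, hxθ⟩ := exists_eq_cyl hx0
    rw [hxn, Real.log_exp] at hxθ
    have h1 := hK k i T le_rfl θ hθ
    rw [← hxθ] at h1
    refine (abs_sub_le _ _ _).trans (add_le_add h1 (le_of_eq_of_le ?_ (hk i)))
    rw [hmK]
    congr 1
    ring
  have hlog : ∀ x ∈ sphere (0 : E2) (Real.exp T), Real.log ‖x‖ = T := fun x hx => by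
    rw [show ‖x‖ = Real.exp T by simpa using hx, Real.log_exp]
  refine ⟨fun i => ?_, ?_, ?_⟩
  · simp only [hσK, hσ]
    exact S.tendsto_cylMass h0 hpt hdiv hK hη hneck i
  · obtain ⟨C, hC⟩ := S.exists_bound_sphere_of_eventually I₁
      (fun k i => -(mK A (Real.exp T) γ h u k i) * T
        - ((mK A (Real.exp T) γ h u k i - 2 * (1 + γ)) / 2) * M k) (by
        obtain ⟨C, hC⟩ := hcircle
        have hU : ∀ i ∈ I₁, ∃ B, ∀ᶠ k in atTop, (1 + γ) * M k - B ≤ u k i 0 := Sys.U₀_ge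
        choose! D hD using hU
        refine ⟨C + ∑ i, |D i|, ?_⟩
        filter_upwards [hC, (Finset.eventually_all I₁).2 hD] with k hk hDk i hi x hx
        have h1 := S.M_max k i 0 (by simp [Real.exp_nonneg])
        have h2 := Finset.single_le_sum (f := fun i => |D i|) (fun _ _ => abs_nonneg _)
          (Finset.mem_univ i)
        have h3 := hDk i hi
        have h4 := abs_le.1 (hk i x hx)
        have h5 := le_abs_self (D i)
        have h6 := abs_nonneg (D i)
        rw [abs_le]
        constructor <;> linarith [h4.1, h4.2])
    exact ⟨C, fun k i hi x hx => by rw [hlog x hx]; exact hC k i hi x hx⟩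
  · obtain ⟨C, hC⟩ := S.exists_bound_sphere_of_eventually Finset.univ
      (fun k i => -(mK A (Real.exp T) γ h u k i) * T
        - ((mK A (Real.exp T) γ h u k i - 2 * (1 + γ)) / 2) * M k
        + (u k i 0 - (1 + γ) * M k)) (by
        obtain ⟨C, hC⟩ := hcircle
        exact ⟨C, hC.mono fun k hk i _ => hk i⟩)
    exact ⟨C, fun k i _ x hx => by rw [hlog x hx]; exact hC k i (Finset.mem_univ i) x hx⟩
end
end
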